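/- (Stochastic domination by a shifted product measure.) Let V be a countable set, let J be symmetric interactions satisfying the integrability condition with n = 2 (with f, δ_f, M_f), let β ≥ 0, let a ≥ 4βM_f with 0 < ∫_ℝ e^{a|u|²}dρ(u) < ∞, assume ρ([0,∞)) > 0, and let 1 ≤ λ ≤ a/(4βM_f). Let C ≥ 1 and C̃ > 0 be the constants from the n = 2 regularity theorem. For a finite Λ ⊂ V and x ∈ Λ, set B_x = ( (2/a)( C̃·A(x,Λ,λ,ξ,C)² + log ρ_a(ℝ) − log ρ_{a/2}(ℝ) ) )^{1/2} and let ζ_x be the single-site measure dζ_x(u) = 1_{u ≥ B_x} dρ_a(u − B_x). Then for every finite Λ ⊂ V, every Λ' ⊂ Λ, and every ξ ∈ ℝ^V with Σ_{y∈V}|J_{x,y}ξ_y| < ∞ for all x ∈ Λ, the Λ'-marginal of ν^ξ_{Λ,β,ρ,J} is stochastically dominated by the normalized product measure ν^0_{Λ',0,ζ,0} = ∏_{x∈Λ'} dζ_x/ζ_x(ℝ). -/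

import Mathlib

open MeasureTheory
open scoped ENNReal Classical

/-- A walk of length `m` in `(R, J)`. -/
def IsWalk {V : Type*} (J : V → V → ℝ) (R : Set V) (m : ℕ) (w : ℕ → V) : Prop :=
  (∀ i, 0 < i → i < m → w i ∈ R) ∧ ∀ i < m, J (w i) (w (i + 1)) ≠ 0

/-- The quantity `A(x, R, λ, ξ, C)` (case `n = 2`). -/
noncomputable def ARealL {V : Type*} (J : V → V → ℝ) (f : ℝ → ℝ) (lam : ℝ)
    (ξ : V → ℝ) (C : ℝ) (x : V) (R : Set V) : ℝ :=
  sInf {A : ℝ | 1 ≤ A ∧ ∀ (m : ℕ) (w : ℕ → V), IsWalk J R m w → w 0 = x → w m ∈ R →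
    |∑' z : {z : V // z ∉ R}, J (w m) z.1 * ξ z.1| ≤
      (∑' z : {z : V // z ∉ R}, |J (w m) z.1| * f (J (w m) z.1)) * C * A * lam ^ (m + 1) *
        ∏ i ∈ Finset.range m, f (J (w i) (w (i + 1)))}

/-- The Hamiltonian `-H^ξ_{Λ,J}` (already multiplied by `β`). -/
noncomputable def hamil {V : Type*} (J : V → V → ℝ) (β : ℝ) (Λ : Finset V)
    (ξ : V → ℝ) (φ : ↥Λ → ℝ) : ℝ :=
  β * ((1 / 2) * ∑ x : ↥Λ, ∑ y : ↥Λ,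
      (if x.1 ≠ y.1 then J x.1 y.1 * φ x * φ y else 0)
    + ∑ x : ↥Λ, φ x * ∑' y : {y : V // y ∉ Λ}, J x.1 y.1 * ξ y.1)

/-- The finite-volume Gibbs measure `ν^ξ_{Λ,β,ρ,J}` on `ℝ^Λ`. -/
noncomputable def gibbs {V : Type*} (J : V → V → ℝ) (β : ℝ) (ρ : Measure ℝ)
    (Λ : Finset V) (ξ : V → ℝ) : Measure (↥Λ → ℝ) :=
  (((Measure.pi fun _ : ↥Λ => ρ).withDensity
      fun φ => ENNReal.ofReal (Real.exp (hamil J β Λ ξ φ))) Set.univ)⁻¹ •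
    (Measure.pi fun _ : ↥Λ => ρ).withDensity
      fun φ => ENNReal.ofReal (Real.exp (hamil J β Λ ξ φ))

/-- The `Λ'`-marginal of a measure on `ℝ^Λ`, for `Λ' ⊆ Λ`. -/
noncomputable def marg {V : Type*} {Λ' Λ : Finset V} (h : Λ' ⊆ Λ)
    (μ : Measure (↥Λ → ℝ)) : Measure (↥Λ' → ℝ) :=
  μ.map fun φ x => φ ⟨x.1, h x.2⟩

/-- The normalized product measure `ν^0_{Λ,0,ρ,0}`. -/
noncomputable def prodN {V : Type*} (ρ : Measure ℝ) (Λ : Finset V) :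
    Measure (↥Λ → ℝ) :=
  ((Measure.pi fun _ : ↥Λ => ρ) Set.univ)⁻¹ • Measure.pi fun _ : ↥Λ => ρ

/-- The tilted single-site measure `dρ_b(u) = e^(b|u|²) dρ(u)`. -/
noncomputable def rhoMod (ρ : Measure ℝ) (b : ℝ) : Measure ℝ :=
  ρ.withDensity fun u => ENNReal.ofReal (Real.exp (b * u ^ 2))

/-- The shifted truncated single-site measure `dζ_{a,B}(u) = 1_{u ≥ B} dρ_a(u - B)`. -/
noncomputable def zetaM (ρ : Measure ℝ) (a B : ℝ) : Measure ℝ :=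
  ((rhoMod ρ a).map (fun u => u + B)).restrict (Set.Ici B)

/-- Stochastic domination. -/
def StochDom {ι : Type*} (μ ν : Measure (ι → ℝ)) : Prop :=
  ∀ g : (ι → ℝ) → ℝ, Measurable g → Monotone g → (∃ K, ∀ φ, |g φ| ≤ K) →
    ∫ φ, g φ ∂μ ≤ ∫ φ, g φ ∂ν

set_option linter.unusedSectionVars false

namespace FinB

section gen
variable {L : Type*} [DistribLattice L] [Fintype L]

theorem holley' (f g μ : L → ℝ) (hf : ∀ a, 0 ≤ f a) (hg : ∀ a, 0 ≤ g a) (hμ : Monotone μ)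
    (h : ∀ a b, f a * g b ≤ f (a ⊓ b) * g (a ⊔ b)) :
    (∑ a, f a * μ a) * (∑ a, g a) ≤ (∑ a, g a * μ a) * ∑ a, f a := by
  obtain ⟨K, hK⟩ : ∃ K : ℝ, ∀ a, 0 ≤ μ a + K := by
    refine ⟨∑ a, |μ a|, fun a => ?_⟩
    have := Finset.single_le_sum (f := fun a => |μ a|) (fun _ _ => abs_nonneg _) (Finset.mem_univ a)
    have h2 := neg_abs_le (μ a)
    linarith
  have key := four_functions_theorem_univ g (fun a => f a * (μ a + K)) f (fun a => g a * (μ a + K))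
    hg (fun a => mul_nonneg (hf a) (hK a)) hf (fun a => mul_nonneg (hg a) (hK a)) (by
      intro a b
      have h1 := h b a
      have h2 : μ b + K ≤ μ (a ⊔ b) + K := by
        have := hμ (le_sup_right : b ≤ a ⊔ b); linarith
      calc g a * (f b * (μ b + K)) = (f b * g a) * (μ b + K) := by ring
        _ ≤ (f (b ⊓ a) * g (b ⊔ a)) * (μ (a ⊔ b) + K) :=
          mul_le_mul h1 h2 (hK b) (mul_nonneg (hf _) (hg _))
        _ = _ := by rw [inf_comm, sup_comm]; ring)
  simp only [mul_add, Finset.sum_add_distrib, ← Finset.sum_mul] at key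
  nlinarith [key]

theorem fkg' (W f g : L → ℝ) (hW : ∀ a, 0 ≤ W a) (hf : Monotone f) (hg : Monotone g)
    (h : ∀ a b, W a * W b ≤ W (a ⊓ b) * W (a ⊔ b)) :
    (∑ a, W a * f a) * (∑ a, W a * g a) ≤ (∑ a, W a) * ∑ a, W a * (f a * g a) := by
  obtain ⟨K, hK⟩ : ∃ K : ℝ, ∀ a, 0 ≤ f a + K ∧ 0 ≤ g a + K := by
    refine ⟨∑ a, (|f a| + |g a|), fun a => ?_⟩
    have := Finset.single_le_sum (f := fun a => |f a| + |g a|)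
      (fun _ _ => by positivity) (Finset.mem_univ a)
    have h2 := neg_abs_le (f a)
    have h3 := neg_abs_le (g a)
    have h4 := abs_nonneg (f a)
    have h5 := abs_nonneg (g a)
    constructor <;> linarith
  have key := fkg (μ := W) (f := fun a => f a + K) (g := fun a => g a + K) hW (fun a => (hK a).1)
    (fun a => (hK a).2) (fun a b hab => by have := hf hab; simpa using this)
    (fun a b hab => by have := hg hab; simpa using this) h
  have e1 : ∀ a, W a * ((f a + K) * (g a + K)) =
      W a * (f a * g a) + W a * f a * K + W a * g a * K + W a * K * K := fun a => by ring
  simp only [e1] at key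
  simp only [mul_add, Finset.sum_add_distrib, ← Finset.sum_mul] at key
  nlinarith [key]

end gen

section pi
variable {I : Type*} [Fintype I] {X : I → Type*} [∀ i, LinearOrder (X i)] [∀ i, Fintype (X i)]

/-- Unnormalised expectation. -/
noncomputable def ex (W F : (∀ i, X i) → ℝ) : ℝ := ∑ ψ, W ψ * F ψ

/-- Unnormalised covariance. -/
noncomputable def cov (W g F : (∀ i, X i) → ℝ) : ℝ :=
  (∑ ψ, W ψ) * ex W (fun ψ => g ψ * F ψ) - ex W g * ex W F

/-- Slice weight. -/
noncomputable def sl (W : (∀ i, X i) → ℝ) (i : I) (c : X i) (ψ : ∀ i, X i) : ℝ :=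
  if ψ i = c then W ψ else 0

/-- Conditional expectation given `ψ i = c`. -/
noncomputable def ce (W : (∀ i, X i) → ℝ) (i : I) (c : X i) (F : (∀ i, X i) → ℝ) : ℝ :=
  ex (sl W i c) F / ∑ ψ, sl W i c ψ

theorem ex_add (W F G : (∀ i, X i) → ℝ) : ex W (fun ψ => F ψ + G ψ) = ex W F + ex W G := by
  simp [ex, mul_add, Finset.sum_add_distrib]

theorem ex_sub (W F G : (∀ i, X i) → ℝ) : ex W (fun ψ => F ψ - G ψ) = ex W F - ex W G := by
  simp [ex, mul_sub, Finset.sum_sub_distrib]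

theorem ex_const_mul (W F : (∀ i, X i) → ℝ) (r : ℝ) : ex W (fun ψ => r * F ψ) = r * ex W F := by
  simp only [ex, Finset.mul_sum]
  exact Finset.sum_congr rfl fun _ _ => by ring

theorem ex_const (W : (∀ i, X i) → ℝ) (r : ℝ) : ex W (fun _ => r) = r * ∑ ψ, W ψ := by
  simp only [ex, Finset.mul_sum]
  exact Finset.sum_congr rfl fun _ _ => by ring

theorem ex_sum {ι : Type*} (s : Finset ι) (W : (∀ i, X i) → ℝ) (F : ι → (∀ i, X i) → ℝ) :
    ex W (fun ψ => ∑ j ∈ s, F j ψ) = ∑ j ∈ s, ex W (F j) := by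
  simp only [ex, Finset.mul_sum]
  exact Finset.sum_comm

theorem ex_mono {W F G : (∀ i, X i) → ℝ} (hW : ∀ ψ, 0 ≤ W ψ) (h : ∀ ψ, F ψ ≤ G ψ) :
    ex W F ≤ ex W G :=
  Finset.sum_le_sum fun ψ _ => mul_le_mul_of_nonneg_left (h ψ) (hW ψ)

theorem cov_add (W g F G : (∀ i, X i) → ℝ) :
    cov W g (fun ψ => F ψ + G ψ) = cov W g F + cov W g G := by
  simp only [cov, mul_add, ex_add]; ring

theorem cov_sub (W g F G : (∀ i, X i) → ℝ) :
    cov W g (fun ψ => F ψ - G ψ) = cov W g F - cov W g G := by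
  simp only [cov, mul_sub, ex_sub]; ring

theorem cov_const_mul (W g F : (∀ i, X i) → ℝ) (r : ℝ) :
    cov W g (fun ψ => r * F ψ) = r * cov W g F := by
  have : ∀ ψ, g ψ * (r * F ψ) = r * (g ψ * F ψ) := fun ψ => by ring
  simp only [cov, this, ex_const_mul]; ring

theorem cov_sum {ι : Type*} (s : Finset ι) (W g : (∀ i, X i) → ℝ) (F : ι → (∀ i, X i) → ℝ) :
    cov W g (fun ψ => ∑ j ∈ s, F j ψ) = ∑ j ∈ s, cov W g (F j) := by
  simp only [cov, Finset.mul_sum, ex_sum, Finset.sum_sub_distrib]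

/-- Log-supermodular. -/
def LS (W : (∀ i, X i) → ℝ) : Prop := ∀ a b, W a * W b ≤ W (a ⊓ b) * W (a ⊔ b)

theorem sl_nonneg {W : (∀ i, X i) → ℝ} (hW : ∀ ψ, 0 < W ψ) (i : I) (c : X i) (ψ) :
    0 ≤ sl W i c ψ := by
  unfold sl; split_ifs; exacts [(hW ψ).le, le_rfl]

theorem sl_pos [∀ i, Nonempty (X i)] {W : (∀ i, X i) → ℝ} (hW : ∀ ψ, 0 < W ψ) (i : I) (c : X i) :
    0 < ∑ ψ, sl W i c ψ := by
  have h0 : 0 < sl W i c (Function.update (fun i => Classical.arbitrary (X i)) i c) := by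
    simp [sl, hW]
  exact lt_of_lt_of_le h0 (Finset.single_le_sum (f := sl W i c) (fun ψ _ => sl_nonneg hW i c ψ)
    (Finset.mem_univ _))

theorem sl_holley {W : (∀ i, X i) → ℝ} (hW : ∀ ψ, 0 < W ψ) (hLS : LS W) (i : I) {c' c : X i}
    (h : c' ≤ c) (a b) : sl W i c' a * sl W i c b ≤ sl W i c' (a ⊓ b) * sl W i c (a ⊔ b) := by
  by_cases h1 : a i = c'
  · by_cases h2 : b i = c
    · have e1 : (a ⊓ b) i = c' := by simp [h1, h2, h]
      have e2 : (a ⊔ b) i = c := by simp [h1, h2, h]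
      simp only [sl, h1, h2, e1, e2, if_true]
      exact hLS a b
    · rw [show sl W i c b = 0 by simp [sl, h2]]
      simpa using mul_nonneg (sl_nonneg hW _ _ _) (sl_nonneg hW _ _ _)
  · rw [show sl W i c' a = 0 by simp [sl, h1]]
    simpa using mul_nonneg (sl_nonneg hW _ _ _) (sl_nonneg hW _ _ _)

theorem ce_mono_slice [∀ i, Nonempty (X i)] {W : (∀ i, X i) → ℝ} (hW : ∀ ψ, 0 < W ψ) (hLS : LS W)
    (i : I) {c' c : X i} (h : c' ≤ c) {F : (∀ i, X i) → ℝ} (hF : Monotone F) :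
    ce W i c' F ≤ ce W i c F := by
  unfold ce
  rw [div_le_div_iff₀ (sl_pos hW i c') (sl_pos hW i c)]
  exact holley' _ _ F (sl_nonneg hW i c') (sl_nonneg hW i c) hF (sl_holley hW hLS i h)

theorem ce_add (W : (∀ i, X i) → ℝ) (i : I) (c : X i) (F G : (∀ i, X i) → ℝ) :
    ce W i c (fun ψ => F ψ + G ψ) = ce W i c F + ce W i c G := by
  simp only [ce, ex_add, add_div]

theorem ce_sub (W : (∀ i, X i) → ℝ) (i : I) (c : X i) (F G : (∀ i, X i) → ℝ) :
    ce W i c (fun ψ => F ψ - G ψ) = ce W i c F - ce W i c G := by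
  simp only [ce, ex_sub, sub_div]

theorem ce_const_mul (W : (∀ i, X i) → ℝ) (i : I) (c : X i) (F : (∀ i, X i) → ℝ) (r : ℝ) :
    ce W i c (fun ψ => r * F ψ) = r * ce W i c F := by
  simp only [ce, ex_const_mul, mul_div_assoc]

theorem ce_const [∀ i, Nonempty (X i)] {W : (∀ i, X i) → ℝ} (hW : ∀ ψ, 0 < W ψ) (i : I) (c : X i)
    (r : ℝ) : ce W i c (fun _ => r) = r := by
  simp only [ce, ex_const]
  exact mul_div_cancel_right₀ _ (sl_pos hW i c).ne'

theorem ce_mono [∀ i, Nonempty (X i)] {W : (∀ i, X i) → ℝ} (hW : ∀ ψ, 0 < W ψ) (i : I) (c : X i)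
    {F G : (∀ i, X i) → ℝ} (h : ∀ ψ, F ψ ≤ G ψ) : ce W i c F ≤ ce W i c G := by
  unfold ce
  exact div_le_div_of_nonneg_right (ex_mono (sl_nonneg hW i c) h) (sl_pos hW i c).le

theorem ex_slices (W F : (∀ i, X i) → ℝ) (i : I) : ex W F = ∑ c, ex (sl W i c) F := by
  unfold ex
  rw [Finset.sum_comm]
  refine Finset.sum_congr rfl fun ψ _ => ?_
  simp [sl, ite_mul]

theorem ex_sl_congr (W : (∀ i, X i) → ℝ) (i : I) (c : X i) (A : X i → (∀ i, X i) → ℝ) :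
    ex (sl W i c) (fun ψ => A (ψ i) ψ) = ex (sl W i c) (A c) := by
  unfold ex
  refine Finset.sum_congr rfl fun ψ _ => ?_
  unfold sl; split_ifs with h
  · simp only [h]
  · simp

theorem ce_congr_slice (W : (∀ i, X i) → ℝ) (i : I) (c : X i) (A : X i → (∀ i, X i) → ℝ) :
    ce W i c (fun ψ => A (ψ i) ψ) = ce W i c (A c) := by
  unfold ce; rw [ex_sl_congr]

theorem slice_cov [∀ i, Nonempty (X i)] {W : (∀ i, X i) → ℝ} (hW : ∀ ψ, 0 < W ψ) (hLS : LS W)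
    (i : I) (A : X i → (∀ i, X i) → ℝ) (hA : ∀ c, Monotone (A c)) {g : (∀ i, X i) → ℝ}
    (hg : Monotone g) :
    cov W g (fun ψ => ce W i (ψ i) (A (ψ i))) ≤ cov W g (fun ψ => A (ψ i) ψ) := by
  have e1 : ex W (fun ψ => ce W i (ψ i) (A (ψ i))) = ex W (fun ψ => A (ψ i) ψ) := by
    rw [ex_slices W _ i, ex_slices W _ i]
    refine Finset.sum_congr rfl fun c _ => ?_
    rw [ex_sl_congr, ex_sl_congr W i c (fun c _ => ce W i c (A c)), ex_const]
    unfold ce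
    rw [div_mul_cancel₀ _ (sl_pos hW i c).ne']
  have e2 : ex W (fun ψ => g ψ * ce W i (ψ i) (A (ψ i))) ≤ ex W (fun ψ => g ψ * A (ψ i) ψ) := by
    rw [ex_slices W _ i, ex_slices W _ i]
    refine Finset.sum_le_sum fun c _ => ?_
    rw [ex_sl_congr W i c (fun c ψ => g ψ * A c ψ),
      ex_sl_congr W i c (fun c ψ => g ψ * ce W i c (A c))]
    have h3 : ex (sl W i c) (fun ψ => g ψ * ce W i c (A c)) =
        ce W i c (A c) * ex (sl W i c) g := by
      rw [← ex_const_mul]; simp only [mul_comm]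
    rw [h3]
    unfold ce
    rw [div_mul_eq_mul_div, div_le_iff₀ (sl_pos hW i c)]
    have := fkg' (sl W i c) g (A c) (sl_nonneg hW i c) hg (hA c) (sl_holley hW hLS i le_rfl)
    unfold ex
    linarith [this]
  unfold cov
  rw [e1]
  have hZ : 0 ≤ ∑ ψ, W ψ := Finset.sum_nonneg fun ψ _ => (hW ψ).le
  nlinarith [mul_le_mul_of_nonneg_left e2 hZ]

theorem cov_nonneg {W : (∀ i, X i) → ℝ} (hW : ∀ ψ, 0 < W ψ) (hLS : LS W) {g F : (∀ i, X i) → ℝ}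
    (hg : Monotone g) (hF : Monotone F) : 0 ≤ cov W g F := by
  have := fkg' W g F (fun ψ => (hW ψ).le) hg hF hLS
  unfold cov ex; linarith

theorem PC [∀ i, Nonempty (X i)] {W : (∀ i, X i) → ℝ} (hW : ∀ ψ, 0 < W ψ) (hLS : LS W)
    (i j : I) (A D : X i → X j → ℝ) (r : X j → ℝ) (hA : ∀ c, Monotone (A c))
    (h2 : ∀ c' c y, c' ≤ c → 0 ≤ D c y - D c' y + ce W i c' (fun ψ => A c (ψ j) - A c' (ψ j)))
    (h3 : ∀ y' y, y' ≤ y → 0 ≤ ce W j y' (fun ψ => D (ψ i) y - D (ψ i) y') + (r y - r y'))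
    {g : (∀ i, X i) → ℝ} (hg : Monotone g) :
    0 ≤ cov W g (fun ψ => A (ψ i) (ψ j) + D (ψ i) (ψ j) + r (ψ j)) := by
  have s1 := slice_cov hW hLS i (fun c ψ => A c (ψ j)) (fun c a b hab => hA c (hab j)) hg
  have hB : ∀ y, Monotone (fun c => ce W i c (fun ψ => A c (ψ j)) + D c y) := by
    intro y c' c hc
    have t1 := h2 c' c y hc
    rw [ce_sub] at t1
    have t2 := ce_mono_slice hW hLS i hc (F := fun ψ => A c (ψ j)) (fun a b hab => hA c (hab j))
    simp only
    linarith
  have s2 := slice_cov hW hLS j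
    (fun y ψ => (fun c => ce W i c (fun ψ' => A c (ψ' j)) + D c y) (ψ i))
    (fun y a b hab => hB y (hab i)) hg
  have s3 : 0 ≤ cov W g (fun ψ => ce W j (ψ j) ((fun y ψ =>
      (fun c => ce W i c (fun ψ' => A c (ψ' j)) + D c y) (ψ i)) (ψ j)) + r (ψ j)) := by
    refine cov_nonneg hW hLS hg fun a b hab => ?_
    have hy := hab j
    have t1 := h3 _ _ hy
    rw [ce_sub] at t1
    have t2 := ce_mono_slice hW hLS j hy
      (F := fun ψ => (fun c => ce W i c (fun ψ' => A c (ψ' j)) + D c (b j)) (ψ i))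
      (fun a' b' hab' => hB (b j) (hab' i))
    simp only [ce_add] at t2 ⊢
    linarith
  rw [cov_add] at s3
  simp only [cov_add] at s1 s2 s3 ⊢
  linarith


theorem moment [∀ i, Nonempty (X i)] {W : (∀ i, X i) → ℝ} (hW : ∀ ψ, 0 < W ψ)
    (e : ∀ i, X i → ℝ) (he : ∀ i c, 0 ≤ e i c)
    (K : I → I → ℝ) (hK : ∀ i j, 0 ≤ K i j)
    (κ γ : ℝ) (hκ : 0 ≤ κ) (ε' ε : I → ℝ)
    (hε : ∀ l, ε' l + κ * ∑ j, K l j * ε j ≤ ε l)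
    (hγ : ∀ l i, κ * (γ * ∑ j, K l j + (1 - γ) * K l i) ≤ γ)
    (hγ1 : γ ≤ 1) (hε0 : ∀ l, 0 ≤ ε l)
    (hcontr : ∀ l, κ * ∑ j, K l j < 1)
    (hloc : ∀ l (ψ : ∀ i, X i), ∑ t, W (Function.update ψ l t) * e l t ≤
      (ε' l + κ * ∑ j, K l j * e j (ψ j)) * ∑ t, W (Function.update ψ l t))
    (hKd : ∀ i, K i i = 0)
    (i : I) (c : X i) (l : I) (hl : l ≠ i) :
    ce W i c (fun ψ => e l (ψ l)) ≤ ε l + γ * e i c := by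
  set x : I → ℝ := fun l => ce W i c (fun ψ => e l (ψ l)) with hx
  have hxi : x i = e i c := by
    simp only [hx]
    rw [ce_congr_slice W i c (fun c _ => e i c)]
    exact ce_const hW i c _
  have hmain : ∀ l, l ≠ i → x l ≤ ε' l + κ * ∑ j, K l j * x j := by
    intro l hl
    have hswap : ∀ F : (∀ i, X i) → ℝ, (Fintype.card (X l) : ℝ) * ∑ ψ, F ψ =
        ∑ ψ : (∀ i, X i), ∑ t, F (Function.update ψ l t) := by
      intro F
      have hbij : ∑ p : (∀ i, X i) × X l, F (Function.update p.1 l p.2) =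
          ∑ p : (∀ i, X i) × X l, F p.1 := by
        let E : (∀ i, X i) × X l ≃ (∀ i, X i) × X l :=
          { toFun := fun p => (Function.update p.1 l p.2, p.1 l)
            invFun := fun p => (Function.update p.1 l p.2, p.1 l)
            left_inv := fun p => by simp
            right_inv := fun p => by simp }
        exact Fintype.sum_equiv E _ _ (fun p => rfl)
      rw [Fintype.sum_prod_type, Fintype.sum_prod_type] at hbij
      rw [hbij]
      simp [Finset.mul_sum]
    have hcard : 0 < (Fintype.card (X l) : ℝ) := by exact_mod_cast Fintype.card_pos
    have key : ∑ ψ, sl W i c ψ * e l (ψ l) ≤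
        ∑ ψ, sl W i c ψ * (ε' l + κ * ∑ j, K l j * e j (ψ j)) := by
      refine le_of_mul_le_mul_left ?_ hcard
      rw [hswap, hswap]
      refine Finset.sum_le_sum fun ψ _ => ?_
      have h1 : ∀ t, sl W i c (Function.update ψ l t) =
          if ψ i = c then W (Function.update ψ l t) else 0 := by
        intro t; simp [sl, Function.update_of_ne hl.symm]
      have h2 : ∀ t, ∑ j, K l j * e j (Function.update ψ l t j) = ∑ j, K l j * e j (ψ j) := by
        intro t
        refine Finset.sum_congr rfl fun j _ => ?_
        by_cases hj : j = l
        · subst hj; simp [hKd]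
        · rw [Function.update_of_ne hj]
      simp only [h1, h2, Function.update_self]
      by_cases hc : ψ i = c
      · simp only [hc, if_true]
        rw [← Finset.sum_mul, mul_comm (∑ t, _)]
        exact hloc l ψ
      · simp [hc]
    have key2 : x l ≤ ce W i c (fun ψ => ε' l + κ * ∑ j, K l j * e j (ψ j)) := by
      simp only [hx, ce]
      exact div_le_div_of_nonneg_right key (sl_pos hW i c).le
    refine key2.trans (le_of_eq ?_)
    rw [ce_add, ce_const hW, ce_const_mul]
    congr 2
    simp only [ce, ex_sum, Finset.sum_div, hx]
    refine Finset.sum_congr rfl fun j _ => ?_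
    have := ce_const_mul W i c (fun ψ => e j (ψ j)) (K l j)
    simpa only [ce] using this
  by_contra hcon
  push Not at hcon
  obtain ⟨m, hm, hmax⟩ := Finset.exists_max_image (Finset.univ.filter (fun l => l ≠ i))
    (fun l => x l - ε l - γ * e i c) ⟨l, by simpa using hl⟩
  set v := x m - ε m - γ * e i c with hv
  have hv0 : 0 < v := by
    have := hmax l (by simpa using hl)
    have h3 : ε l + γ * e i c < x l := hcon
    linarith
  have hmi : m ≠ i := by simpa using hm
  have h1 := hmain m hmi
  have h2 : ∑ j, K m j * x j ≤ ∑ j, K m j * ε j + (∑ j, K m j * v)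
      + (∑ j, K m j * (γ * e i c)) + K m i * ((1 - γ) * e i c) := by
    have h4 : K m i * ((1 - γ) * e i c) =
        ∑ j, if j = i then K m j * ((1 - γ) * e i c) else 0 := by simp
    rw [h4, ← Finset.sum_add_distrib, ← Finset.sum_add_distrib, ← Finset.sum_add_distrib]
    refine Finset.sum_le_sum fun j _ => ?_
    by_cases hj : j = i
    · subst hj
      rw [hxi, if_pos rfl]
      have := hε0 j
      have := hK m j
      nlinarith [mul_nonneg this (hε0 j), mul_nonneg this hv0.le]
    · rw [if_neg hj]
      have h5 := hmax j (by simpa using hj)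
      have h6 := hK m j
      nlinarith [mul_le_mul_of_nonneg_left h5 h6]
  rw [← Finset.sum_mul, ← Finset.sum_mul] at h2
  have h7 := hε m
  have h8 := mul_le_mul_of_nonneg_right (hγ m i) (he i c)
  have h9 := mul_lt_mul_of_pos_right (hcontr m) hv0
  have h10 := mul_le_mul_of_nonneg_left h2 hκ
  nlinarith

theorem LS_of_exp (w : ∀ i, X i → ℝ) (hw : ∀ i c, 0 < w i c) (H : (∀ i, X i) → ℝ)
    (hH : ∀ a b, H a + H b ≤ H (a ⊓ b) + H (a ⊔ b)) :
    LS (fun ψ : ∀ i, X i => (∏ i, w i (ψ i)) * Real.exp (H ψ)) := by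
  intro a b
  have h1 : (∏ i, w i (a i)) * ∏ i, w i (b i) =
      (∏ i, w i ((a ⊓ b) i)) * ∏ i, w i ((a ⊔ b) i) := by
    rw [← Finset.prod_mul_distrib, ← Finset.prod_mul_distrib]
    refine Finset.prod_congr rfl fun i _ => ?_
    rcases le_total (a i) (b i) with h | h
    · simp [h]
    · simp [h, mul_comm]
  have h2 : Real.exp (H a) * Real.exp (H b) ≤ Real.exp (H (a ⊓ b)) * Real.exp (H (a ⊔ b)) := by
    rw [← Real.exp_add, ← Real.exp_add]; exact Real.exp_le_exp.2 (hH a b)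
  have h3 : 0 ≤ (∏ i, w i (a i)) * ∏ i, w i (b i) :=
    mul_nonneg (Finset.prod_nonneg fun i _ => (hw _ _).le)
      (Finset.prod_nonneg fun i _ => (hw _ _).le)
  calc _ = ((∏ i, w i (a i)) * ∏ i, w i (b i)) * (Real.exp (H a) * Real.exp (H b)) := by ring
    _ ≤ ((∏ i, w i (a i)) * ∏ i, w i (b i)) * (Real.exp (H (a ⊓ b)) * Real.exp (H (a ⊔ b))) :=
      mul_le_mul_of_nonneg_left h2 h3
    _ = _ := by rw [h1]; ring

theorem supermod_mul {i j : I} (hij : i ≠ j) (u : X i → ℝ) (v : X j → ℝ) (hu : Monotone u)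
    (hv : Monotone v) (a b : ∀ i, X i) :
    u (a i) * v (a j) + u (b i) * v (b j) ≤
      u ((a ⊓ b) i) * v ((a ⊓ b) j) + u ((a ⊔ b) i) * v ((a ⊔ b) j) := by
  rcases le_total (a i) (b i) with h | h <;> rcases le_total (a j) (b j) with h' | h' <;>
    simp only [Pi.inf_apply, Pi.sup_apply, h, h', inf_of_le_left, inf_of_le_right, sup_of_le_left,
      sup_of_le_right] <;> nlinarith [hu h, hv h', mul_nonneg (sub_nonneg.2 (hu h)) (sub_nonneg.2 (hv h'))]

/-- the weight `ν_s` -/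
noncomputable def Ws (w m e k : ∀ i, X i → ℝ) (K : I → I → ℝ) (s : ℝ) (ψ : ∀ i, X i) : ℝ :=
  (∏ i, w i (ψ i)) * Real.exp (s * ∑ i, k i (ψ i) + (1 - s) * ∑ i, ∑ j,
    K i j * (m i (ψ i) * e j (ψ j) + 1 / 2 * (e i (ψ i) * e j (ψ j))))

theorem thmB [∀ i, Nonempty (X i)] (w m e k : ∀ i, X i → ℝ) (hw : ∀ i c, 0 < w i c)
    (he : ∀ i c, 0 ≤ e i c) (hem : ∀ i, Monotone (e i)) (hmm : ∀ i, Monotone (m i))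
    (hme : ∀ i c c', c' ≤ c → m i c ≠ m i c' → e i c' = 0)
    (M : I → ℝ) (hM : ∀ i c, m i c ≤ M i)
    (K : I → I → ℝ) (hK : ∀ i j, 0 ≤ K i j) (hKs : ∀ i j, K i j = K j i) (hKd : ∀ i, K i i = 0)
    (κ γ : ℝ) (hκ : 0 ≤ κ) (ε' ε : I → ℝ)
    (hε : ∀ l, ε' l + κ * ∑ j, K l j * ε j ≤ ε l)
    (hγ : ∀ l i, κ * (γ * ∑ j, K l j + (1 - γ) * K l i) ≤ γ)
    (hγ0 : 0 ≤ γ) (hγ1 : γ ≤ 1) (hε0 : ∀ l, 0 ≤ ε l)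
    (hcontr : ∀ l, κ * ∑ j, K l j < 1)
    (hloc : ∀ s, 0 ≤ s → s ≤ 1 → ∀ l (ψ : ∀ i, X i),
      ∑ t, Ws w m e k K s (Function.update ψ l t) * e l t ≤
      (ε' l + κ * ∑ j, K l j * e j (ψ j)) * ∑ t, Ws w m e k K s (Function.update ψ l t))
    (hk : ∀ i, Monotone (fun c => k i c - ∑ j, K i j *
      (ε j * m i c + (M j + ε j) * e i c + (1 + γ) / 2 * e i c ^ 2)))
    (g : (∀ i, X i) → ℝ) (hg : Monotone g) :
    ex (Ws w m e k K 0) g * (∑ ψ, Ws w m e k K 1 ψ) ≤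
      ex (Ws w m e k K 1) g * (∑ ψ, Ws w m e k K 0 ψ) := by
  have hWpos : ∀ s ψ, 0 < Ws w m e k K s ψ := fun s ψ =>
    mul_pos (Finset.prod_pos fun i _ => hw _ _) (Real.exp_pos _)
  have hLS : ∀ s, 0 ≤ s → s ≤ 1 → LS (Ws w m e k K s) := by
    intro s hs0 hs1
    refine LS_of_exp w hw _ fun a b => ?_
    have h1 : ∑ i, k i (a i) + ∑ i, k i (b i) = ∑ i, k i ((a ⊓ b) i) + ∑ i, k i ((a ⊔ b) i) := by
      rw [← Finset.sum_add_distrib, ← Finset.sum_add_distrib]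
      refine Finset.sum_congr rfl fun i _ => ?_
      rcases le_total (a i) (b i) with h | h
      · simp [h]
      · simp [h, add_comm]
    have h2 : ∑ i, ∑ j, K i j * (m i (a i) * e j (a j) + 1 / 2 * (e i (a i) * e j (a j))) +
        ∑ i, ∑ j, K i j * (m i (b i) * e j (b j) + 1 / 2 * (e i (b i) * e j (b j))) ≤
        ∑ i, ∑ j, K i j * (m i ((a ⊓ b) i) * e j ((a ⊓ b) j) +
          1 / 2 * (e i ((a ⊓ b) i) * e j ((a ⊓ b) j))) +
        ∑ i, ∑ j, K i j * (m i ((a ⊔ b) i) * e j ((a ⊔ b) j) +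
          1 / 2 * (e i ((a ⊔ b) i) * e j ((a ⊔ b) j))) := by
      simp only [← Finset.sum_add_distrib]
      refine Finset.sum_le_sum fun i _ => Finset.sum_le_sum fun j _ => ?_
      by_cases hij : i = j
      · subst hij; simp [hKd]
      · have t1 := supermod_mul hij (m i) (e j) (hmm i) (hem j) a b
        have t2 := supermod_mul hij (e i) (e j) (hem i) (hem j) a b
        have t3 := mul_le_mul_of_nonneg_left (add_le_add t1
          (mul_le_mul_of_nonneg_left t2 (by norm_num : (0 : ℝ) ≤ 1 / 2))) (hK i j)
        nlinarith [t3]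
    have h3 := mul_le_mul_of_nonneg_left h2 (sub_nonneg.2 hs1)
    linear_combination h3 + s * h1
  set Ψ : (∀ i, X i) → ℝ := fun ψ => ∑ i, k i (ψ i) - ∑ i, ∑ j,
    K i j * (m i (ψ i) * e j (ψ j) + 1 / 2 * (e i (ψ i) * e j (ψ j))) with hΨ
  have hcov : ∀ s, 0 ≤ s → s ≤ 1 → 0 ≤ cov (Ws w m e k K s) g Ψ := by
    intro s hs0 hs1
    set W := Ws w m e k K s with hWdef
    have hW := hWpos s
    have hL := hLS s hs0 hs1
    have hmom := moment hW e he K hK κ γ hκ ε' ε hε hγ hγ1 hε0 hcontr (hloc s hs0 hs1) hKd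
    have term1 : ∀ i j, i ≠ j → cov W g (fun ψ => m i (ψ i) * e j (ψ j)) ≤
        M i * cov W g (fun ψ => e j (ψ j)) + ε j * cov W g (fun ψ => m i (ψ i)) := by
      intro i j hij
      have := PC hW hL i j (fun c y => (M i - m i c) * e j y) (fun c y => ε j * m i c) (fun _ => 0)
        (fun c y y' h => mul_le_mul_of_nonneg_left (hem j h) (sub_nonneg.2 (hM i c)))
        (by
          intro c' c y hc
          have e1 : ∀ ψ : ∀ i, X i, (M i - m i c) * e j (ψ j) - (M i - m i c') * e j (ψ j) =
            (m i c' - m i c) * e j (ψ j) := fun ψ => by ring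
          simp only [e1, ce_const_mul]
          by_cases hmc : m i c = m i c'
          · simp [hmc]
          · have h1 := hmom i c' j hij.symm
            rw [hme i c c' hc hmc] at h1
            have h2 := hmm i hc
            nlinarith [mul_le_mul_of_nonneg_left h1 (sub_nonneg.2 h2)])
        (by
          intro y' y hy
          simp only [sub_self, add_zero]
          rw [ce_const hW])
        hg
      have e2 : (fun ψ : ∀ i, X i => (M i - m i (ψ i)) * e j (ψ j) + ε j * m i (ψ i) + 0) =
          (fun ψ => (M i * e j (ψ j) + ε j * m i (ψ i)) - m i (ψ i) * e j (ψ j)) := by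
        funext ψ; ring
      rw [e2, cov_sub, cov_add, cov_const_mul, cov_const_mul] at this
      linarith
    have term3 : ∀ i j, i ≠ j → cov W g (fun ψ => e i (ψ i) * e j (ψ j)) ≤
        (1 + γ) / 2 * cov W g (fun ψ => e i (ψ i) ^ 2) + (1 + γ) / 2 * cov W g (fun ψ => e j (ψ j) ^ 2)
        + ε j * cov W g (fun ψ => e i (ψ i)) + ε i * cov W g (fun ψ => e j (ψ j)) := by
      intro i j hij
      have aux : ∀ x s s' : ℝ, 0 ≤ x → 0 ≤ s' → s' ≤ s →
          -((s - s') * x) ≤ 1 / 2 * (max (x - s) 0) ^ 2 - 1 / 2 * (max (x - s') 0) ^ 2 := by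
        intro x s s' hx hs' hss
        rcases le_total (x - s) 0 with h | h <;> rcases le_total (x - s') 0 with h' | h' <;>
          simp only [max_eq_left, max_eq_right, h, h'] <;>
          nlinarith [mul_nonneg (sub_nonneg.2 hss) hx,
            mul_nonneg (sub_nonneg.2 hss) hs', mul_nonneg (sub_nonneg.2 hss) (hs'.trans hss),
            mul_le_mul_of_nonneg_left h (sub_nonneg.2 hss), mul_nonneg hx hs',
            mul_le_mul_of_nonneg_left h hx, mul_le_mul_of_nonneg_left h hs',
            mul_self_nonneg (x - s')]
      have auxm : ∀ x s s' : ℝ, s' ≤ s →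
          1 / 2 * (max (s' - x) 0) ^ 2 ≤ 1 / 2 * (max (s - x) 0) ^ 2 := by
        intro x s s' h
        have : max (s' - x) 0 ≤ max (s - x) 0 := max_le_max (by linarith) le_rfl
        have h0 : 0 ≤ max (s' - x) 0 := le_max_right _ _
        nlinarith
      have := PC hW hL i j (fun c y => 1 / 2 * (max (e j y - e i c) 0) ^ 2)
        (fun c y => 1 / 2 * (max (e i c - e j y) 0) ^ 2 + (ε j * e i c + γ / 2 * e i c ^ 2))
        (fun y => ε i * e j y + γ / 2 * e j y ^ 2)
        (fun c y y' h => auxm _ _ _ (hem j h))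
        (by
          intro c' c y hc
          have h1 := hem i hc
          have h2 := auxm (e j y) _ _ h1
          have h3 : ce W i c' (fun ψ => -(e i c - e i c') * e j (ψ j)) ≤
            ce W i c' (fun ψ => 1 / 2 * (max (e j (ψ j) - e i c) 0) ^ 2 -
              1 / 2 * (max (e j (ψ j) - e i c') 0) ^ 2) :=
            ce_mono hW i c' fun ψ => by
              have := aux (e j (ψ j)) (e i c) (e i c') (he _ _) (he _ _) h1
              linarith
          rw [ce_const_mul] at h3
          have h4 := hmom i c' j hij.symm
          have h5 := mul_le_mul_of_nonneg_left h4 (sub_nonneg.2 h1)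
          have h6 : 0 ≤ γ * (e i c - e i c') ^ 2 := by positivity
          nlinarith)
        (by
          intro y' y hy
          have h1 := hem j hy
          have h3 : ce W j y' (fun ψ => -(e j y - e j y') * e i (ψ i)) ≤
            ce W j y' (fun ψ => 1 / 2 * (max (e i (ψ i) - e j y) 0) ^ 2 +
              (ε j * e i (ψ i) + γ / 2 * e i (ψ i) ^ 2) -
              (1 / 2 * (max (e i (ψ i) - e j y') 0) ^ 2 +
              (ε j * e i (ψ i) + γ / 2 * e i (ψ i) ^ 2))) :=
            ce_mono hW j y' fun ψ => by
              have := aux (e i (ψ i)) (e j y) (e j y') (he _ _) (he _ _) h1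
              linarith
          rw [ce_const_mul] at h3
          have h4 := hmom j y' i hij
          have h5 := mul_le_mul_of_nonneg_left h4 (sub_nonneg.2 h1)
          have h6 : 0 ≤ γ * (e j y - e j y') ^ 2 := by positivity
          nlinarith)
        hg
      have e2 : (fun ψ : ∀ i, X i => 1 / 2 * (max (e j (ψ j) - e i (ψ i)) 0) ^ 2 +
          (1 / 2 * (max (e i (ψ i) - e j (ψ j)) 0) ^ 2 +
            (ε j * e i (ψ i) + γ / 2 * e i (ψ i) ^ 2)) + (ε i * e j (ψ j) + γ / 2 * e j (ψ j) ^ 2)) =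
          (fun ψ => ((((1 + γ) / 2 * e i (ψ i) ^ 2 + (1 + γ) / 2 * e j (ψ j) ^ 2) +
            ε j * e i (ψ i)) + ε i * e j (ψ j)) - e i (ψ i) * e j (ψ j)) := by
        funext ψ
        rcases le_total (e i (ψ i)) (e j (ψ j)) with h | h
        · rw [max_eq_left (by linarith), max_eq_right (by linarith)]; ring
        · rw [max_eq_right (by linarith), max_eq_left (by linarith)]; ring
      rw [e2, cov_sub, cov_add, cov_add, cov_add, cov_const_mul, cov_const_mul, cov_const_mul,
        cov_const_mul] at this
      linarith
    have hmono : 0 ≤ ∑ i, cov W g (fun ψ => k i (ψ i) - ∑ j, K i j *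
        (ε j * m i (ψ i) + (M j + ε j) * e i (ψ i) + (1 + γ) / 2 * e i (ψ i) ^ 2)) :=
      Finset.sum_nonneg fun i _ => cov_nonneg hW hL hg fun a b hab => hk i (hab i)
    have e3 : ∀ i, cov W g (fun ψ => k i (ψ i) - ∑ j, K i j *
        (ε j * m i (ψ i) + (M j + ε j) * e i (ψ i) + (1 + γ) / 2 * e i (ψ i) ^ 2)) =
        cov W g (fun ψ => k i (ψ i)) - ∑ j, K i j * (ε j * cov W g (fun ψ => m i (ψ i)) +
          (M j + ε j) * cov W g (fun ψ => e i (ψ i)) +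
          (1 + γ) / 2 * cov W g (fun ψ => e i (ψ i) ^ 2)) := by
      intro i
      rw [cov_sub, cov_sum]
      simp only [cov_const_mul, cov_add]
    have e4 : cov W g Ψ = ∑ i, cov W g (fun ψ => k i (ψ i)) - ∑ i, ∑ j,
        K i j * (cov W g (fun ψ => m i (ψ i) * e j (ψ j)) +
          1 / 2 * cov W g (fun ψ => e i (ψ i) * e j (ψ j))) := by
      rw [hΨ, cov_sub, cov_sum, cov_sum]
      simp only [cov_sum, cov_const_mul, cov_add]
    rw [e4]
    simp only [e3, Finset.sum_sub_distrib] at hmono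
    have e5 : ∑ i, ∑ j, K i j * (cov W g (fun ψ => m i (ψ i) * e j (ψ j)) +
          1 / 2 * cov W g (fun ψ => e i (ψ i) * e j (ψ j))) ≤
        ∑ i, ∑ j, K i j * ((M i * cov W g (fun ψ => e j (ψ j)) + ε j * cov W g (fun ψ => m i (ψ i))) +
          1 / 2 * ((1 + γ) / 2 * cov W g (fun ψ => e i (ψ i) ^ 2) +
            (1 + γ) / 2 * cov W g (fun ψ => e j (ψ j) ^ 2)
        + ε j * cov W g (fun ψ => e i (ψ i)) + ε i * cov W g (fun ψ => e j (ψ j)))) := by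
      refine Finset.sum_le_sum fun i _ => Finset.sum_le_sum fun j _ => ?_
      by_cases hij : i = j
      · subst hij; simp [hKd]
      · exact mul_le_mul_of_nonneg_left (add_le_add (term1 i j hij)
          (mul_le_mul_of_nonneg_left (term3 i j hij) (by norm_num))) (hK i j)
    have e6 : ∑ i, ∑ j, K i j * ((M i * cov W g (fun ψ => e j (ψ j)) +
            ε j * cov W g (fun ψ => m i (ψ i))) +
          1 / 2 * ((1 + γ) / 2 * cov W g (fun ψ => e i (ψ i) ^ 2) +
            (1 + γ) / 2 * cov W g (fun ψ => e j (ψ j) ^ 2)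
        + ε j * cov W g (fun ψ => e i (ψ i)) + ε i * cov W g (fun ψ => e j (ψ j)))) =
        ∑ i, ∑ j, K i j * (ε j * cov W g (fun ψ => m i (ψ i)) +
          (M j + ε j) * cov W g (fun ψ => e i (ψ i)) +
          (1 + γ) / 2 * cov W g (fun ψ => e i (ψ i) ^ 2)) := by
      have sw : ∀ F : I → I → ℝ, ∑ i, ∑ j, K i j * F i j = ∑ i, ∑ j, K i j * F j i := by
        intro F
        rw [Finset.sum_comm]
        refine Finset.sum_congr rfl fun i _ => Finset.sum_congr rfl fun j _ => by rw [hKs]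
      have s1 := sw (fun i j => M i * cov W g (fun ψ => e j (ψ j)) +
        1 / 2 * ((1 + γ) / 2 * cov W g (fun ψ => e j (ψ j) ^ 2) + ε i * cov W g (fun ψ => e j (ψ j))))
      have s2 : ∀ F G : I → I → ℝ, ∑ i, ∑ j, K i j * (F i j + G i j) =
          ∑ i, ∑ j, K i j * F i j + ∑ i, ∑ j, K i j * G i j := by
        intro F G
        simp only [mul_add, Finset.sum_add_distrib]
      have s3 := s2 (fun i j => M i * cov W g (fun ψ => e j (ψ j)) +
        1 / 2 * ((1 + γ) / 2 * cov W g (fun ψ => e j (ψ j) ^ 2) + ε i * cov W g (fun ψ => e j (ψ j))))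
        (fun i j => ε j * cov W g (fun ψ => m i (ψ i)) + 1 / 2 * ((1 + γ) / 2 *
          cov W g (fun ψ => e i (ψ i) ^ 2) + ε j * cov W g (fun ψ => e i (ψ i))))
      rw [s1, ← s2] at s3
      refine Eq.trans ?_ (s3.trans ?_)
      · refine Finset.sum_congr rfl fun i _ => Finset.sum_congr rfl fun j _ => ?_
        ring
      · refine Finset.sum_congr rfl fun i _ => Finset.sum_congr rfl fun j _ => ?_
        ring
    linarith
  -- derivative in s
  set Z : ℝ → ℝ := fun s => ∑ ψ, Ws w m e k K s ψ with hZ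
  set G : ℝ → ℝ := fun s => ex (Ws w m e k K s) g with hG
  have hZpos : ∀ s, 0 < Z s := fun s => Finset.sum_pos (fun ψ _ => hWpos s ψ)
    ⟨fun i => Classical.arbitrary (X i), Finset.mem_univ _⟩
  have hWd : ∀ s ψ, HasDerivAt (fun s => Ws w m e k K s ψ) (Ws w m e k K s ψ * Ψ ψ) s := by
    intro s ψ
    unfold Ws
    have h1 : HasDerivAt (fun s : ℝ => s * ∑ i, k i (ψ i) + (1 - s) * ∑ i, ∑ j,
      K i j * (m i (ψ i) * e j (ψ j) + 1 / 2 * (e i (ψ i) * e j (ψ j)))) (Ψ ψ) s := by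
      have := ((hasDerivAt_id s).mul_const (∑ i, k i (ψ i))).add
        (((hasDerivAt_id s).const_sub 1).mul_const (∑ i, ∑ j,
          K i j * (m i (ψ i) * e j (ψ j) + 1 / 2 * (e i (ψ i) * e j (ψ j)))))
      refine this.congr_deriv ?_
      simp only [hΨ]; ring
    refine (h1.exp.const_mul _).congr_deriv ?_
    ring
  have hZd : ∀ s, HasDerivAt Z (ex (Ws w m e k K s) Ψ) s := fun s =>
    HasDerivAt.fun_sum fun ψ _ => hWd s ψ
  have hGd : ∀ s, HasDerivAt G (ex (Ws w m e k K s) (fun ψ => g ψ * Ψ ψ)) s := fun s => by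
    have := HasDerivAt.fun_sum (u := Finset.univ) (fun ψ _ => (hWd s ψ).mul_const (g ψ))
    refine this.congr_deriv ?_
    exact Finset.sum_congr rfl fun ψ _ => by ring
  have hmon : MonotoneOn (fun s => G s / Z s) (Set.Icc 0 1) := by
    have hd : ∀ s, HasDerivAt (fun s => G s / Z s) _ s := fun s =>
      (hGd s).div (hZd s) (hZpos s).ne'
    refine monotoneOn_of_deriv_nonneg (convex_Icc 0 1)
      (fun s _ => (hd s).continuousAt.continuousWithinAt)
      (fun s _ => (hd s).differentiableAt.differentiableWithinAt) ?_
    intro s hs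
    rw [interior_Icc] at hs
    rw [(hd s).deriv]
    refine div_nonneg ?_ (sq_nonneg _)
    have := hcov s hs.1.le hs.2.le
    unfold cov at this
    simp only [hZ, hG]
    linarith
  have := hmon (Set.left_mem_Icc.2 zero_le_one) (Set.right_mem_Icc.2 zero_le_one) zero_le_one
  simp only at this
  rw [div_le_div_iff₀ (hZpos 0) (hZpos 1)] at this
  exact this

end pi
end FinB

namespace FinB

theorem stepA_exp {ι : Type*} [Fintype ι] (K : ι → ι → ℝ) (hKs : ∀ x y, K x y = K y x)
    (T θ ths s s0 Mb Eb Mv Ev Ea : ι → ℝ)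
    (hths : ∀ x, ths x = |θ x| + ∑ y, |K x y| * T y)
    (h1 : ∀ x, |s x - s0 x| ≤ (Mv x + Ev x) - (Mb x + Eb x))
    (h2 : ∀ x, |s x| ≤ T x + Ea x) (h3 : ∀ x, |s0 x| ≤ T x + Eb x)
    (h4 : ∀ x, Ea x ≤ Ev x) (h5 : ∀ x, Eb x ≤ Ev x) (h6 : ∀ x, Mb x ≤ Mv x)
    (h7 : ∀ x, 0 ≤ Eb x) (h8 : ∀ x, 0 ≤ Mb x) :
    (∑ x, θ x * s x + 1 / 2 * ∑ x, ∑ y, K x y * s x * s y) +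
      (∑ x, ths x * (Mb x + Eb x) + ∑ x, ∑ y, |K x y| * (Mb x * Eb y + 1 / 2 * (Eb x * Eb y))) ≤
    (∑ x, θ x * s0 x + 1 / 2 * ∑ x, ∑ y, K x y * s0 x * s0 y) +
      (∑ x, ths x * (Mv x + Ev x) + ∑ x, ∑ y, |K x y| * (Mv x * Ev y + 1 / 2 * (Ev x * Ev y))) := by
  have sw : ∀ F : ι → ι → ℝ, ∑ i, ∑ j, |K i j| * F i j = ∑ i, ∑ j, |K i j| * F j i := by
    intro F
    rw [Finset.sum_comm]
    exact Finset.sum_congr rfl fun i _ => Finset.sum_congr rfl fun j _ => by rw [hKs]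
  have sym : ∀ M E : ι → ℝ, ∑ x, ∑ y, |K x y| * (M x * E y + 1 / 2 * (E x * E y)) =
      1 / 2 * ∑ x, ∑ y, |K x y| * (M x * E y + E x * M y + E x * E y) := by
    intro M E
    have e1 := sw (fun x y => M x * E y)
    simp only [mul_add, Finset.sum_add_distrib] at e1 ⊢
    have e2 : ∑ x, ∑ y, |K x y| * (1 / 2 * (E x * E y)) =
        1 / 2 * ∑ x, ∑ y, |K x y| * (E x * E y) := by
      simp only [Finset.mul_sum]
      exact Finset.sum_congr rfl fun i _ => Finset.sum_congr rfl fun j _ => by ring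
    have e3 : ∑ x, ∑ y, |K x y| * (M y * E x) = ∑ x, ∑ y, |K x y| * (E x * M y) :=
      Finset.sum_congr rfl fun i _ => Finset.sum_congr rfl fun j _ => by ring
    rw [e2, ← e3, ← e1]; ring
  rw [sym, sym]
  set dV : ι → ℝ := fun x => (Mv x + Ev x) - (Mb x + Eb x) with hdV
  have hdV0 : ∀ x, 0 ≤ dV x := fun x => (abs_nonneg _).trans (h1 x)
  have hT : ∑ x, (∑ y, |K x y| * T y) * dV x =
      1 / 2 * ∑ x, ∑ y, |K x y| * (T y * dV x + T x * dV y) := by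
    have e1 := sw (fun x y => T y * dV x)
    simp only [mul_add, Finset.sum_add_distrib]
    rw [← e1]
    have : ∑ x, (∑ y, |K x y| * T y) * dV x = ∑ x, ∑ y, |K x y| * (T y * dV x) := by
      refine Finset.sum_congr rfl fun i _ => ?_
      rw [Finset.sum_mul]
      exact Finset.sum_congr rfl fun j _ => by ring
    rw [this]; ring
  have lin : ∑ x, θ x * s x - ∑ x, θ x * s0 x ≤ ∑ x, |θ x| * dV x := by
    rw [← Finset.sum_sub_distrib]
    refine Finset.sum_le_sum fun x _ => ?_
    calc θ x * s x - θ x * s0 x = θ x * (s x - s0 x) := by ring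
      _ ≤ |θ x * (s x - s0 x)| := le_abs_self _
      _ = |θ x| * |s x - s0 x| := abs_mul _ _
      _ ≤ _ := mul_le_mul_of_nonneg_left (h1 x) (abs_nonneg _)
  have lin2 : ∑ x, ths x * (Mv x + Ev x) - ∑ x, ths x * (Mb x + Eb x) =
      ∑ x, |θ x| * dV x + ∑ x, (∑ y, |K x y| * T y) * dV x := by
    rw [← Finset.sum_sub_distrib, ← Finset.sum_add_distrib]
    refine Finset.sum_congr rfl fun x _ => ?_
    rw [hths]; simp only [hdV]; ring
  have quad : ∑ x, ∑ y, K x y * s x * s y - ∑ x, ∑ y, K x y * s0 x * s0 y ≤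
      ∑ x, ∑ y, |K x y| * (T y * dV x + T x * dV y) +
      (∑ x, ∑ y, |K x y| * (Mv x * Ev y + Ev x * Mv y + Ev x * Ev y) -
       ∑ x, ∑ y, |K x y| * (Mb x * Eb y + Eb x * Mb y + Eb x * Eb y)) := by
    simp only [← Finset.sum_sub_distrib, ← Finset.sum_add_distrib]
    refine Finset.sum_le_sum fun x _ => Finset.sum_le_sum fun y _ => ?_
    have b1 : |s x * s y - s0 x * s0 y| ≤ dV x * (T y + Ea y) + (T x + Eb x) * dV y := by
      have : s x * s y - s0 x * s0 y = (s x - s0 x) * s y + s0 x * (s y - s0 y) := by ring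
      rw [this]
      refine (abs_add_le _ _).trans (add_le_add ?_ ?_)
      · rw [abs_mul]; exact mul_le_mul (h1 x) (h2 y) (abs_nonneg _) (hdV0 x)
      · rw [abs_mul]
        exact mul_le_mul (h3 x) (h1 y) (abs_nonneg _) ((abs_nonneg _).trans (h3 x))
    have b2 : dV x * Ea y + Eb x * dV y ≤ (Mv x * Ev y + Ev x * Mv y + Ev x * Ev y) -
        (Mb x * Eb y + Eb x * Mb y + Eb x * Eb y) := by
      have t1 := mul_le_mul_of_nonneg_left (h4 y) (hdV0 x)
      have t2 := mul_nonneg (h8 x) (sub_nonneg.2 (h5 y))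
      have t3 := mul_nonneg (sub_nonneg.2 (h5 x)) (sub_nonneg.2 (h6 y))
      have t4 := mul_nonneg (sub_nonneg.2 (h5 x)) (h8 y)
      simp only [hdV] at t1 ⊢
      nlinarith
    have b3 : K x y * (s x * s y - s0 x * s0 y) ≤ |K x y| * (dV x * (T y + Ea y) + (T x + Eb x) * dV y) := by
      refine (le_abs_self _).trans ?_
      rw [abs_mul]; exact mul_le_mul_of_nonneg_left b1 (abs_nonneg _)
    have b4 := mul_le_mul_of_nonneg_left b2 (abs_nonneg (K x y))
    nlinarith
  linarith

end FinB

namespace FinB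

/-- excess above `T` -/
noncomputable def ep (T t : ℝ) : ℝ := max (t - T) 0
/-- bounded part, plus chain -/
noncomputable def mp (T t : ℝ) : ℝ := min t T + T
/-- bounded part, minus chain -/
noncomputable def mn (T B n : ℝ) : ℝ := if T < n then T + B else 0
/-- state spaces of the chains -/
noncomputable def SS {ι : Type*} (S : Finset ℝ) (T : ι → ℝ) : ι ⊕ ι → Finset ℝ :=
  Sum.elim (fun x => S.filter (fun t => -T x ≤ t))
    (fun x => insert 0 ((S.image (fun t => -t)).filter (fun t => T x < t)))

theorem mp_add_ep (T t : ℝ) : mp T t + ep T t = t + T := by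
  unfold mp ep
  rcases le_total t T with h | h
  · rw [min_eq_left h, max_eq_right (by linarith)]; ring
  · rw [min_eq_right h, max_eq_left (by linarith)]; ring

theorem ep_nonneg (T t : ℝ) : 0 ≤ ep T t := le_max_right _ _
theorem ep_mono (T : ℝ) : Monotone (ep T) := fun a b h => max_le_max (by linarith) le_rfl
theorem mp_mono (T : ℝ) : Monotone (mp T) := fun a b h => by
  have := min_le_min h (le_refl T); unfold mp; linarith
theorem mn_mono {T B : ℝ} (h : 0 ≤ T + B) : Monotone (mn T B) := fun a b hab => by
  unfold mn; split_ifs <;> linarith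
theorem mn_nonneg {T B : ℝ} (h : 0 ≤ T + B) (n : ℝ) : 0 ≤ mn T B n := by
  unfold mn; split_ifs <;> linarith
theorem mp_nonneg {T t : ℝ} (hT : 0 ≤ T) (h : -T ≤ t) : 0 ≤ mp T t := by
  unfold mp; have : -T ≤ min t T := le_min h (by linarith); linarith

section
variable {ι : Type*} [Fintype ι] {S : Finset ℝ} {T : ι → ℝ}

/-- the plus part -/
noncomputable def PP (ψ : ∀ i, ↥(SS S T i)) (x : ι) : ↥S :=
  ⟨(ψ (Sum.inl x)).1, (Finset.mem_filter.1 (ψ (Sum.inl x)).2).1⟩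

theorem PP_ge (ψ : ∀ i, ↥(SS S T i)) (x : ι) : -T x ≤ (ψ (Sum.inl x)).1 :=
  (Finset.mem_filter.1 (ψ (Sum.inl x)).2).2

theorem NN_cases {x : ι} (n : ↥(SS S T (Sum.inr x))) : n.1 = 0 ∨ (T x < n.1 ∧ -n.1 ∈ S) := by
  have := n.2
  simp only [SS, Sum.elim_inr, Finset.mem_insert, Finset.mem_filter, Finset.mem_image] at this
  rcases this with h | ⟨⟨u, hu, h⟩, h2⟩
  · exact Or.inl h
  · exact Or.inr ⟨h2, by rw [← h]; simpa using hu⟩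

/-- the reconstructed spin at a site -/
noncomputable def sg (x : ι) (p : ↥(SS S T (Sum.inl x))) (n : ↥(SS S T (Sum.inr x))) : ↥S :=
  if h : n.1 = 0 then ⟨p.1, (Finset.mem_filter.1 p.2).1⟩
  else ⟨-n.1, ((NN_cases n).resolve_left h).2⟩

/-- weight of the minus chain -/
noncomputable def qn (p : ℝ → ℝ) (R n : ℝ) : ℝ := if n = 0 then 1 else p (-n) / R

/-- the admissibility indicator -/
noncomputable def ci (T B p n : ℝ) : ℝ := if T < n ∧ B < p then 0 else 1

theorem fibre (hT : ∀ x, 0 < T x) (p : ℝ → ℝ) (B R : ι → ℝ) (x : ι)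
    (hR : R x = ∑ t ∈ S.filter (fun t => -T x ≤ t ∧ t ≤ B x), p t) (hRpos : 0 < R x) (s : ↥S) :
    ∑ u : ↥(SS S T (Sum.inl x)), ∑ n : ↥(SS S T (Sum.inr x)),
      (if sg x u n = s then p u.1 * qn p (R x) n.1 * ci (T x) (B x) u.1 n.1 else 0) = p s.1 := by
  have hTx := hT x
  by_cases hs : -T x ≤ s.1
  · have h1 : ∀ u : ↥(SS S T (Sum.inl x)), ∑ n : ↥(SS S T (Sum.inr x)),
      (if sg x u n = s then p u.1 * qn p (R x) n.1 * ci (T x) (B x) u.1 n.1 else 0) =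
      if u.1 = s.1 then p u.1 else 0 := by
      intro u
      rw [Finset.sum_eq_single (⟨0, by simp [SS]⟩ : ↥(SS S T (Sum.inr x)))]
      · have hc : ¬ (T x < 0 ∧ B x < u.1) := fun h => by linarith [h.1]
        simp [sg, Subtype.ext_iff, qn, ci, hc]
      · intro n _ hn
        have hn0 : n.1 ≠ 0 := fun h => hn (Subtype.ext h)
        have h2 := ((NN_cases n).resolve_left hn0).1
        rw [if_neg]
        simp only [sg, hn0, dite_false, Subtype.ext_iff]
        intro h; linarith
      · simp
    rw [Finset.sum_congr rfl fun u _ => h1 u]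
    rw [Finset.sum_eq_single (⟨s.1, by simp [SS, s.2, hs]⟩ : ↥(SS S T (Sum.inl x)))]
    · simp
    · intro u _ hu
      rw [if_neg]; exact fun h => hu (Subtype.ext h)
    · simp
  · push Not at hs
    have hs0 : -s.1 ≠ 0 := by intro h; linarith
    have h1 : ∀ u : ↥(SS S T (Sum.inl x)), ∑ n : ↥(SS S T (Sum.inr x)),
      (if sg x u n = s then p u.1 * qn p (R x) n.1 * ci (T x) (B x) u.1 n.1 else 0) =
      if u.1 ≤ B x then p u.1 * (p s.1 / R x) else 0 := by
      intro u
      have hu := (Finset.mem_filter.1 u.2).2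
      rw [Finset.sum_eq_single (⟨-s.1, by
          simp only [SS, Sum.elim_inr, Finset.mem_insert, Finset.mem_filter, Finset.mem_image]
          exact Or.inr ⟨⟨s.1, s.2, rfl⟩, by linarith⟩⟩ : ↥(SS S T (Sum.inr x)))]
      · have : sg x u (⟨-s.1, by
          simp only [SS, Sum.elim_inr, Finset.mem_insert, Finset.mem_filter, Finset.mem_image]
          exact Or.inr ⟨⟨s.1, s.2, rfl⟩, by linarith⟩⟩ : ↥(SS S T (Sum.inr x))) = s := by
          simp only [sg, hs0, dite_false, Subtype.ext_iff]; ring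
        rw [if_pos this]
        simp only [qn, hs0, if_false, neg_neg, ci]
        by_cases hB : u.1 ≤ B x
        · rw [if_neg (by push Not; intro h; linarith), if_pos hB]; ring
        · rw [if_pos ⟨by linarith, by linarith⟩, if_neg hB]; ring
      · intro n _ hn
        rw [if_neg]
        intro h
        rw [Subtype.ext_iff] at h
        by_cases hn0 : n.1 = 0
        · simp only [sg, hn0, dite_true] at h
          linarith
        · simp only [sg, hn0, dite_false] at h
          exact hn (Subtype.ext (by simp only; linarith))
      · simp
    rw [Finset.sum_congr rfl fun u _ => h1 u]
    have h2 : ∑ u : ↥(SS S T (Sum.inl x)), (if u.1 ≤ B x then p u.1 * (p s.1 / R x) else 0) =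
        ∑ u ∈ SS S T (Sum.inl x), (if u ≤ B x then p u * (p s.1 / R x) else 0) :=
      Finset.sum_coe_sort (SS S T (Sum.inl x)) (fun u => if u ≤ B x then p u * (p s.1 / R x) else 0)
    rw [h2, ← Finset.sum_filter]
    simp only [SS, Sum.elim_inl, Finset.filter_filter]
    rw [← Finset.sum_mul, ← hR]
    field_simp

theorem sum_pair_prod (F : ∀ x, ↥(SS S T (Sum.inl x)) → ↥(SS S T (Sum.inr x)) → ℝ) :
    ∑ ψ : (∀ i, ↥(SS S T i)), ∏ x, F x (ψ (Sum.inl x)) (ψ (Sum.inr x)) =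
      ∏ x, ∑ u, ∑ n, F x u n := by
  have h1 : ∑ ψ : (∀ i, ↥(SS S T i)), ∏ x, F x (ψ (Sum.inl x)) (ψ (Sum.inr x)) =
      ∑ q : (∀ x, ↥(SS S T (Sum.inl x))) × (∀ x, ↥(SS S T (Sum.inr x))),
        ∏ x, F x (q.1 x) (q.2 x) :=
    Fintype.sum_equiv (Equiv.sumPiEquivProdPi (fun i => ↥(SS S T i))) _ _ (fun ψ => rfl)
  rw [h1, Fintype.sum_prod_type]
  rw [Finset.prod_univ_sum]
  rw [Fintype.piFinset_univ]
  refine Finset.sum_congr rfl fun P _ => ?_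
  rw [Finset.prod_univ_sum, Fintype.piFinset_univ]

/-- total bounded part at a site -/
noncomputable def MM (B : ι → ℝ) (ψ : ∀ i, ↥(SS S T i)) (x : ι) : ℝ :=
  mp (T x) (ψ (Sum.inl x)).1 + mn (T x) (B x) (ψ (Sum.inr x)).1
/-- total excess at a site -/
noncomputable def EE (ψ : ∀ i, ↥(SS S T i)) (x : ι) : ℝ :=
  ep (T x) (ψ (Sum.inl x)).1 + ep (T x) (ψ (Sum.inr x)).1

/-- the weight at time zero -/
noncomputable def nu0 (p : ℝ → ℝ) (K : ι → ι → ℝ) (B R ths : ι → ℝ) (ψ : ∀ i, ↥(SS S T i)) : ℝ :=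
  (∏ x, p (ψ (Sum.inl x)).1 * qn p (R x) (ψ (Sum.inr x)).1) *
    Real.exp (∑ x, ths x * (MM B ψ x + EE ψ x) +
      ∑ x, ∑ y, |K x y| * (MM B ψ x * EE ψ y + 1 / 2 * (EE ψ x * EE ψ y)))

/-- the energy -/
noncomputable def HH {ι : Type*} [Fintype ι] (K : ι → ι → ℝ) (θ s : ι → ℝ) : ℝ :=
  ∑ x, θ x * s x + 1 / 2 * ∑ x, ∑ y, K x y * s x * s y

theorem stepA (p : ℝ → ℝ) (hp : ∀ t ∈ S, 0 < p t)
    (K : ι → ι → ℝ) (hKs : ∀ x y, K x y = K y x)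
    (B R θ ths : ι → ℝ) (hths : ∀ x, ths x = |θ x| + ∑ y, |K x y| * T y)
    (hT : ∀ x, 0 < T x) (hB : ∀ x, 0 < B x)
    (hR : ∀ x, R x = ∑ t ∈ S.filter (fun t => -T x ≤ t ∧ t ≤ B x), p t) (hRpos : ∀ x, 0 < R x)
    (G : (ι → ↥S) → ℝ) (hG : Monotone G) :
    (∑ s : ι → ↥S, (∏ x, p (s x).1) * Real.exp (HH K θ fun x => (s x).1) * G s) *
      (∑ ψ : (∀ i, ↥(SS S T i)), nu0 p K B R ths ψ) ≤
    (∑ ψ : (∀ i, ↥(SS S T i)), nu0 p K B R ths ψ * G (PP ψ)) *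
      ∑ s : ι → ↥S, (∏ x, p (s x).1) * Real.exp (HH K θ fun x => (s x).1) := by
  set sig : (∀ i, ↥(SS S T i)) → ι → ↥S := fun ψ x => sg x (ψ (Sum.inl x)) (ψ (Sum.inr x)) with hsig
  set fw : (∀ i, ↥(SS S T i)) → ℝ := fun ψ =>
    (∏ x, p (ψ (Sum.inl x)).1 * qn p (R x) (ψ (Sum.inr x)).1 *
      ci (T x) (B x) (ψ (Sum.inl x)).1 (ψ (Sum.inr x)).1) *
      Real.exp (HH K θ fun x => (sig ψ x).1) with hfw
  have hppos : ∀ (x : ι) (u : ↥(SS S T (Sum.inl x))), 0 < p u.1 := fun x u =>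
    hp _ (Finset.mem_filter.1 u.2).1
  have hqpos : ∀ (x : ι) (n : ↥(SS S T (Sum.inr x))), 0 < qn p (R x) n.1 := by
    intro x n
    unfold qn
    rcases NN_cases n with h | h
    · simp [h]
    · split_ifs
      · exact one_pos
      · exact div_pos (hp _ h.2) (hRpos x)
  have hcnn : ∀ T B u n, 0 ≤ ci T B u n := by
    intro T B u n; unfold ci; split_ifs <;> norm_num
  have hfn : ∀ ψ, 0 ≤ fw ψ := fun ψ => mul_nonneg (Finset.prod_nonneg fun x _ =>
    mul_nonneg (mul_pos (hppos x _) (hqpos x _)).le (hcnn _ _ _ _)) (Real.exp_pos _).le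
  have hnu : ∀ ψ : (∀ i, ↥(SS S T i)), 0 ≤ nu0 p K B R ths ψ := fun ψ =>
    mul_nonneg (Finset.prod_nonneg fun x _ => (mul_pos (hppos x _) (hqpos x _)).le)
      (Real.exp_pos _).le
  -- claim 1
  have claim1 : ∀ Q : (ι → ↥S) → ℝ, ∑ ψ, fw ψ * Q (sig ψ) =
      ∑ s : ι → ↥S, (∏ x, p (s x).1) * Real.exp (HH K θ fun x => (s x).1) * Q s := by
    intro Q
    have h1 : ∀ ψ, fw ψ * Q (sig ψ) = ∑ s : ι → ↥S, (∏ x,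
        (if sg x (ψ (Sum.inl x)) (ψ (Sum.inr x)) = s x then
          p (ψ (Sum.inl x)).1 * qn p (R x) (ψ (Sum.inr x)).1 *
          ci (T x) (B x) (ψ (Sum.inl x)).1 (ψ (Sum.inr x)).1 else 0)) *
        (Real.exp (HH K θ fun x => (s x).1) * Q s) := by
      intro ψ
      rw [Finset.sum_eq_single (sig ψ)]
      · simp only [hsig, if_true, hfw]; ring
      · intro s _ hs
        obtain ⟨x, hx⟩ : ∃ x, sig ψ x ≠ s x := by
          by_contra hcon; push Not at hcon; exact hs (funext fun x => (hcon x).symm)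
        rw [Finset.prod_eq_zero (Finset.mem_univ x) (if_neg hx), zero_mul]
      · simp
    rw [Finset.sum_congr rfl fun ψ _ => h1 ψ, Finset.sum_comm]
    refine Finset.sum_congr rfl fun s _ => ?_
    rw [← Finset.sum_mul]
    rw [sum_pair_prod (fun x u n => if sg x u n = s x then
          p u.1 * qn p (R x) n.1 * ci (T x) (B x) u.1 n.1 else 0)]
    rw [Finset.prod_congr rfl fun x _ => fibre hT p B R x (hR x) (hRpos x) (s x)]
    ring
  have hle : ∀ ψ, sig ψ ≤ PP ψ := by
    intro ψ x
    rw [← Subtype.coe_le_coe]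
    simp only [hsig, sg, PP]
    have h1 := PP_ge ψ x
    split_ifs with h
    · exact le_rfl
    · have := ((NN_cases (ψ (Sum.inr x))).resolve_left h).1
      simp only; linarith
  have claim2 : ∑ ψ, fw ψ * G (sig ψ) ≤ ∑ ψ, fw ψ * G (PP ψ) :=
    Finset.sum_le_sum fun ψ _ => mul_le_mul_of_nonneg_left (hG (hle ψ)) (hfn ψ)
  have hPm : Monotone (fun ψ : (∀ i, ↥(SS S T i)) => G (PP ψ)) := by
    intro a b hab
    refine hG fun x => ?_
    exact hab (Sum.inl x)
  have claim3 := holley' fw (nu0 p K B R ths) (fun ψ => G (PP ψ)) hfn hnu hPm (by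
    intro a b
    by_cases hc : ∃ x, ci (T x) (B x) (a (Sum.inl x)).1 (a (Sum.inr x)).1 = 0
    · obtain ⟨x, hx⟩ := hc
      have : fw a = 0 := by
        simp only [hfw]
        rw [Finset.prod_eq_zero (Finset.mem_univ x) (by rw [hx, mul_zero]), zero_mul]
      rw [this, zero_mul]
      exact mul_nonneg (hfn _) (hnu _)
    · push Not at hc
      have hca : ∀ x, ¬ (T x < (a (Sum.inr x)).1 ∧ B x < (a (Sum.inl x)).1) := by
        intro x h; exact hc x (if_pos h)
      have hlel : ∀ x, ((a ⊓ b) (Sum.inl x)).1 ≤ (a (Sum.inl x)).1 := fun x =>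
        (inf_le_left : a ⊓ b ≤ a) (Sum.inl x)
      have hler : ∀ x, ((a ⊓ b) (Sum.inr x)).1 ≤ (a (Sum.inr x)).1 := fun x =>
        (inf_le_left : a ⊓ b ≤ a) (Sum.inr x)
      have hca' : ∀ x, ci (T x) (B x) ((a ⊓ b) (Sum.inl x)).1 ((a ⊓ b) (Sum.inr x)).1 = 1 := by
        intro x
        refine if_neg fun h => hca x ⟨h.1.trans_le (hler x), h.2.trans_le (hlel x)⟩
      have hca1 : ∀ x, ci (T x) (B x) (a (Sum.inl x)).1 (a (Sum.inr x)).1 = 1 :=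
        fun x => if_neg (hca x)
      have modc : ∀ (i : ι ⊕ ι) (F : ℝ → ℝ), F ((a ⊓ b) i).1 + F ((a ⊔ b) i).1 =
          F (a i).1 + F (b i).1 := by
        intro i F
        rcases le_total (a i) (b i) with h | h
        · simp [h]
        · simp [h, add_comm]
      have modm : ∀ (i : ι ⊕ ι) (F : ℝ → ℝ), F ((a ⊓ b) i).1 * F ((a ⊔ b) i).1 =
          F (a i).1 * F (b i).1 := by
        intro i F
        rcases le_total (a i) (b i) with h | h
        · simp [h]
        · simp [h, mul_comm]
      have hprod : (∏ x, p (a (Sum.inl x)).1 * qn p (R x) (a (Sum.inr x)).1) *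
          (∏ x, p (b (Sum.inl x)).1 * qn p (R x) (b (Sum.inr x)).1) =
          (∏ x, p ((a ⊓ b) (Sum.inl x)).1 * qn p (R x) ((a ⊓ b) (Sum.inr x)).1) *
          (∏ x, p ((a ⊔ b) (Sum.inl x)).1 * qn p (R x) ((a ⊔ b) (Sum.inr x)).1) := by
        rw [← Finset.prod_mul_distrib, ← Finset.prod_mul_distrib]
        refine Finset.prod_congr rfl fun x _ => ?_
        rw [mul_mul_mul_comm, ← modm (Sum.inl x) p, ← modm (Sum.inr x) (qn p (R x)),
          mul_mul_mul_comm]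
      have hsabs : ∀ (c : ∀ i, ↥(SS S T i)) (x : ι), |(sig c x).1| ≤ T x + EE c x := by
        intro c x
        simp only [hsig, sg, EE]
        have h1 := PP_ge c x
        have e1 : (c (Sum.inl x)).1 - T x ≤ ep (T x) (c (Sum.inl x)).1 := le_max_left _ _
        have e2 : (c (Sum.inr x)).1 - T x ≤ ep (T x) (c (Sum.inr x)).1 := le_max_left _ _
        have e3 := ep_nonneg (T x) (c (Sum.inl x)).1
        have e4 := ep_nonneg (T x) (c (Sum.inr x)).1
        have := hT x
        split_ifs with h
        · exact abs_le.2 ⟨by simp only; linarith, by simp only; linarith⟩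
        · have h2 := ((NN_cases (c (Sum.inr x))).resolve_left h).1
          exact abs_le.2 ⟨by simp only; linarith, by simp only; linarith⟩
      have hEmono : ∀ {c d : ∀ i, ↥(SS S T i)}, c ≤ d → ∀ x, EE c x ≤ EE d x := fun hcd x =>
        add_le_add (ep_mono _ (hcd (Sum.inl x))) (ep_mono _ (hcd (Sum.inr x)))
      have hdiff : ∀ x, |(sig a x).1 - (sig (a ⊓ b) x).1| ≤
          (MM B (a ⊔ b) x + EE (a ⊔ b) x) - (MM B b x + EE b x) := by
        intro x
        have m1 := modc (Sum.inl x) (mp (T x))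
        have m2 := modc (Sum.inl x) (ep (T x))
        have m3 := modc (Sum.inr x) (mn (T x) (B x))
        have m4 := modc (Sum.inr x) (ep (T x))
        have m5 := mp_add_ep (T x) (a (Sum.inl x)).1
        have m6 := mp_add_ep (T x) ((a ⊓ b) (Sum.inl x)).1
        have hV : (MM B (a ⊔ b) x + EE (a ⊔ b) x) - (MM B b x + EE b x) =
          ((a (Sum.inl x)).1 - ((a ⊓ b) (Sum.inl x)).1) +
          ((mn (T x) (B x) (a (Sum.inr x)).1 + ep (T x) (a (Sum.inr x)).1) -
          (mn (T x) (B x) ((a ⊓ b) (Sum.inr x)).1 + ep (T x) ((a ⊓ b) (Sum.inr x)).1)) := by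
          unfold MM EE; linarith
        rw [hV]
        have hTx := hT x
        have hBx := hB x
        have hge := PP_ge (a ⊓ b) x
        have hge' := PP_ge a x
        have hl := hlel x
        have hr := hler x
        have hcx := hca x
        simp only [hsig, sg]
        generalize (a (Sum.inl x)) = u at *
        generalize ((a ⊓ b) (Sum.inl x)) = u' at *
        generalize (a (Sum.inr x)) = n at *
        generalize ((a ⊓ b) (Sum.inr x)) = n' at *
        have mn0 : mn (T x) (B x) 0 = 0 := if_neg (by linarith)
        have ep0 : ep (T x) 0 = 0 := max_eq_right (by linarith)
        have big : ∀ n : ℝ, T x < n → mn (T x) (B x) n + ep (T x) n = n + B x := by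
          intro n hn
          unfold mn ep; rw [if_pos hn, max_eq_left (by linarith)]; ring
        rcases NN_cases n with hn | hn
        · have hn' : n'.1 = 0 := by
            rcases NN_cases n' with h | h
            · exact h
            · linarith [h.1]
          simp only [hn, hn', dite_true, mn0, ep0]
          rw [abs_of_nonneg (by linarith)]; linarith
        · have hn0 : n.1 ≠ 0 := by intro h; linarith [hn.1]
          have hu : u.1 ≤ B x := by
            by_contra h; push Not at h; exact hcx ⟨hn.1, h⟩
          rw [big n.1 hn.1]
          rcases NN_cases n' with h | h
          · simp only [hn0, h, dite_true, dite_false, mn0, ep0]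
            exact abs_le.2 ⟨by linarith, by linarith [hn.1]⟩
          · have h0 : n'.1 ≠ 0 := by intro h'; linarith [h.1]
            rw [big n'.1 h.1]
            simp only [hn0, h0, dite_false]
            exact abs_le.2 ⟨by linarith, by linarith [hn.1]⟩
      have hexp := stepA_exp K hKs T θ ths (fun x => (sig a x).1) (fun x => (sig (a ⊓ b) x).1)
        (MM B b) (EE b) (MM B (a ⊔ b)) (EE (a ⊔ b)) (EE a) hths hdiff (hsabs a)
        (fun x => (hsabs (a ⊓ b) x).trans (by
          have := hEmono (inf_le_right : a ⊓ b ≤ b) x; linarith))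
        (hEmono le_sup_left) (hEmono le_sup_right)
        (fun x => add_le_add (mp_mono _ ((le_sup_right : b ≤ a ⊔ b) (Sum.inl x)))
          (mn_mono (by linarith [hT x, hB x]) ((le_sup_right : b ≤ a ⊔ b) (Sum.inr x))))
        (fun x => add_nonneg (ep_nonneg _ _) (ep_nonneg _ _))
        (fun x => add_nonneg (mp_nonneg (hT x).le (PP_ge b x))
          (mn_nonneg (by linarith [hT x, hB x]) _))
      have hexp2 := Real.exp_le_exp.2 hexp
      rw [Real.exp_add (_ + _) (_ + _), Real.exp_add (_ + _) (_ + _)] at hexp2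
      simp only [hfw, nu0, hca', hca1, mul_one]
      have hpp : 0 ≤ (∏ x, p (a (Sum.inl x)).1 * qn p (R x) (a (Sum.inr x)).1) *
          (∏ x, p (b (Sum.inl x)).1 * qn p (R x) (b (Sum.inr x)).1) :=
        mul_nonneg (Finset.prod_nonneg fun x _ => (mul_pos (hppos x _) (hqpos x _)).le)
          (Finset.prod_nonneg fun x _ => (mul_pos (hppos x _) (hqpos x _)).le)
      have := mul_le_mul_of_nonneg_left hexp2 hpp
      rw [mul_mul_mul_comm, mul_mul_mul_comm (∏ x, p ((a ⊓ b) (Sum.inl x)).1 * _), ← hprod]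
      exact this)
  have c1 := claim1 (fun _ => 1)
  simp only [mul_one] at c1
  rw [← claim1 G, ← c1]
  have hZ : 0 ≤ ∑ ψ : (∀ i, ↥(SS S T i)), nu0 p K B R ths ψ := Finset.sum_nonneg fun ψ _ => hnu ψ
  exact (mul_le_mul_of_nonneg_right claim2 hZ).trans claim3

end
end FinB

namespace FinB

theorem Ws_update {I : Type*} [Fintype I] {X : I → Type*} [∀ i, LinearOrder (X i)]
    [∀ i, Fintype (X i)] (w m e k : ∀ i, X i → ℝ) (hw : ∀ i c, 0 < w i c)
    (K : I → I → ℝ) (hKs : ∀ i j, K i j = K j i) (hKd : ∀ i, K i i = 0) (s : ℝ) (l : I)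
    (ψ : ∀ i, X i) : ∃ C : ℝ, 0 < C ∧ ∀ t, Ws w m e k K s (Function.update ψ l t) =
      C * (w l t * Real.exp (s * k l t + (1 - s) * ((m l t + e l t) * (∑ j, K l j * e j (ψ j)) +
        e l t * ∑ j, K l j * m j (ψ j)))) := by
  set rs : Finset I := Finset.univ.erase l with hrs
  have hsplit : ∀ F : I → ℝ, ∑ i, F i = F l + ∑ i ∈ rs, F i := fun F =>
    (Finset.add_sum_erase _ F (Finset.mem_univ l)).symm
  have hne : ∀ i ∈ rs, i ≠ l := fun i hi => (Finset.mem_erase.1 hi).1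
  refine ⟨(∏ i ∈ rs, w i (ψ i)) * Real.exp (s * ∑ i ∈ rs, k i (ψ i) + (1 - s) * ∑ i ∈ rs,
    ∑ j ∈ rs, K i j * (m i (ψ i) * e j (ψ j) + 1 / 2 * (e i (ψ i) * e j (ψ j)))),
    mul_pos (Finset.prod_pos fun i _ => hw _ _) (Real.exp_pos _), fun t => ?_⟩
  unfold Ws
  rw [← Finset.mul_prod_erase _ _ (Finset.mem_univ l)]
  rw [Function.update_self]
  have e1 : ∏ i ∈ Finset.univ.erase l, w i (Function.update ψ l t i) = ∏ i ∈ rs, w i (ψ i) :=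
    Finset.prod_congr rfl fun i hi => by rw [Function.update_of_ne (hne i hi)]
  have e2 : ∑ i, k i (Function.update ψ l t i) = k l t + ∑ i ∈ rs, k i (ψ i) := by
    rw [hsplit, Function.update_self]
    congr 1
    exact Finset.sum_congr rfl fun i hi => by rw [Function.update_of_ne (hne i hi)]
  have e4 : ∑ j, K l j * e j (ψ j) = ∑ j ∈ rs, K l j * e j (ψ j) := by
    rw [hsplit, hKd]; ring
  have e5 : ∑ j, K l j * m j (ψ j) = ∑ j ∈ rs, K l j * m j (ψ j) := by
    rw [hsplit, hKd]; ring
  have e3 : ∑ i, ∑ j, K i j * (m i (Function.update ψ l t i) * e j (Function.update ψ l t j) +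
      1 / 2 * (e i (Function.update ψ l t i) * e j (Function.update ψ l t j))) =
      ((m l t + e l t) * (∑ j ∈ rs, K l j * e j (ψ j)) + e l t * ∑ j ∈ rs, K l j * m j (ψ j)) +
      ∑ i ∈ rs, ∑ j ∈ rs, K i j * (m i (ψ i) * e j (ψ j) + 1 / 2 * (e i (ψ i) * e j (ψ j))) := by
    rw [hsplit]
    simp only [Function.update_self]
    rw [hsplit (fun j => K l j * (m l t * e j (Function.update ψ l t j) +
      1 / 2 * (e l t * e j (Function.update ψ l t j)))), hKd]
    have f1 : ∑ j ∈ rs, K l j * (m l t * e j (Function.update ψ l t j) +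
        1 / 2 * (e l t * e j (Function.update ψ l t j))) =
        (m l t + 1 / 2 * e l t) * ∑ j ∈ rs, K l j * e j (ψ j) := by
      rw [Finset.mul_sum]
      refine Finset.sum_congr rfl fun j hj => ?_
      rw [Function.update_of_ne (hne j hj)]; ring
    have f2 : ∑ i ∈ rs, ∑ j, K i j * (m i (Function.update ψ l t i) * e j (Function.update ψ l t j) +
      1 / 2 * (e i (Function.update ψ l t i) * e j (Function.update ψ l t j))) =
      (e l t * ∑ j ∈ rs, K l j * m j (ψ j) + 1 / 2 * e l t * ∑ j ∈ rs, K l j * e j (ψ j)) +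
      ∑ i ∈ rs, ∑ j ∈ rs, K i j * (m i (ψ i) * e j (ψ j) + 1 / 2 * (e i (ψ i) * e j (ψ j))) := by
      rw [Finset.mul_sum, Finset.mul_sum, ← Finset.sum_add_distrib, ← Finset.sum_add_distrib]
      refine Finset.sum_congr rfl fun i hi => ?_
      rw [hsplit, Function.update_of_ne (hne i hi), Function.update_self, hKs i l]
      have : ∑ j ∈ rs, K i j * (m i (ψ i) * e j (Function.update ψ l t j) +
          1 / 2 * (e i (ψ i) * e j (Function.update ψ l t j))) = ∑ j ∈ rs, K i j *
          (m i (ψ i) * e j (ψ j) + 1 / 2 * (e i (ψ i) * e j (ψ j))) :=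
        Finset.sum_congr rfl fun j hj => by rw [Function.update_of_ne (hne j hj)]
      rw [this]; ring
    rw [f1, f2]; ring
  rw [e1, e2, e3, e4, e5]
  have : ∀ A1 A2 B1 B2 : ℝ, s * (A1 + A2) + (1 - s) * (B1 + B2) =
      (s * A1 + (1 - s) * B1) + (s * A2 + (1 - s) * B2) := fun _ _ _ _ => by ring
  rw [this, Real.exp_add]
  ring

theorem exp_bound (a D T B e Y P s : ℝ) (ha : 0 < a) (hD : D ≤ a / 4) (hB : 0 < B)
    (hBT : 3 * B ≤ T) (hY : 0 ≤ Y) (hs0 : 0 ≤ s) (hs1 : s ≤ 1) (he : 3 / (2 * a) * Y < e)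
    (hP : P ≤ 10 / 3 * (D * T)) :
    4 / 3 * D * T * (T + e + B) + s * (D * (10 / 3 * T * e + 8 / 5 * e ^ 2)) +
      (1 - s) * ((T + e + B) * Y + e * P) ≤ 13 / 16 * a * (T + e) ^ 2 := by
  have hY2 : Y ≤ 2 / 3 * a * e := by
    rw [div_mul_eq_mul_div, div_lt_iff₀ (by linarith)] at he
    linarith
  have he0 : 0 ≤ e := le_trans (by positivity) he.le
  have hT : 0 < T := by linarith
  have hs1' : 0 ≤ 1 - s := by linarith
  have h1 : (1 - s) * ((T + e + B) * Y + e * P) ≤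
      (1 - s) * ((4 / 3 * T + e) * (2 / 3 * a * e) + e * (10 / 3 * (D * T))) := by
    refine mul_le_mul_of_nonneg_left (add_le_add ?_ (mul_le_mul_of_nonneg_left hP he0)) hs1'
    exact mul_le_mul (by linarith) hY2 hY (by positivity)
  have h2 : 4 / 3 * D * T * (T + e + B) ≤ 4 / 3 * (a / 4) * T * (4 / 3 * T + e) := by
    have := mul_le_mul hD (show T + e + B ≤ 4 / 3 * T + e by linarith) (by positivity)
      (by positivity)
    nlinarith [mul_le_mul_of_nonneg_left this hT.le]
  have h3 : s * (D * (10 / 3 * T * e + 8 / 5 * e ^ 2)) + (1 - s) * (e * (10 / 3 * (D * T))) =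
      D * (10 / 3 * T * e + s * (8 / 5 * e ^ 2)) := by ring
  have h4 : D * (10 / 3 * T * e + s * (8 / 5 * e ^ 2)) ≤
      a / 4 * (10 / 3 * T * e + s * (8 / 5 * e ^ 2)) :=
    mul_le_mul_of_nonneg_right hD (by positivity)
  have h5 : (16 / 9 * T ^ 2 + 14 / 3 * T * e + s * (8 / 5 * e ^ 2) +
      (1 - s) * ((4 / 3 * T + e) * (8 / 3 * e))) ≤ 13 / 4 * (T + e) ^ 2 := by
    have q0 : 16 / 9 * T ^ 2 + 14 / 3 * T * e + (4 / 3 * T + e) * (8 / 3 * e) ≤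
        13 / 4 * (T + e) ^ 2 := by
      nlinarith [sq_nonneg (T - 17 / 30 * e), sq_nonneg e, sq_nonneg T]
    have q1 : 16 / 9 * T ^ 2 + 14 / 3 * T * e + 8 / 5 * e ^ 2 ≤ 13 / 4 * (T + e) ^ 2 := by
      nlinarith [mul_nonneg hT.le he0, sq_nonneg e, sq_nonneg T]
    nlinarith [mul_le_mul_of_nonneg_left q0 hs1', mul_le_mul_of_nonneg_left q1 hs0]
  nlinarith [mul_le_mul_of_nonneg_left h5 ha.le]

/-- abstract local moment bound -/
theorem loc_bound {Xt : Type*} [Fintype Xt] (V e bad core : Xt → ℝ) (hV : ∀ t, 0 ≤ V t)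
    (ε' y c : ℝ) (hy : 0 ≤ y) (hc : 0 ≤ c)
    (hbad : ∀ t, y < e t → V t * e t ≤ c * bad t) (hbad0 : ∀ t, 0 ≤ bad t)
    (hcore : ∀ t, c * core t ≤ V t) (hbc : ∑ t, bad t ≤ ε' * ∑ t, core t) (hε' : 0 ≤ ε') :
    ∑ t, V t * e t ≤ (ε' + y) * ∑ t, V t := by
  have h1 : ∑ t, V t * e t ≤ ∑ t, (c * bad t + y * V t) := by
    refine Finset.sum_le_sum fun t _ => ?_
    by_cases h : y < e t
    · have h2 := hbad t h
      have := mul_nonneg hy (hV t); linarith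
    · push Not at h
      have := mul_le_mul_of_nonneg_left h (hV t)
      have := mul_nonneg hc (hbad0 t)
      linarith
  rw [Finset.sum_add_distrib, ← Finset.mul_sum, ← Finset.mul_sum] at h1
  have h3 : c * ∑ t, core t ≤ ∑ t, V t := by
    rw [Finset.mul_sum]; exact Finset.sum_le_sum fun t _ => hcore t
  have h4 := mul_le_mul_of_nonneg_left hbc hc
  have h5 := mul_le_mul_of_nonneg_left h3 hε'
  nlinarith

/-- the data of the discrete comparison -/
structure Dat {ι : Type*} [Fintype ι] (S : Finset ℝ) (p : ℝ → ℝ) (K : ι → ι → ℝ)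
    (a : ℝ) (θ T B D : ι → ℝ) : Prop where
  ex : ∃ Do Di εp εn : ι → ℝ, (∀ x, 0 ≤ Do x) ∧ (∀ x, Do x + Di x ≤ D x) ∧
    (∀ x, |θ x| ≤ 4 / 3 * Do x * T x) ∧ (∀ x, ∑ y, |K x y| * T y ≤ Di x * T x) ∧
    (∀ x, ∑ y, |K x y| ≤ Di x) ∧ (∀ x, 0 ≤ εp x) ∧ (∀ x, 0 ≤ εn x) ∧
    (∀ x, εp x + εn x ≤ T x / 12) ∧
    (∀ x, ∑ t ∈ S, p t * ep (T x) t * Real.exp (13 / 16 * a * t ^ 2) ≤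
      εp x * ∑ t ∈ S.filter (fun t => -B x ≤ t ∧ t ≤ B x), p t) ∧
    (∀ x, ∑ t ∈ S, p t * ep (T x) (-t) * Real.exp (13 / 16 * a * t ^ 2) ≤
      εn x * ∑ t ∈ S.filter (fun t => -B x ≤ t ∧ t ≤ B x), p t)
  core : ∀ x, 0 < ∑ t ∈ S.filter (fun t => -B x ≤ t ∧ t ≤ B x), p t
  hp : ∀ t ∈ S, 0 < p t
  hKs : ∀ x y, K x y = K y x
  hKd : ∀ x, K x x = 0
  ha : 0 < a
  hD : ∀ x, D x ≤ a / 4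
  hB : ∀ x, 0 < B x
  hBT : ∀ x, 3 * B x ≤ T x

/-- the single-site exponent -/
noncomputable def Th (D T t : ℝ) : ℝ :=
  4 / 3 * D * T * t + D * (10 / 3 * T * ep T t + 8 / 5 * ep T t ^ 2)

section main
variable {ι : Type*} [Fintype ι]

/-- weights -/
noncomputable def cw (S : Finset ℝ) (p : ℝ → ℝ) (T B R ths : ι → ℝ) :
    ∀ i : ι ⊕ ι, ↥(SS S T i) → ℝ
  | Sum.inl x => fun t => p t.1 * Real.exp (ths x * (mp (T x) t.1 + ep (T x) t.1))
  | Sum.inr x => fun t => qn p (R x) t.1 *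
      Real.exp (ths x * (mn (T x) (B x) t.1 + ep (T x) t.1))

/-- bounded parts -/
noncomputable def cm (S : Finset ℝ) (T B : ι → ℝ) : ∀ i : ι ⊕ ι, ↥(SS S T i) → ℝ
  | Sum.inl x => fun t => mp (T x) t.1
  | Sum.inr x => fun t => mn (T x) (B x) t.1

/-- site of a chain -/
def pr : ι ⊕ ι → ι := Sum.elim id id

/-- excess parts -/
noncomputable def cee (S : Finset ℝ) (T : ι → ℝ) (i : ι ⊕ ι) (t : ↥(SS S T i)) : ℝ :=
  ep (T (pr i)) t.1

/-- potential -/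
noncomputable def ck (S : Finset ℝ) (T B D ths : ι → ℝ) (i : ι ⊕ ι) (t : ↥(SS S T i)) : ℝ :=
  (4 / 3 * D (pr i) * T (pr i) - ths (pr i)) * (cm S T B i t + cee S T i t) +
    D (pr i) * (10 / 3 * T (pr i) * cee S T i t + 8 / 5 * cee S T i t ^ 2)

/-- coupling of chains -/
noncomputable def cK (K : ι → ι → ℝ) (i j : ι ⊕ ι) : ℝ := |K (pr i) (pr j)|

theorem sum_cK (K : ι → ι → ℝ) (i : ι ⊕ ι) (F : ι ⊕ ι → ℝ) :
    ∑ j, cK K i j * F j = ∑ y, |K (pr i) y| * (F (Sum.inl y) + F (Sum.inr y)) := by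
  rw [Fintype.sum_sum_type, ← Finset.sum_add_distrib]
  exact Finset.sum_congr rfl fun y _ => by simp [cK, pr]; ring

theorem Ws_zero (S : Finset ℝ) (p : ℝ → ℝ) (K : ι → ι → ℝ) (T B R D ths : ι → ℝ)
    (ψ : ∀ i, ↥(SS S T i)) :
    Ws (cw S p T B R ths) (cm S T B) (cee S T) (ck S T B D ths) (cK K) 0 ψ =
      nu0 p K B R ths ψ := by
  unfold Ws nu0
  rw [Fintype.prod_sum_type]
  have h1 : ∑ i, ∑ j, cK K i j * (cm S T B i (ψ i) * cee S T j (ψ j) +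
      1 / 2 * (cee S T i (ψ i) * cee S T j (ψ j))) =
      ∑ x, ∑ y, |K x y| * (MM B ψ x * EE ψ y + 1 / 2 * (EE ψ x * EE ψ y)) := by
    simp only [sum_cK K]
    rw [Fintype.sum_sum_type, ← Finset.sum_add_distrib]
    refine Finset.sum_congr rfl fun x _ => ?_
    rw [← Finset.sum_add_distrib]
    refine Finset.sum_congr rfl fun y _ => ?_
    simp only [pr, Sum.elim_inl, Sum.elim_inr, id, cm, cee, MM, EE]
    ring
  rw [h1]
  simp only [cw, Finset.prod_mul_distrib, ← Real.exp_sum]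
  have h2 : ∑ x, ths x * (MM B ψ x + EE ψ x) =
      ∑ x, ths x * (mp (T x) (ψ (Sum.inl x)).1 + ep (T x) (ψ (Sum.inl x)).1) +
      ∑ x, ths x * (mn (T x) (B x) (ψ (Sum.inr x)).1 + ep (T x) (ψ (Sum.inr x)).1) := by
    rw [← Finset.sum_add_distrib]
    refine Finset.sum_congr rfl fun x _ => ?_
    unfold MM EE; ring
  rw [h2, zero_mul, zero_add, sub_zero, one_mul]
  conv_rhs => rw [Real.exp_add, Real.exp_add]
  ring

theorem Ws_one (S : Finset ℝ) (p : ℝ → ℝ) (K : ι → ι → ℝ) (T B R D ths : ι → ℝ)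
    (ψ : ∀ i, ↥(SS S T i)) :
    Ws (cw S p T B R ths) (cm S T B) (cee S T) (ck S T B D ths) (cK K) 1 ψ =
      (∏ x, (p (ψ (Sum.inl x)).1 * Real.exp (Th (D x) (T x) (ψ (Sum.inl x)).1))) *
      ((∏ x, Real.exp (4 / 3 * D x * T x * T x)) * ∏ x, (cw S p T B R ths (Sum.inr x) (ψ (Sum.inr x)) *
        Real.exp (ck S T B D ths (Sum.inr x) (ψ (Sum.inr x))))) := by
  have h1 : ∏ x, (cw S p T B R ths (Sum.inl x) (ψ (Sum.inl x)) *
        Real.exp (ck S T B D ths (Sum.inl x) (ψ (Sum.inl x)))) =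
      (∏ x, (p (ψ (Sum.inl x)).1 * Real.exp (Th (D x) (T x) (ψ (Sum.inl x)).1))) *
      (∏ x, Real.exp (4 / 3 * D x * T x * T x)) := by
    rw [← Finset.prod_mul_distrib]
    refine Finset.prod_congr rfl fun x _ => ?_
    simp only [cw, ck, cm, cee, pr, Sum.elim_inl, id, Th]
    rw [mul_assoc (p _), ← Real.exp_add, mul_assoc (p _), ← Real.exp_add]
    congr 2
    rw [mp_add_ep]; ring
  unfold Ws
  rw [sub_self, zero_mul, add_zero, one_mul, Real.exp_sum, ← Finset.prod_mul_distrib,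
    Fintype.prod_sum_type, h1]
  ring

theorem discrete {S : Finset ℝ} {p : ℝ → ℝ} {K : ι → ι → ℝ} {a : ℝ} {θ T B D : ι → ℝ}
    (h : Dat S p K a θ T B D) (G : (ι → ↥S) → ℝ) (hG : Monotone G) :
    (∑ s : ι → ↥S, (∏ x, p (s x).1) * Real.exp (HH K θ fun x => (s x).1) * G s) *
      (∑ s : ι → ↥S, ∏ x, (if -T x ≤ (s x).1 then p (s x).1 * Real.exp (Th (D x) (T x) (s x).1)
        else 0)) ≤
    (∑ s : ι → ↥S, (∏ x, (if -T x ≤ (s x).1 then p (s x).1 * Real.exp (Th (D x) (T x) (s x).1)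
        else 0)) * G s) *
      ∑ s : ι → ↥S, (∏ x, p (s x).1) * Real.exp (HH K θ fun x => (s x).1) := by
  obtain ⟨⟨Do, Di, εp, εn, hDo, hDD, hθ, hKT, hKsum, hεp0, hεn0, hεs, hεp, hεn⟩, hcore, hp, hKs,
    hKd, ha, hD, hB, hBT⟩ := h
  have hT : ∀ x, 0 < T x := fun x => by linarith [hB x, hBT x]
  have hDi0 : ∀ x, 0 ≤ Di x := fun x =>
    le_trans (Finset.sum_nonneg fun y _ => abs_nonneg _) (hKsum x)
  have hD0 : ∀ x, 0 ≤ D x := fun x => by linarith [hDo x, hDi0 x, hDD x]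
  have hDiD : ∀ x, Di x ≤ D x := fun x => by linarith [hDo x, hDD x]
  set ths : ι → ℝ := fun x => |θ x| + ∑ y, |K x y| * T y with hths
  set R : ι → ℝ := fun x => ∑ t ∈ S.filter (fun t => -T x ≤ t ∧ t ≤ B x), p t with hR
  have hcR : ∀ x, ∑ t ∈ S.filter (fun t => -B x ≤ t ∧ t ≤ B x), p t ≤ R x := by
    intro x
    refine Finset.sum_le_sum_of_subset_of_nonneg ?_ ?_
    · intro t ht
      simp only [Finset.mem_filter] at ht ⊢
      exact ⟨ht.1, by linarith [ht.2.1, hBT x, hB x], ht.2.2⟩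
    · intro t ht _; exact (hp t (Finset.mem_filter.1 ht).1).le
  have hRpos : ∀ x, 0 < R x := fun x => (hcore x).trans_le (hcR x)
  have hths0 : ∀ x, 0 ≤ ths x := fun x => add_nonneg (abs_nonneg _)
    (Finset.sum_nonneg fun y _ => mul_nonneg (abs_nonneg _) (hT y).le)
  have hgap : ∀ x, Di x * T x / 3 ≤ 4 / 3 * D x * T x - ths x := by
    intro x
    have h1 := hθ x
    have h2 := hKT x
    have h3 := mul_le_mul_of_nonneg_right (hDD x) (hT x).le
    simp only [hths]
    linarith
  have hgap0 : ∀ x, 0 ≤ 4 / 3 * D x * T x - ths x := fun x =>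
    le_trans (by have := mul_nonneg (hDi0 x) (hT x).le; linarith) (hgap x)
  haveI hne : ∀ i, Nonempty ↥(SS S T i) := by
    rintro (x | x)
    · have hc := hcore x
      have : (S.filter (fun t => -B x ≤ t ∧ t ≤ B x)).Nonempty := by
        by_contra hcon
        rw [Finset.not_nonempty_iff_eq_empty] at hcon
        rw [hcon] at hc; simp at hc
      obtain ⟨t, ht⟩ := this
      simp only [Finset.mem_filter] at ht
      exact ⟨⟨t, by simp only [SS, Sum.elim_inl, Finset.mem_filter]
                    exact ⟨ht.1, by linarith [ht.2.1, hBT x, hB x]⟩⟩⟩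
    · exact ⟨⟨0, by simp [SS]⟩⟩
  have hqpos : ∀ (x : ι) (n : ↥(SS S T (Sum.inr x))), 0 < qn p (R x) n.1 := by
    intro x n
    unfold qn
    rcases NN_cases n with h | h
    · simp [h]
    · split_ifs
      · exact one_pos
      · exact div_pos (hp _ h.2) (hRpos x)
  have hppos : ∀ (x : ι) (u : ↥(SS S T (Sum.inl x))), 0 < p u.1 := fun x u =>
    hp _ (Finset.mem_filter.1 u.2).1
  have hw : ∀ i c, 0 < cw S p T B R ths i c := by
    rintro (x | x) c
    · exact mul_pos (hppos x c) (Real.exp_pos _)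
    · exact mul_pos (hqpos x c) (Real.exp_pos _)
  set M : ι ⊕ ι → ℝ := Sum.elim (fun x => 2 * T x) (fun x => T x + B x) with hM
  set ε' : ι ⊕ ι → ℝ := Sum.elim εp εn with hε'
  set ε : ι ⊕ ι → ℝ := fun i => ε' i + T (pr i) / 8 with hεd
  have hε'0 : ∀ i, 0 ≤ ε' i := by
    rintro (x | x)
    · exact hεp0 x
    · exact hεn0 x
  have hε0 : ∀ i, 0 ≤ ε i := fun i => add_nonneg (hε'0 i) (by linarith [hT (pr i)])
  have hKc0 : ∀ i j : ι ⊕ ι, 0 ≤ cK K i j := fun i j => abs_nonneg _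
  have hKcs : ∀ i j : ι ⊕ ι, cK K i j = cK K j i := fun i j => by unfold cK; rw [hKs]
  have hKcd : ∀ i : ι ⊕ ι, cK K i i = 0 := fun i => by unfold cK; rw [hKd, abs_zero]
  have hSK : ∀ l : ι ⊕ ι, ∑ j, cK K l j ≤ 2 * Di (pr l) := by
    intro l
    have h1 := sum_cK K l (fun _ => 1)
    simp only [mul_one] at h1
    rw [h1, ← Finset.sum_mul]
    have := hKsum (pr l); linarith
  have hSKε : ∀ l : ι ⊕ ι, ∑ j, cK K l j * ε j ≤ Di (pr l) * T (pr l) / 3 := by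
    intro l
    rw [sum_cK]
    have h1 : ∑ y, |K (pr l) y| * (ε (Sum.inl y) + ε (Sum.inr y)) ≤
        ∑ y, (|K (pr l) y| * T y) * (1 / 3) := by
      refine Finset.sum_le_sum fun y _ => ?_
      rw [mul_assoc]
      refine mul_le_mul_of_nonneg_left ?_ (abs_nonneg _)
      simp only [hεd, hε', pr, Sum.elim_inl, Sum.elim_inr, id]
      linarith [hεs y]
    rw [← Finset.sum_mul] at h1
    linarith [hKT (pr l)]
  have hSKM : ∀ l : ι ⊕ ι, ∑ j, cK K l j * M j ≤ 10 / 3 * (D (pr l) * T (pr l)) := by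
    intro l
    rw [sum_cK]
    have h1 : ∑ y, |K (pr l) y| * (M (Sum.inl y) + M (Sum.inr y)) ≤
        ∑ y, (|K (pr l) y| * T y) * (10 / 3) := by
      refine Finset.sum_le_sum fun y _ => ?_
      rw [mul_assoc]
      refine mul_le_mul_of_nonneg_left ?_ (abs_nonneg _)
      simp only [hM, Sum.elim_inl, Sum.elim_inr]
      linarith [hBT y]
    rw [← Finset.sum_mul] at h1
    have h2 := mul_le_mul_of_nonneg_right (hDiD (pr l)) (hT (pr l)).le
    linarith [hKT (pr l)]
  have hmM : ∀ i c, cm S T B i c ≤ M i := by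
    rintro (x | x) c
    · simp only [cm, hM, Sum.elim_inl, mp]
      have := min_le_right c.1 (T x); linarith
    · simp only [cm, hM, Sum.elim_inr, mn]
      split_ifs
      · exact le_rfl
      · linarith [hT x, hB x]
  have hm0 : ∀ i c, 0 ≤ cm S T B i c := by
    rintro (x | x) c
    · exact mp_nonneg (hT x).le (Finset.mem_filter.1 c.2).2
    · exact mn_nonneg (by linarith [hT x, hB x]) _
  have he0 : ∀ i c, 0 ≤ cee S T i c := fun i c => ep_nonneg _ _
  have hem : ∀ i, Monotone (cee S T i) := fun i c c' hc => ep_mono _ hc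
  have hmm : ∀ i, Monotone (cm S T B i) := by
    rintro (x | x) c c' hc
    · exact mp_mono _ hc
    · exact mn_mono (by linarith [hT x, hB x]) hc
  have hκ : 0 ≤ 3 / (2 * a) := by positivity
  have hmain := thmB (cw S p T B R ths) (cm S T B) (cee S T) (ck S T B D ths) hw he0 hem hmm
    (by
      rintro (x | x) c c' hc hne'
      · simp only [cee, pr, Sum.elim_inl, id, ep]
        refine max_eq_right ?_
        by_contra hcon
        push Not at hcon
        apply hne'
        simp only [cm, mp]
        have hc2 : c'.1 ≤ c.1 := hc
        rw [min_eq_right (by linarith), min_eq_right (by linarith)]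
      · simp only [cee, pr, Sum.elim_inr, id, ep]
        refine max_eq_right ?_
        by_contra hcon
        push Not at hcon
        apply hne'
        simp only [cm, mn]
        have hc2 : c'.1 ≤ c.1 := hc
        rw [if_pos (by linarith), if_pos (by linarith)])
    M hmM (cK K) hKc0 hKcs hKcd (3 / (2 * a)) (3 / 5) hκ ε' ε
    (by
      intro l
      have h1 := mul_le_mul_of_nonneg_left (hSKε l) hκ
      have h2 : Di (pr l) * T (pr l) ≤ a / 4 * T (pr l) :=
        mul_le_mul_of_nonneg_right ((hDiD _).trans (hD _)) (hT _).le
      have h3 : 3 / (2 * a) * (Di (pr l) * T (pr l) / 3) ≤ 3 / (2 * a) * (a / 4 * T (pr l) / 3) :=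
        mul_le_mul_of_nonneg_left (by linarith) hκ
      have h4 : 3 / (2 * a) * (a / 4 * T (pr l) / 3) = T (pr l) / 8 := by field_simp; ring
      simp only [hεd] at h1 ⊢
      linarith)
    (by
      intro l i
      have h1 := hSK l
      have h2 : cK K l i ≤ Di (pr l) :=
        (Finset.single_le_sum (f := fun y => |K (pr l) y|) (fun _ _ => abs_nonneg _)
          (Finset.mem_univ (pr i))).trans (hKsum _)
      have h3 := (hDiD (pr l)).trans (hD (pr l))
      have h4 : 3 / (2 * a) * (3 / 5 * ∑ j, cK K l j + (1 - 3 / 5) * cK K l i) ≤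
        3 / (2 * a) * (2 / 5 * a) := mul_le_mul_of_nonneg_left (by linarith) hκ
      refine h4.trans (le_of_eq ?_)
      field_simp)
    (by norm_num) (by norm_num) hε0
    (by
      intro l
      have h1 := hSK l
      have h3 := (hDiD (pr l)).trans (hD (pr l))
      have h4 : 3 / (2 * a) * (∑ j, cK K l j) ≤
        3 / (2 * a) * (a / 2) := mul_le_mul_of_nonneg_left (by linarith) hκ
      refine h4.trans_lt ?_
      have : 3 / (2 * a) * (a / 2) = 3 / 4 := by field_simp; norm_num
      rw [this]; norm_num)
    (by
      intro s hs0 hs1 l ψ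
      obtain ⟨Cc, hCc, hup⟩ := Ws_update (cw S p T B R ths) (cm S T B) (cee S T) (ck S T B D ths)
        hw (cK K) hKcs hKcd s l ψ
      simp only [hup]
      set Y := ∑ j, cK K l j * cee S T j (ψ j) with hYd
      set P := ∑ j, cK K l j * cm S T B j (ψ j) with hPd
      have hY : 0 ≤ Y := Finset.sum_nonneg fun j _ => mul_nonneg (hKc0 _ _) (he0 _ _)
      have hP0 : 0 ≤ P := Finset.sum_nonneg fun j _ => mul_nonneg (hKc0 _ _) (hm0 _ _)
      have hP : P ≤ 10 / 3 * (D (pr l) * T (pr l)) :=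
        (Finset.sum_le_sum fun j _ => mul_le_mul_of_nonneg_left (hmM _ _) (hKc0 _ _)).trans (hSKM l)
      have hs1' : 0 ≤ 1 - s := by linarith
      have hred : ∀ V : ↥(SS S T l) → ℝ, ∑ t, V t * cee S T l t ≤
          (ε' l + 3 / (2 * a) * Y) * ∑ t, V t → ∑ t, Cc * V t * cee S T l t ≤
          (ε' l + 3 / (2 * a) * Y) * ∑ t, Cc * V t := by
        intro V hV
        have h1 := mul_le_mul_of_nonneg_left hV hCc.le
        rw [Finset.mul_sum] at h1
        rw [← Finset.mul_sum]
        have h2 : ∑ t, Cc * V t * cee S T l t = ∑ t, Cc * (V t * cee S T l t) :=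
          Finset.sum_congr rfl fun t _ => by ring
        rw [h2]; linarith
      apply hred
      clear_value Y P
      have hyn : 0 ≤ 3 / (2 * a) * Y := mul_nonneg hκ hY
      rcases l with x | x
      · -- plus chain
        simp only [pr, Sum.elim_inl, id] at hP
        set A := ths x + s * (4 / 3 * D x * T x - ths x) + (1 - s) * Y with hA
        have hA0 : 0 ≤ A := by
          have := mul_nonneg hs0 (hgap0 x)
          have := mul_nonneg hs1' hY
          linarith [hths0 x]
        have hVeq : ∀ t : ↥(SS S T (Sum.inl x)), cw S p T B R ths (Sum.inl x) t * Real.exp (s *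
            ck S T B D ths (Sum.inl x) t + (1 - s) * ((cm S T B (Sum.inl x) t +
            cee S T (Sum.inl x) t) * Y + cee S T (Sum.inl x) t * P)) =
            p t.1 * Real.exp (A * (t.1 + T x) + s * (D x * (10 / 3 * T x * ep (T x) t.1 +
              8 / 5 * ep (T x) t.1 ^ 2)) + (1 - s) * (ep (T x) t.1 * P)) := by
          intro t
          simp only [cw, ck, cm, cee, pr, Sum.elim_inl, id]
          rw [mul_assoc, ← Real.exp_add, mp_add_ep]
          congr 2
          simp only [hA]; ring
        simp only [hVeq]
        refine loc_bound _ _ (fun t => p t.1 * ep (T x) t.1 * Real.exp (13 / 16 * a * t.1 ^ 2))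
          (fun t => if -B x ≤ t.1 ∧ t.1 ≤ B x then p t.1 else 0)
          (fun t => (mul_pos (hppos x t) (Real.exp_pos _)).le) _ _ (Real.exp (A * (T x - B x)))
          hyn (Real.exp_pos _).le ?_ ?_ ?_ ?_ (hε'0 _)
        · intro t ht
          simp only [cee, pr, Sum.elim_inl, id] at ht ⊢
          have hpos : 0 < ep (T x) t.1 := hyn.trans_lt ht
          have htT : t.1 = T x + ep (T x) t.1 := by
            unfold ep at hpos ⊢
            rcases le_total (t.1 - T x) 0 with h | h
            · rw [max_eq_right h] at hpos; exact absurd hpos (lt_irrefl _)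
            · rw [max_eq_left h]; ring
          have hb := exp_bound a (D x) (T x) (B x) (ep (T x) t.1) Y P s ha (hD x) (hB x)
            (hBT x) hY hs0 hs1 ht hP
          rw [← htT] at hb
          have hAb : A * (t.1 + B x) ≤ 4 / 3 * D x * T x * (t.1 + B x) + (1 - s) * ((t.1 + B x) * Y) := by
            have h1 : ths x + s * (4 / 3 * D x * T x - ths x) ≤ 4 / 3 * D x * T x := by
              nlinarith [hgap0 x]
            have h2 : 0 ≤ t.1 + B x := by rw [htT]; linarith [hT x, hB x]
            have := mul_le_mul_of_nonneg_right h1 h2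
            simp only [hA]; linarith
          have hexp : A * (t.1 + T x) + s * (D x * (10 / 3 * T x * ep (T x) t.1 +
              8 / 5 * ep (T x) t.1 ^ 2)) + (1 - s) * (ep (T x) t.1 * P) ≤
              A * (T x - B x) + 13 / 16 * a * t.1 ^ 2 := by linarith
          have h3 := Real.exp_le_exp.2 hexp
          rw [Real.exp_add (A * (T x - B x))] at h3
          have h4 := mul_le_mul_of_nonneg_left h3 (mul_nonneg (hppos x t).le hpos.le)
          linarith
        · intro t
          exact mul_nonneg (mul_nonneg (hppos x t).le (ep_nonneg _ _)) (Real.exp_pos _).le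
        · intro t
          split_ifs with h
          · rw [mul_comm]
            refine mul_le_mul_of_nonneg_left (Real.exp_le_exp.2 ?_) (hppos x t).le
            have h1 : ep (T x) t.1 = 0 := max_eq_right (by linarith [h.2, hBT x, hB x])
            rw [h1]
            have := mul_le_mul_of_nonneg_left (show T x - B x ≤ t.1 + T x by linarith [h.1]) hA0
            linarith
          · rw [mul_zero]
            exact (mul_pos (hppos x t) (Real.exp_pos _)).le
        · have h1 : ∑ t : ↥(SS S T (Sum.inl x)), p t.1 * ep (T x) t.1 *
              Real.exp (13 / 16 * a * t.1 ^ 2) =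
              ∑ t ∈ SS S T (Sum.inl x), p t * ep (T x) t * Real.exp (13 / 16 * a * t ^ 2) :=
            Finset.sum_coe_sort (SS S T (Sum.inl x))
              (fun t => p t * ep (T x) t * Real.exp (13 / 16 * a * t ^ 2))
          have h2 : ∑ t : ↥(SS S T (Sum.inl x)), (if -B x ≤ t.1 ∧ t.1 ≤ B x then p t.1 else 0) =
              ∑ t ∈ SS S T (Sum.inl x), (if -B x ≤ t ∧ t ≤ B x then p t else 0) :=
            Finset.sum_coe_sort (SS S T (Sum.inl x))
              (fun t => if -B x ≤ t ∧ t ≤ B x then p t else 0)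
          have h3 : ∑ t ∈ SS S T (Sum.inl x), (if -B x ≤ t ∧ t ≤ B x then p t else 0) =
              ∑ t ∈ S.filter (fun t => -B x ≤ t ∧ t ≤ B x), p t := by
            rw [← Finset.sum_filter]
            simp only [SS, Sum.elim_inl, Finset.filter_filter]
            refine Finset.sum_congr (Finset.filter_congr fun t _ => ?_) fun _ _ => rfl
            constructor
            · exact fun h => h.2
            · exact fun h => ⟨by linarith [h.1, hBT x, hB x], h⟩
          rw [h1, h2, h3]
          refine le_trans (Finset.sum_le_sum_of_subset_of_nonneg (Finset.filter_subset _ _) ?_)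
            (hεp x)
          intro t ht _
          exact mul_nonneg (mul_nonneg (hp t ht).le (ep_nonneg _ _)) (Real.exp_pos _).le
      · -- minus chain
        simp only [pr, Sum.elim_inr, id] at hP
        have mn0 : mn (T x) (B x) 0 = 0 := if_neg (by linarith [hT x])
        have ep00 : ep (T x) 0 = 0 := max_eq_right (by linarith [hT x])
        refine loc_bound _ _ (fun t => qn p (R x) t.1 * ep (T x) t.1 *
            Real.exp (13 / 16 * a * t.1 ^ 2))
          (fun t => if t.1 = 0 then 1 else 0)
          (fun t => (mul_pos (hw _ t) (Real.exp_pos _)).le) _ _ 1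
          hyn zero_le_one ?_ ?_ ?_ ?_ (hε'0 _)
        · intro t ht
          simp only [cee, pr, Sum.elim_inr, id] at ht
          have hpos : 0 < ep (T x) t.1 := hyn.trans_lt ht
          have htT : t.1 = T x + ep (T x) t.1 := by
            unfold ep at hpos ⊢
            rcases le_total (t.1 - T x) 0 with h | h
            · rw [max_eq_right h] at hpos; exact absurd hpos (lt_irrefl _)
            · rw [max_eq_left h]; ring
          have hb := exp_bound a (D x) (T x) (B x) (ep (T x) t.1) Y P s ha (hD x) (hB x)
            (hBT x) hY hs0 hs1 ht hP
          rw [← htT] at hb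
          have hme : mn (T x) (B x) t.1 + ep (T x) t.1 = t.1 + B x := by
            unfold mn; rw [if_pos (by linarith)]; linarith
          have h1 : ths x + s * (4 / 3 * D x * T x - ths x) ≤ 4 / 3 * D x * T x := by
            nlinarith [hgap0 x]
          have h2 : 0 ≤ t.1 + B x := by rw [htT]; linarith [hT x, hB x]
          have hAb := mul_le_mul_of_nonneg_right h1 h2
          simp only [cw, ck, cm, cee, pr, Sum.elim_inr, id]
          rw [hme]
          have hexp : ths x * (t.1 + B x) + (s * ((4 / 3 * D x * T x - ths x) * (t.1 + B x) +
              D x * (10 / 3 * T x * ep (T x) t.1 + 8 / 5 * ep (T x) t.1 ^ 2)) +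
              (1 - s) * ((t.1 + B x) * Y + ep (T x) t.1 * P)) ≤ 13 / 16 * a * t.1 ^ 2 := by
            linarith
          have h3 := Real.exp_le_exp.2 hexp
          have h4 := mul_le_mul_of_nonneg_left h3 (mul_nonneg (hqpos x t).le hpos.le)
          rw [Real.exp_add (ths x * (t.1 + B x))] at h4
          linarith
        · intro t
          exact mul_nonneg (mul_nonneg (hqpos x t).le (ep_nonneg _ _)) (Real.exp_pos _).le
        · intro t
          split_ifs with h
          · simp only [cw, ck, cm, cee, pr, Sum.elim_inr, id, h, mn0, ep00, qn]
            simp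
          · rw [mul_zero]
            exact (mul_pos (hw _ t) (Real.exp_pos _)).le
        · have h2 : ∑ t : ↥(SS S T (Sum.inr x)), (if t.1 = 0 then (1 : ℝ) else 0) = 1 := by
            rw [Finset.sum_eq_single (⟨0, by simp [SS]⟩ : ↥(SS S T (Sum.inr x)))]
            · simp
            · intro t _ ht; rw [if_neg]; exact fun h => ht (Subtype.ext h)
            · simp
          rw [h2, mul_one]
          have h1 : ∑ t : ↥(SS S T (Sum.inr x)), qn p (R x) t.1 * ep (T x) t.1 *
              Real.exp (13 / 16 * a * t.1 ^ 2) =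
              ∑ t ∈ SS S T (Sum.inr x), qn p (R x) t * ep (T x) t * Real.exp (13 / 16 * a * t ^ 2) :=
            Finset.sum_coe_sort (SS S T (Sum.inr x))
              (fun t => qn p (R x) t * ep (T x) t * Real.exp (13 / 16 * a * t ^ 2))
          rw [h1]
          simp only [SS, Sum.elim_inr]
          rw [Finset.sum_insert (by simp only [Finset.mem_filter]; intro h; linarith [h.2, hT x]),
            ep00, mul_zero, zero_mul, zero_add, Finset.sum_filter,
            Finset.sum_image (fun a _ b _ h => neg_injective h)]
          have h5 : ∀ t ∈ S, (if T x < -t then qn p (R x) (-t) * ep (T x) (-t) *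
              Real.exp (13 / 16 * a * (-t) ^ 2) else 0) ≤
              (p t * ep (T x) (-t) * Real.exp (13 / 16 * a * t ^ 2)) / R x := by
            intro t ht
            split_ifs with h
            · have h0 : -t ≠ 0 := by intro h'; linarith [hT x]
              rw [qn, if_neg h0, neg_neg, neg_sq]
              refine le_of_eq ?_; ring
            · exact div_nonneg (mul_nonneg (mul_nonneg (hp t ht).le (ep_nonneg _ _))
                (Real.exp_pos _).le) (hRpos x).le
          refine (Finset.sum_le_sum h5).trans ?_
          rw [← Finset.sum_div, div_le_iff₀ (hRpos x)]
          exact (hεn x).trans (mul_le_mul_of_nonneg_left (hcR x) (hεn0 x)))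
    (by
      intro i c c' hc
      have hm := hmm i hc
      have he := hem i hc
      have he00 := he0 i c
      have e1 : ∀ c, ∑ j, cK K i j * (ε j * cm S T B i c + (M j + ε j) * cee S T i c +
          (1 + 3 / 5) / 2 * cee S T i c ^ 2) = (∑ j, cK K i j * ε j) * cm S T B i c +
          ((∑ j, cK K i j * M j) + ∑ j, cK K i j * ε j) * cee S T i c +
          (4 / 5 * ∑ j, cK K i j) * cee S T i c ^ 2 := by
        intro c
        rw [← Finset.sum_add_distrib, Finset.mul_sum, Finset.sum_mul, Finset.sum_mul,
          Finset.sum_mul, ← Finset.sum_add_distrib, ← Finset.sum_add_distrib]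
        exact Finset.sum_congr rfl fun j _ => by ring
      dsimp only
      rw [e1, e1]
      have a1 := (hSKε i).trans (hgap (pr i))
      have a2 := hSKM i
      have a3 : 4 / 5 * ∑ j, cK K i j ≤ 8 / 5 * D (pr i) := by
        have := hSK i; have := hDiD (pr i); linarith
      have he2 : cee S T i c ^ 2 ≤ cee S T i c' ^ 2 := by nlinarith
      have b1 := mul_nonneg (sub_nonneg.2 a1) (sub_nonneg.2 hm)
      have b2 := mul_nonneg (sub_nonneg.2 a1) (sub_nonneg.2 he)
      have b3 := mul_nonneg (sub_nonneg.2 a2) (sub_nonneg.2 he)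
      have b4 := mul_nonneg (sub_nonneg.2 a3) (sub_nonneg.2 he2)
      unfold ck
      nlinarith)
    (fun ψ => G (PP ψ)) (fun ψ ψ' hψ => hG fun x => hψ (Sum.inl x))
  have hA := stepA (T := T) p hp K hKs B R θ ths (fun x => rfl) hT hB (fun x => rfl) hRpos G hG
  unfold ex at hmain
  simp only [Ws_zero] at hmain
  -- product form at time one
  set vv : ∀ x, ↥(SS S T (Sum.inl x)) → ℝ := fun x t => p t.1 * Real.exp (Th (D x) (T x) t.1)
    with hvv
  set uu : (∀ x, ↥(SS S T (Sum.inr x))) → ℝ := fun N => (∏ x, Real.exp (4 / 3 * D x * T x * T x)) *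
    ∏ x, (cw S p T B R ths (Sum.inr x) (N x) * Real.exp (ck S T B D ths (Sum.inr x) (N x))) with huu
  set inj : (∀ x, ↥(SS S T (Sum.inl x))) → (ι → ↥S) := fun P x =>
    ⟨(P x).1, (Finset.mem_filter.1 (P x).2).1⟩ with hinj
  have hinji : Function.Injective inj := by
    intro P P' hPP
    funext x
    have := congrFun hPP x
    simp only [hinj, Subtype.mk.injEq] at this
    exact Subtype.ext this
  have hone : ∀ Q : (ι → ↥S) → ℝ, ∑ ψ, Ws (cw S p T B R ths) (cm S T B) (cee S T)
      (ck S T B D ths) (cK K) 1 ψ * Q (PP ψ) =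
      (∑ s : ι → ↥S, (∏ x, (if -T x ≤ (s x).1 then p (s x).1 * Real.exp (Th (D x) (T x) (s x).1)
        else 0)) * Q s) * ∑ N, uu N := by
    intro Q
    have h1 : ∑ ψ, Ws (cw S p T B R ths) (cm S T B) (cee S T)
      (ck S T B D ths) (cK K) 1 ψ * Q (PP ψ) =
      ∑ q : (∀ x, ↥(SS S T (Sum.inl x))) × (∀ x, ↥(SS S T (Sum.inr x))),
        ((∏ x, vv x (q.1 x)) * Q (inj q.1)) * uu q.2 := by
      refine Fintype.sum_equiv (Equiv.sumPiEquivProdPi (fun i => ↥(SS S T i))) _ _ (fun ψ => ?_)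
      rw [Ws_one]
      simp only [Equiv.sumPiEquivProdPi, Equiv.coe_fn_mk, hvv, huu, hinj]
      have : (PP ψ) = fun x => ⟨(ψ (Sum.inl x)).1, (Finset.mem_filter.1 (ψ (Sum.inl x)).2).1⟩ := rfl
      rw [this]; ring
    rw [h1, Fintype.sum_prod_type]
    have h2 : ∑ s : ι → ↥S, (∏ x, (if -T x ≤ (s x).1 then p (s x).1 *
        Real.exp (Th (D x) (T x) (s x).1) else 0)) * Q s =
        ∑ P : (∀ x, ↥(SS S T (Sum.inl x))), (∏ x, vv x (P x)) * Q (inj P) := by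
      symm
      refine Fintype.sum_of_injective inj hinji _ _ ?_ ?_
      · intro s hs
        by_cases hall : ∀ x, -T x ≤ (s x).1
        · exfalso; apply hs
          refine ⟨fun x => ⟨(s x).1, ?_⟩, rfl⟩
          simp only [SS, Sum.elim_inl, Finset.mem_filter]
          exact ⟨(s x).2, hall x⟩
        · push Not at hall
          obtain ⟨x, hx⟩ := hall
          rw [Finset.prod_eq_zero (Finset.mem_univ x) (if_neg (not_le.2 hx)), zero_mul]
      · intro P
        congr 1
        refine Finset.prod_congr rfl fun x _ => ?_
        rw [if_pos]
        exact (Finset.mem_filter.1 (P x).2).2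
    rw [h2, Finset.sum_mul]
    refine Finset.sum_congr rfl fun P _ => ?_
    rw [Finset.mul_sum]
  have hone1 := hone (fun _ => 1)
  simp only [mul_one] at hone1
  have hmain2 : (∑ ψ : (∀ i, ↥(SS S T i)), nu0 p K B R ths ψ * G (PP ψ)) *
      ((∑ s : ι → ↥S, ∏ x, (if -T x ≤ (s x).1 then p (s x).1 *
        Real.exp (Th (D x) (T x) (s x).1) else 0)) * ∑ N, uu N) ≤
      ((∑ s : ι → ↥S, (∏ x, (if -T x ≤ (s x).1 then p (s x).1 *
        Real.exp (Th (D x) (T x) (s x).1) else 0)) * G s) * ∑ N, uu N) *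
      (∑ ψ : (∀ i, ↥(SS S T i)), nu0 p K B R ths ψ) := by
    rw [← hone1, ← hone G]
    convert hmain
  clear hmain
  have hU : 0 < ∑ N, uu N := by
    refine Finset.sum_pos (fun N _ => ?_) ⟨fun x => Classical.arbitrary _, Finset.mem_univ _⟩
    exact mul_pos (Finset.prod_pos fun x _ => Real.exp_pos _)
      (Finset.prod_pos fun x _ => mul_pos (hw _ _) (Real.exp_pos _))
  have hZ0 : 0 < ∑ ψ : (∀ i, ↥(SS S T i)), nu0 p K B R ths ψ := by
    refine Finset.sum_pos (fun ψ _ => ?_) ⟨fun x => Classical.arbitrary _, Finset.mem_univ _⟩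
    exact mul_pos (Finset.prod_pos fun x _ => mul_pos (hppos x _) (hqpos x _)) (Real.exp_pos _)
  have hNH : 0 ≤ ∑ s : ι → ↥S, (∏ x, p (s x).1) * Real.exp (HH K θ fun x => (s x).1) :=
    Finset.sum_nonneg fun s _ => mul_nonneg (Finset.prod_nonneg fun x _ => (hp _ (s x).2).le)
      (Real.exp_pos _).le
  have hv0 : 0 ≤ ∑ s : ι → ↥S, ∏ x, (if -T x ≤ (s x).1 then p (s x).1 *
      Real.exp (Th (D x) (T x) (s x).1) else 0) :=
    Finset.sum_nonneg fun s _ => Finset.prod_nonneg fun x _ => by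
      split_ifs
      · exact (mul_pos (hp _ (s x).2) (Real.exp_pos _)).le
      · exact le_rfl
  generalize (∑ s : ι → ↥S, (∏ x, p (s x).1) * Real.exp (HH K θ fun x => (s x).1) * G s) = NG at *
  generalize (∑ s : ι → ↥S, (∏ x, p (s x).1) * Real.exp (HH K θ fun x => (s x).1)) = N1 at *
  generalize (∑ s : ι → ↥S, (∏ x, (if -T x ≤ (s x).1 then p (s x).1 *
      Real.exp (Th (D x) (T x) (s x).1) else 0)) * G s) = VG at *
  generalize (∑ s : ι → ↥S, ∏ x, (if -T x ≤ (s x).1 then p (s x).1 *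
      Real.exp (Th (D x) (T x) (s x).1) else 0)) = V1 at *
  generalize (∑ N, uu N) = U at *
  generalize (∑ ψ : (∀ i, ↥(SS S T i)), nu0 p K B R ths ψ * G (PP ψ)) = n0G at *
  generalize (∑ ψ : (∀ i, ↥(SS S T i)), nu0 p K B R ths ψ) = n0 at *
  have f1 : n0G * V1 ≤ VG * n0 := by
    refine le_of_mul_le_mul_right ?_ hU
    linarith
  refine le_of_mul_le_mul_right ?_ hZ0
  calc NG * V1 * n0 = (NG * n0) * V1 := by ring
    _ ≤ (n0G * N1) * V1 := mul_le_mul_of_nonneg_right hA hv0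
    _ = (n0G * V1) * N1 := by ring
    _ ≤ (VG * n0) * N1 := mul_le_mul_of_nonneg_right f1 hNH
    _ = _ := by ring

end main
end FinB

namespace FinB

/-- unnormalised one dimensional domination -/
def Dom1 (μ ν : Measure ℝ) : Prop :=
  ∀ g : ℝ → ℝ≥0∞, Measurable g → Monotone g →
    (∫⁻ u, g u ∂μ) * ν Set.univ ≤ (∫⁻ u, g u ∂ν) * μ Set.univ

theorem dom_lmarginal {ι : Type*} [Fintype ι] (μ ν : ι → Measure ℝ) [∀ i, IsFiniteMeasure (μ i)]
    [∀ i, IsFiniteMeasure (ν i)] (h : ∀ i, Dom1 (μ i) (ν i)) (g : (ι → ℝ) → ℝ≥0∞)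
    (hg : Measurable g) (hgm : Monotone g) (s : Finset ι) :
    ∀ x, (∫⋯∫⁻_s, g ∂μ) x * ∏ i ∈ s, ν i Set.univ ≤ (∫⋯∫⁻_s, g ∂ν) x * ∏ i ∈ s, μ i Set.univ := by
  induction s using Finset.induction_on with
  | empty => intro x; simp
  | insert i s hi ih =>
    intro x
    have hmono : Monotone (∫⋯∫⁻_s, g ∂μ) := by
      intro x y hxy
      refine lintegral_mono fun z => hgm fun j => ?_
      unfold Function.updateFinset
      split_ifs
      · exact le_rfl
      · exact hxy j
    have hmeas : Measurable (∫⋯∫⁻_s, g ∂μ) := hg.lmarginal μ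
    have hmeas' : Measurable (∫⋯∫⁻_s, g ∂ν) := hg.lmarginal ν
    rw [lmarginal_insert g hg hi, lmarginal_insert g hg hi, Finset.prod_insert hi,
      Finset.prod_insert hi]
    have hm1 : Measurable fun u => (∫⋯∫⁻_s, g ∂μ) (Function.update x i u) :=
      hmeas.comp (measurable_update x)
    have hm2 : Measurable fun u => (∫⋯∫⁻_s, g ∂ν) (Function.update x i u) :=
      hmeas'.comp (measurable_update x)
    have h1 := h i (fun u => (∫⋯∫⁻_s, g ∂μ) (Function.update x i u))
      (hmeas.comp (measurable_update x)) (fun u v huv => hmono (Function.update_mono huv))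
    calc _ = ((∫⁻ u, (∫⋯∫⁻_s, g ∂μ) (Function.update x i u) ∂μ i) * ν i Set.univ) *
          ∏ j ∈ s, ν j Set.univ := by ring
      _ ≤ ((∫⁻ u, (∫⋯∫⁻_s, g ∂μ) (Function.update x i u) ∂ν i) * μ i Set.univ) *
          ∏ j ∈ s, ν j Set.univ := by gcongr
      _ = (∫⁻ u, (∫⋯∫⁻_s, g ∂μ) (Function.update x i u) * ∏ j ∈ s, ν j Set.univ ∂ν i) *
          μ i Set.univ := by
          rw [lintegral_mul_const _ hm1]; ring
      _ ≤ (∫⁻ u, (∫⋯∫⁻_s, g ∂ν) (Function.update x i u) * ∏ j ∈ s, μ j Set.univ ∂ν i) *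
          μ i Set.univ := by
          refine mul_le_mul_left (lintegral_mono fun u => ?_) _
          exact ih _
      _ = _ := by
          rw [lintegral_mul_const _ hm2]; ring

theorem dom_pi {ι : Type*} [Fintype ι] (μ ν : ι → Measure ℝ) [∀ i, IsFiniteMeasure (μ i)]
    [∀ i, IsFiniteMeasure (ν i)] (h : ∀ i, Dom1 (μ i) (ν i)) (g : (ι → ℝ) → ℝ≥0∞)
    (hg : Measurable g) (hgm : Monotone g) :
    (∫⁻ φ, g φ ∂Measure.pi μ) * ∏ i, ν i Set.univ ≤
      (∫⁻ φ, g φ ∂Measure.pi ν) * ∏ i, μ i Set.univ := by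
  have := dom_lmarginal μ ν h g hg hgm Finset.univ 0
  rwa [← lintegral_eq_lmarginal_univ, ← lintegral_eq_lmarginal_univ] at this

/-- rounding -/
noncomputable def qr (n : ℕ) (v : ℝ) : ℝ := (⌊(n + 1 : ℝ) * min v n⌋₊ : ℝ) / (n + 1)

theorem qr_mono (n : ℕ) : Monotone (qr n) := by
  intro u v h
  unfold qr
  gcongr

theorem qr_nonneg (n : ℕ) (v : ℝ) : 0 ≤ qr n v := by unfold qr; positivity

theorem qr_le (n : ℕ) (v : ℝ) : qr n v ≤ max v 0 := by
  unfold qr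
  have hn : (0 : ℝ) < n + 1 := by positivity
  rcases le_total 0 v with h | h
  · rw [div_le_iff₀ hn]
    have h0 : 0 ≤ min v (n : ℝ) := le_min h (Nat.cast_nonneg _)
    calc ((⌊(n + 1 : ℝ) * min v n⌋₊ : ℕ) : ℝ) ≤ (n + 1 : ℝ) * min v n :=
          Nat.floor_le (by positivity)
      _ ≤ (n + 1 : ℝ) * max v 0 := by
          gcongr
          exact (min_le_left _ _).trans (le_max_left _ _)
      _ = _ := mul_comm _ _
  · rw [Nat.floor_of_nonpos]
    · simp
    · exact mul_nonpos_of_nonneg_of_nonpos hn.le ((min_le_left _ _).trans h)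

theorem qr_zero (n : ℕ) (v : ℝ) (h : v ≤ 0) : qr n v = 0 :=
  le_antisymm ((qr_le n v).trans (by simp [h])) (qr_nonneg n v)

theorem qr_meas (n : ℕ) : Measurable (qr n) := (qr_mono n).measurable

theorem qr_mem (n : ℕ) (v : ℝ) :
    qr n v ∈ (Finset.range ((n + 1) * n + 1)).image (fun k : ℕ => (k : ℝ) / (n + 1)) := by
  rw [Finset.mem_image]
  refine ⟨_, ?_, rfl⟩
  rw [Finset.mem_range, Nat.lt_succ_iff]
  refine Nat.floor_le_of_le ?_
  push_cast
  gcongr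
  exact min_le_right _ _

theorem qr_lim (v : ℝ) : Filter.Tendsto (fun n => qr n v) Filter.atTop (nhds (max v 0)) := by
  have hev : ∀ᶠ n : ℕ in Filter.atTop, max v 0 - 1 / ((n : ℝ) + 1) ≤ qr n v := by
    filter_upwards [Filter.eventually_ge_atTop ⌈v⌉₊] with n hn
    have hvn : v ≤ n := (Nat.le_ceil v).trans (by exact_mod_cast hn)
    have hn' : (0 : ℝ) < n + 1 := by positivity
    rcases le_total 0 v with h | h
    · unfold qr
      rw [min_eq_left hvn, max_eq_left h, sub_le_iff_le_add, ← add_div, le_div_iff₀ hn', mul_comm]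
      exact (Nat.lt_floor_add_one _).le
    · rw [qr_zero n v h, max_eq_right h]
      have : 0 ≤ 1 / ((n : ℝ) + 1) := by positivity
      linarith
  refine tendsto_of_tendsto_of_tendsto_of_le_of_le' ?_ tendsto_const_nhds hev
    (Filter.Eventually.of_forall fun n => qr_le n v)
  have := tendsto_one_div_add_atTop_nhds_zero_nat (𝕜 := ℝ)
  simpa using (tendsto_const_nhds (x := max v 0)).sub this

/-- symmetric rounding toward zero -/
noncomputable def rr (n : ℕ) (v : ℝ) : ℝ := qr n v - qr n (-v)

theorem rr_mono (n : ℕ) : Monotone (rr n) := by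
  intro u v h
  have h1 := qr_mono n h
  have h2 := qr_mono n (neg_le_neg h)
  unfold rr; linarith

theorem rr_meas (n : ℕ) : Measurable (rr n) := (rr_mono n).measurable

theorem rr_neg (n : ℕ) (v : ℝ) : rr n (-v) = - rr n v := by unfold rr; rw [neg_neg]; ring

theorem rr_le (n : ℕ) (v : ℝ) : rr n v ≤ max v 0 := by
  have := qr_le n v
  have := qr_nonneg n (-v)
  unfold rr; linarith

theorem rr_abs (n : ℕ) (v : ℝ) : |rr n v| ≤ |v| := by
  rw [abs_le]
  have h1 := rr_le n v
  have h2 := rr_le n (-v)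
  rw [rr_neg] at h2
  have h3 : max v 0 ≤ |v| := max_le (le_abs_self v) (abs_nonneg v)
  have h4 : max (-v) 0 ≤ |v| := max_le (neg_le_abs v) (abs_nonneg v)
  constructor <;> linarith

theorem rr_lim (v : ℝ) : Filter.Tendsto (fun n => rr n v) Filter.atTop (nhds v) := by
  have := (qr_lim v).sub (qr_lim (-v))
  have h2 : max v 0 - max (-v) 0 = v := by
    rcases le_total 0 v with h | h
    · rw [max_eq_left h, max_eq_right (by linarith)]; ring
    · rw [max_eq_right h, max_eq_left (by linarith)]; ring
  rwa [h2] at this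

/-- range -/
noncomputable def rg (n : ℕ) : Finset ℝ :=
  (((Finset.range ((n + 1) * n + 1)).image (fun k : ℕ => (k : ℝ) / (n + 1))) ×ˢ
    ((Finset.range ((n + 1) * n + 1)).image (fun k : ℕ => (k : ℝ) / (n + 1)))).image
      (fun q => q.1 - q.2)

theorem rr_mem (n : ℕ) (v : ℝ) : rr n v ∈ rg n := by
  unfold rg rr
  rw [Finset.mem_image]
  exact ⟨(qr n v, qr n (-v)), Finset.mem_product.2 ⟨qr_mem n v, qr_mem n (-v)⟩, rfl⟩

section disc
variable (ρ : Measure ℝ) [IsFiniteMeasure ρ]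

/-- atom mass -/
noncomputable def pn (n : ℕ) (t : ℝ) : ℝ := (ρ (rr n ⁻¹' {t})).toReal

/-- support -/
noncomputable def Sn (n : ℕ) : Finset ℝ := (rg n).filter (fun t => 0 < pn ρ n t)

theorem pn_pos (n : ℕ) (t : ℝ) (ht : t ∈ Sn ρ n) : 0 < pn ρ n t := (Finset.mem_filter.1 ht).2

theorem ms (n : ℕ) (t : ℝ) : MeasurableSet (rr n ⁻¹' {t}) := rr_meas n (measurableSet_singleton t)

theorem ae_mem (n : ℕ) : ∀ᵐ u ∂ρ, rr n u ∈ Sn ρ n := by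
  have h : ∀ t ∈ (rg n : Set ℝ), t ∉ Sn ρ n → ∀ᵐ u ∂ρ, rr n u ≠ t := by
    intro t ht htS
    have h0 : ρ (rr n ⁻¹' {t}) = 0 := by
      by_contra hne
      apply htS
      exact Finset.mem_filter.2 ⟨ht, ENNReal.toReal_pos hne (measure_ne_top _ _)⟩
    rw [ae_iff]
    convert h0 using 2
    ext u; simp
  have h2 : ∀ᵐ u ∂ρ, ∀ t ∈ (rg n : Set ℝ), t ∉ Sn ρ n → rr n u ≠ t := by
    rw [ae_ball_iff (Finset.countable_toSet _)]
    intro t ht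
    by_cases hS : t ∈ Sn ρ n
    · exact Filter.Eventually.of_forall fun u h => absurd hS h
    · filter_upwards [h t ht hS] with u hu _ using hu
  filter_upwards [h2] with u hu
  by_contra hn
  exact hu _ (rr_mem n u) hn rfl

theorem sum1 (n : ℕ) (F : ℝ → ℝ) (Q : ℝ → Prop) (hQ : MeasurableSet {t | Q t}):
    ∑ t ∈ (Sn ρ n).filter Q, pn ρ n t * F t = ∫ u in {u | Q (rr n u)}, F (rr n u) ∂ρ := by
  have hU : {u | Q (rr n u)} =ᵐ[ρ] ⋃ t ∈ (Sn ρ n).filter Q, rr n ⁻¹' {t} := by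
    filter_upwards [ae_mem ρ n] with u hu
    apply propext
    change Q (rr n u) ↔ u ∈ ⋃ t ∈ (Sn ρ n).filter Q, rr n ⁻¹' {t}
    simp [hu]
  rw [setIntegral_congr_set hU, integral_biUnion_finset]
  · refine Finset.sum_congr rfl fun t _ => ?_
    rw [setIntegral_congr_fun (g := fun _ => F t) (ms n t) (fun u hu => by
      have : rr n u = t := hu
      simp only [this])]
    rw [setIntegral_const]; rfl
  · intro t _; exact ms n t
  · intro t _ t' _ htt
    refine Set.disjoint_left.2 fun u hu hu' => htt ?_
    exact (show rr n u = t from hu).symm.trans hu'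
  · intro t _
    refine (integrableOn_const (C := F t) (measure_ne_top _ _)).congr_fun (fun u hu => ?_) (ms n t)
    have : rr n u = t := hu
    simp only [this]

variable {ι : Type*} [Fintype ι]

/-- cell -/
def cell (n : ℕ) (s : ι → ℝ) : Set (ι → ℝ) := Set.univ.pi fun x => rr n ⁻¹' {s x}

theorem cell_meas (n : ℕ) (s : ι → ℝ) : MeasurableSet (cell n s) :=
  MeasurableSet.univ_pi fun x => ms n _

theorem mem_cell (n : ℕ) (s φ : ι → ℝ) : φ ∈ cell n s ↔ (fun x => rr n (φ x)) = s := by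
  simp [cell, funext_iff]

theorem sumpi (n : ℕ) (F g : (ι → ℝ) → ℝ) (hg : Integrable g (Measure.pi fun _ : ι => ρ)) :
    ∑ s : ι → ↥(Sn ρ n), F (fun x => (s x).1) *
      ∫ φ in cell n (fun x => (s x).1), g φ ∂(Measure.pi fun _ : ι => ρ) =
      ∫ φ, F (fun x => rr n (φ x)) * g φ ∂(Measure.pi fun _ : ι => ρ) := by
  have hae : ∀ᵐ φ ∂(Measure.pi fun _ : ι => ρ), ∀ x, rr n (φ x) ∈ Sn ρ n := by
    rw [ae_all_iff]
    intro x
    exact (Measure.tendsto_eval_ae_ae (μ := fun _ : ι => ρ) (i := x)).eventually (ae_mem ρ n)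
  have hU : ∀ᵐ φ ∂(Measure.pi fun _ : ι => ρ), φ ∈ ⋃ s : ι → ↥(Sn ρ n),
      cell n (fun x => (s x).1) := by
    filter_upwards [hae] with φ hφ
    rw [Set.mem_iUnion]
    exact ⟨fun x => ⟨rr n (φ x), hφ x⟩, (mem_cell n _ _).2 rfl⟩
  have heq : ∀ s : ι → ℝ, Set.EqOn (fun φ : ι → ℝ => F s * g φ)
      (fun φ => F (fun x => rr n (φ x)) * g φ) (cell n s) := by
    intro s φ hφ
    have := (mem_cell n _ _).1 hφ
    simp only [this]
  rw [← Measure.restrict_eq_self_of_ae_mem hU, integral_iUnion_fintype, 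
    Measure.restrict_eq_self_of_ae_mem hU]
  · refine Finset.sum_congr rfl fun s _ => ?_
    rw [← setIntegral_congr_fun (cell_meas n _) (heq _), integral_const_mul]
  · intro s; exact cell_meas n _
  · intro s s' hss
    refine Set.disjoint_left.2 fun φ hφ hφ' => hss ?_
    have h1 := (mem_cell n _ _).1 hφ
    have h2 := (mem_cell n _ _).1 hφ'
    funext x
    exact Subtype.ext (congrFun (h1.symm.trans h2) x)
  · intro s
    exact IntegrableOn.congr_fun (hg.integrableOn.const_mul _) (heq _) (cell_meas n _)

/-- conditional expectation -/
noncomputable def gh (n : ℕ) (g : (ι → ℝ) → ℝ) (s : ι → ↥(Sn ρ n)) : ℝ :=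
  (∫ φ in cell n (fun x => (s x).1), g φ ∂(Measure.pi fun _ : ι => ρ)) / ∏ x, pn ρ n (s x).1

theorem dom_cell (n : ℕ) (t t' : ℝ) (h : t ≤ t') :
    Dom1 (ρ.restrict (rr n ⁻¹' {t})) (ρ.restrict (rr n ⁻¹' {t'})) := by
  intro g hg hgm
  rcases h.eq_or_lt with rfl | hlt
  · exact le_rfl
  set c : ℝ≥0∞ := ⨆ u ∈ rr n ⁻¹' {t}, g u
  have h1 : ∀ u ∈ rr n ⁻¹' {t}, g u ≤ c := fun u hu => le_iSup₂ (f := fun u _ => g u) u hu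
  have h2 : ∀ u ∈ rr n ⁻¹' {t'}, c ≤ g u := fun u hu => iSup₂_le fun v hv => hgm (by
    by_contra hcon
    push Not at hcon
    have := rr_mono n hcon.le
    rw [show rr n u = t' from hu, show rr n v = t from hv] at this
    linarith)
  have h3 : ∫⁻ u in rr n ⁻¹' {t}, g u ∂ρ ≤ c * ρ (rr n ⁻¹' {t}) := by
    rw [← setLIntegral_const]
    exact setLIntegral_mono measurable_const h1
  have h4 : c * ρ (rr n ⁻¹' {t'}) ≤ ∫⁻ u in rr n ⁻¹' {t'}, g u ∂ρ := by
    rw [← setLIntegral_const]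
    exact setLIntegral_mono hg h2
  rw [Measure.restrict_apply_univ, Measure.restrict_apply_univ]
  calc _ ≤ c * ρ (rr n ⁻¹' {t}) * ρ (rr n ⁻¹' {t'}) := by gcongr
    _ = c * ρ (rr n ⁻¹' {t'}) * ρ (rr n ⁻¹' {t}) := by ring
    _ ≤ _ := by gcongr

theorem gh_mono (n : ℕ) (g : (ι → ℝ) → ℝ) (hg : Measurable g) (hgm : Monotone g)
    (hg0 : ∀ φ, 0 ≤ g φ) (hg1 : ∀ φ, g φ ≤ 1) : Monotone (gh (ι := ι) ρ n g) := by
  intro s s' hss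
  unfold gh
  have hp : ∀ s : ι → ↥(Sn ρ n), 0 < ∏ x, pn ρ n (s x).1 := fun s =>
    Finset.prod_pos fun x _ => pn_pos ρ n _ (s x).2
  rw [div_le_div_iff₀ (hp s) (hp s')]
  have hd := dom_pi (fun x => ρ.restrict (rr n ⁻¹' {(s x).1}))
    (fun x => ρ.restrict (rr n ⁻¹' {(s' x).1})) (fun x => dom_cell ρ n _ _ (hss x))
    (fun φ => ENNReal.ofReal (g φ)) hg.ennreal_ofReal
    (fun φ ψ h => ENNReal.ofReal_le_ofReal (hgm h))
  rw [← Measure.restrict_pi_pi, ← Measure.restrict_pi_pi] at hd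
  simp only [Measure.restrict_apply_univ] at hd
  have hI : ∀ s : ι → ↥(Sn ρ n), ∫ φ in cell n (fun x => (s x).1), g φ ∂(Measure.pi fun _ : ι => ρ)
      = (∫⁻ φ in cell n (fun x => (s x).1), ENNReal.ofReal (g φ) ∂(Measure.pi fun _ : ι => ρ)).toReal :=
    fun s => integral_eq_lintegral_of_nonneg_ae (Filter.Eventually.of_forall hg0)
      hg.aestronglyMeasurable
  have hfin : ∀ s : ι → ↥(Sn ρ n),
      (∫⁻ φ in cell n (fun x => (s x).1), ENNReal.ofReal (g φ) ∂(Measure.pi fun _ : ι => ρ)) ≠ ⊤ := by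
    intro s
    refine ne_top_of_le_ne_top ?_ (lintegral_mono (g := fun _ => (1 : ℝ≥0∞)) fun φ => ?_)
    · simp only [lintegral_const, one_mul]; exact measure_ne_top _ _
    · exact ENNReal.ofReal_le_one.2 (hg1 φ)
  rw [hI, hI]
  unfold pn
  rw [← ENNReal.toReal_prod, ← ENNReal.toReal_prod, ← ENNReal.toReal_mul, ← ENNReal.toReal_mul]
  refine ENNReal.toReal_mono ?_ hd
  exact ENNReal.mul_ne_top (hfin s') (ENNReal.prod_ne_top fun x _ => measure_ne_top _ _)

end disc

end FinB

namespace FinB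

/-- the data of the continuous comparison -/
structure CDat {ι : Type*} [Fintype ι] (ρ : Measure ℝ) (K : ι → ι → ℝ)
    (a : ℝ) (θ T B D : ι → ℝ) : Prop where
  ex : ∃ Do Di εp εn : ι → ℝ, (∀ x, 0 ≤ Do x) ∧ (∀ x, Do x + Di x ≤ D x) ∧
    (∀ x, |θ x| ≤ 4 / 3 * Do x * T x) ∧ (∀ x, ∑ y, |K x y| * T y ≤ Di x * T x) ∧
    (∀ x, ∑ y, |K x y| ≤ Di x) ∧ (∀ x, 0 ≤ εp x) ∧ (∀ x, 0 ≤ εn x) ∧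
    (∀ x, εp x + εn x ≤ T x / 12) ∧
    (∀ x, ∫ t, ep (T x) t * Real.exp (13 / 16 * a * t ^ 2) ∂ρ ≤
      εp x * (ρ (Set.Icc (-B x) (B x))).toReal) ∧
    (∀ x, ∫ t, ep (T x) (-t) * Real.exp (13 / 16 * a * t ^ 2) ∂ρ ≤
      εn x * (ρ (Set.Icc (-B x) (B x))).toReal)
  core : ∀ x, 0 < (ρ (Set.Icc (-B x) (B x))).toReal
  hint : Integrable (fun u => Real.exp (a * u ^ 2)) ρ
  hKs : ∀ x y, K x y = K y x
  hKd : ∀ x, K x x = 0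
  ha : 0 < a
  hD : ∀ x, D x ≤ a / 4
  hB : ∀ x, 0 < B x
  hBT : ∀ x, 3 * B x ≤ T x

theorem ep_cont (T : ℝ) : Continuous (ep T) := by unfold ep; fun_prop

theorem lin_exp (a : ℝ) (ha : 0 < a) (v : ℝ) (hv : 0 ≤ v) :
    v * Real.exp (13 / 16 * a * v ^ 2) ≤ (1 + 8 / a) * Real.exp (a * v ^ 2) := by
  have h1 : v ≤ 1 + v ^ 2 := by nlinarith [sq_nonneg (v - 1)]
  have h2 : 3 / 16 * a * v ^ 2 + 1 ≤ Real.exp (3 / 16 * a * v ^ 2) := Real.add_one_le_exp _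
  have h3 : v ≤ (1 + 8 / a) * Real.exp (3 / 16 * a * v ^ 2) := by
    have h4 : (1 + 8 / a) * (3 / 16 * a * v ^ 2 + 1) ≤
      (1 + 8 / a) * Real.exp (3 / 16 * a * v ^ 2) := by gcongr
    have h5 : (1 + 8 / a) * (3 / 16 * a * v ^ 2 + 1) =
      3 / 16 * a * v ^ 2 + 1 + 3 / 2 * v ^ 2 + 8 / a := by field_simp; ring
    have h6 : 0 ≤ 8 / a := by positivity
    have h7 : 0 ≤ 3 / 16 * a * v ^ 2 := by positivity
    nlinarith [sq_nonneg v]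
  calc v * Real.exp (13 / 16 * a * v ^ 2) ≤
        (1 + 8 / a) * Real.exp (3 / 16 * a * v ^ 2) * Real.exp (13 / 16 * a * v ^ 2) := by gcongr
    _ = _ := by rw [mul_assoc, ← Real.exp_add]; congr 2; ring

theorem ep_le_abs {T : ℝ} (hT : 0 ≤ T) (t : ℝ) : ep T t ≤ |t| :=
  max_le (by linarith [le_abs_self t]) (abs_nonneg t)

theorem bad_int (ρ : Measure ℝ) (a : ℝ) (ha : 0 < a)
    (hint : Integrable (fun u => Real.exp (a * u ^ 2)) ρ) (T : ℝ) (hT : 0 ≤ T) :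
    Integrable (fun t => ep T t * Real.exp (13 / 16 * a * t ^ 2)) ρ := by
  refine (hint.const_mul (1 + 8 / a)).mono' ?_ (Filter.Eventually.of_forall fun t => ?_)
  · exact ((ep_cont T).mul (by fun_prop)).aestronglyMeasurable
  · rw [Real.norm_of_nonneg (mul_nonneg (ep_nonneg _ _) (Real.exp_pos _).le)]
    have := lin_exp a ha |t| (abs_nonneg t)
    rw [sq_abs] at this
    exact (mul_le_mul_of_nonneg_right (ep_le_abs hT t) (Real.exp_pos _).le).trans this

theorem bad_int' (ρ : Measure ℝ) (a : ℝ) (ha : 0 < a)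
    (hint : Integrable (fun u => Real.exp (a * u ^ 2)) ρ) (T : ℝ) (hT : 0 ≤ T) :
    Integrable (fun t => ep T (-t) * Real.exp (13 / 16 * a * t ^ 2)) ρ := by
  refine (hint.const_mul (1 + 8 / a)).mono' ?_ (Filter.Eventually.of_forall fun t => ?_)
  · exact (((ep_cont T).comp continuous_neg).mul (by fun_prop)).aestronglyMeasurable
  · rw [Real.norm_of_nonneg (mul_nonneg (ep_nonneg _ _) (Real.exp_pos _).le)]
    have := lin_exp a ha |t| (abs_nonneg t)
    rw [sq_abs] at this
    have h2 := ep_le_abs hT (-t)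
    rw [abs_neg] at h2
    exact (mul_le_mul_of_nonneg_right h2 (Real.exp_pos _).le).trans this

theorem ep_rr {T : ℝ} (hT : 0 ≤ T) (n : ℕ) (u : ℝ) : ep T (rr n u) ≤ ep T u := by
  have := rr_le n u
  unfold ep
  refine max_le ?_ (le_max_right _ _)
  rcases le_total 0 u with h | h
  · rw [max_eq_left h] at this
    exact (by linarith : rr n u - T ≤ u - T).trans (le_max_left _ _)
  · rw [max_eq_right h] at this
    exact (by linarith : rr n u - T ≤ 0).trans (le_max_right _ _)

theorem rr_sq (n : ℕ) (u : ℝ) : rr n u ^ 2 ≤ u ^ 2 := sq_le_sq.2 (rr_abs n u)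

section lim
variable {ι : Type*} [Fintype ι] {ρ : Measure ℝ} [IsFiniteMeasure ρ] {K : ι → ι → ℝ} {a : ℝ}
  {θ T B D : ι → ℝ}

theorem CDat.disc (h : CDat ρ K a θ T B D) (n : ℕ) : Dat (Sn ρ n) (pn ρ n) K a θ T B D := by
  obtain ⟨⟨Do, Di, εp, εn, hDo, hDD, hθ, hKT, hKsum, hεp0, hεn0, hεs, hεp, hεn⟩, hcore, hint, hKs,
    hKd, ha, hD, hB, hBT⟩ := h
  have hT : ∀ x, 0 < T x := fun x => by linarith [hB x, hBT x]
  have hcc : ∀ x, (ρ (Set.Icc (-B x) (B x))).toReal ≤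
      ∑ t ∈ (Sn ρ n).filter (fun t => -B x ≤ t ∧ t ≤ B x), pn ρ n t := by
    intro x
    have h1 := sum1 ρ n (fun _ => 1) (fun t => -B x ≤ t ∧ t ≤ B x) measurableSet_Icc
    simp only [mul_one] at h1
    have h2 : ∑ t ∈ (Sn ρ n).filter (fun t => -B x ≤ t ∧ t ≤ B x), pn ρ n t =
        ∫ _ in {u | -B x ≤ rr n u ∧ rr n u ≤ B x}, (1 : ℝ) ∂ρ := by convert h1
    rw [h2, setIntegral_const, smul_eq_mul, mul_one]
    refine ENNReal.toReal_mono (measure_ne_top _ _) (measure_mono fun u hu => ?_)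
    have := (rr_abs n u).trans (abs_le.2 hu)
    exact abs_le.1 this
  have hall : ∀ F : ℝ → ℝ, ∑ t ∈ Sn ρ n, pn ρ n t * F t = ∫ u, F (rr n u) ∂ρ := by
    intro F
    have h1 := sum1 ρ n F (fun _ => True) (by simp)
    simpa using h1
  refine ⟨⟨Do, Di, εp, εn, hDo, hDD, hθ, hKT, hKsum, hεp0, hεn0, hεs, fun x => ?_, fun x => ?_⟩,
    fun x => (hcore x).trans_le (hcc x), pn_pos ρ n, hKs, hKd, ha, hD, hB, hBT⟩
  · simp only [mul_assoc (pn ρ n _)]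
    rw [hall (fun t => ep (T x) t * Real.exp (13 / 16 * a * t ^ 2))]
    refine le_trans ?_ ((hεp x).trans (mul_le_mul_of_nonneg_left (hcc x) (hεp0 x)))
    refine integral_mono_of_nonneg (Filter.Eventually.of_forall fun u =>
      mul_nonneg (ep_nonneg _ _) (Real.exp_pos _).le) (bad_int ρ a ha hint _ (hT x).le)
      (Filter.Eventually.of_forall fun u => ?_)
    have := rr_sq n u
    exact mul_le_mul (ep_rr (hT x).le n u) (Real.exp_le_exp.2 (by gcongr)) (Real.exp_pos _).le
      (ep_nonneg _ _)
  · simp only [mul_assoc (pn ρ n _)]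
    rw [hall (fun t => ep (T x) (-t) * Real.exp (13 / 16 * a * t ^ 2))]
    refine le_trans ?_ ((hεn x).trans (mul_le_mul_of_nonneg_left (hcc x) (hεn0 x)))
    refine integral_mono_of_nonneg (Filter.Eventually.of_forall fun u =>
      mul_nonneg (ep_nonneg _ _) (Real.exp_pos _).le) (bad_int' ρ a ha hint _ (hT x).le)
      (Filter.Eventually.of_forall fun u => ?_)
    have := rr_sq n u
    refine mul_le_mul ?_ (Real.exp_le_exp.2 (by gcongr)) (Real.exp_pos _).le
      (ep_nonneg _ _)
    rw [← rr_neg]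
    exact ep_rr (hT x).le n (-u)

/-- limit weight -/
noncomputable def F2 (T D : ι → ℝ) (φ : ι → ℝ) : ℝ :=
  ∏ x, (if -T x ≤ φ x then Real.exp (Th (D x) (T x) (φ x)) else 0)

theorem Th_cont (D T : ℝ) : Continuous (Th D T) := by
  have := ep_cont T
  unfold Th; fun_prop

theorem w1_meas (D T : ℝ) : Measurable fun u : ℝ => if -T ≤ u then Real.exp (Th D T u) else 0 :=
  Measurable.ite measurableSet_Ici (Th_cont D T).rexp.measurable measurable_const

theorem HH_cont (K : ι → ι → ℝ) (θ : ι → ℝ) : Continuous (HH K θ) := by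
  unfold HH; fun_prop

theorem Th_le {D T a : ℝ} (hD0 : 0 ≤ D) (hD : D ≤ a / 4) (hT : 0 ≤ T) (t : ℝ) :
    Th D T t ≤ a * T ^ 2 + a * t ^ 2 := by
  unfold Th
  have h1 := ep_le_abs hT t
  have h0 := ep_nonneg T t
  have h2 := le_abs_self t
  have h3 := sq_abs t
  have h4 : ep T t ^ 2 ≤ t ^ 2 := by rw [← h3]; gcongr
  have h5 : T * t ≤ T * |t| := by gcongr
  have h6 : T * ep T t ≤ T * |t| := by gcongr
  have h7 : 4 / 3 * T * t + 10 / 3 * T * ep T t + 8 / 5 * ep T t ^ 2 ≤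
    14 / 3 * (T * |t|) + 8 / 5 * t ^ 2 := by linarith
  have h8 : 0 ≤ 14 / 3 * (T * |t|) + 8 / 5 * t ^ 2 := by positivity
  have h9 : 14 / 3 * (T * |t|) + 8 / 5 * t ^ 2 ≤ 4 * (T ^ 2 + t ^ 2) := by
    nlinarith [sq_nonneg (T - |t|)]
  have h10 := mul_le_mul_of_nonneg_left h7 hD0
  have h11 := mul_le_mul_of_nonneg_right hD h8
  have h12 : a / 4 * (14 / 3 * (T * |t|) + 8 / 5 * t ^ 2) ≤ a / 4 * (4 * (T ^ 2 + t ^ 2)) :=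
    mul_le_mul_of_nonneg_left h9 (hD0.trans hD)
  linarith

theorem F2_le (ha : 0 < a) (hD0 : ∀ x, 0 ≤ D x) (hD : ∀ x, D x ≤ a / 4) (hT : ∀ x, 0 ≤ T x)
    (φ : ι → ℝ) : F2 T D φ ≤ ∏ x, Real.exp (a * T x ^ 2 + a * φ x ^ 2) := by
  unfold F2
  refine Finset.prod_le_prod (fun x _ => ?_) (fun x _ => ?_)
  · split_ifs
    · exact (Real.exp_pos _).le
    · exact le_rfl
  · split_ifs
    · exact Real.exp_le_exp.2 (Th_le (hD0 x) (hD x) (hT x) _)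
    · exact (Real.exp_pos _).le

theorem F2_nonneg (φ : ι → ℝ) : 0 ≤ F2 T D φ := by
  unfold F2
  refine Finset.prod_nonneg fun x _ => ?_
  split_ifs
  · exact (Real.exp_pos _).le
  · exact le_rfl

theorem F1_le (ha : 0 < a) (hKs : ∀ x y, K x y = K y x) (hK : ∀ x, ∑ y, |K x y| ≤ a / 4)
    (φ : ι → ℝ) : Real.exp (HH K θ φ) ≤ ∏ x, Real.exp (θ x ^ 2 / (2 * a) + a * φ x ^ 2) := by
  rw [← Real.exp_sum]
  refine Real.exp_le_exp.2 ?_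
  unfold HH
  have h1 : ∑ x, ∑ y, K x y * φ x * φ y ≤ ∑ x, ∑ y, |K x y| * ((φ x ^ 2 + φ y ^ 2) / 2) := by
    refine Finset.sum_le_sum fun x _ => Finset.sum_le_sum fun y _ => ?_
    rw [mul_assoc]
    calc K x y * (φ x * φ y) ≤ |K x y * (φ x * φ y)| := le_abs_self _
      _ = |K x y| * |φ x * φ y| := abs_mul _ _
      _ ≤ _ := by
        gcongr
        rw [abs_le]
        constructor <;> nlinarith [sq_nonneg (φ x + φ y), sq_nonneg (φ x - φ y)]
  have h2 : ∑ x, ∑ y, |K x y| * ((φ x ^ 2 + φ y ^ 2) / 2) = ∑ x, (∑ y, |K x y|) * φ x ^ 2 := by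
    have e1 : ∑ x, ∑ y, |K x y| * ((φ x ^ 2 + φ y ^ 2) / 2) =
      ∑ x, ∑ y, |K x y| * (φ x ^ 2 / 2) + ∑ x, ∑ y, |K x y| * (φ y ^ 2 / 2) := by
      rw [← Finset.sum_add_distrib]
      refine Finset.sum_congr rfl fun x _ => ?_
      rw [← Finset.sum_add_distrib]
      refine Finset.sum_congr rfl fun y _ => ?_
      ring
    have e2 : ∑ x, ∑ y, |K x y| * (φ y ^ 2 / 2) = ∑ x, ∑ y, |K x y| * (φ x ^ 2 / 2) := by
      rw [Finset.sum_comm]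
      refine Finset.sum_congr rfl fun x _ => Finset.sum_congr rfl fun y _ => ?_
      rw [hKs]
    rw [e1, e2, ← Finset.sum_add_distrib]
    refine Finset.sum_congr rfl fun x _ => ?_
    rw [← Finset.sum_mul]; ring
  have h3 : ∑ x, (∑ y, |K x y|) * φ x ^ 2 ≤ ∑ x, a / 4 * φ x ^ 2 := by
    refine Finset.sum_le_sum fun x _ => ?_
    gcongr
    exact hK x
  have h4 : ∑ x, θ x * φ x ≤ ∑ x, (θ x ^ 2 / (2 * a) + a / 2 * φ x ^ 2) := by
    refine Finset.sum_le_sum fun x _ => ?_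
    have : 0 ≤ (θ x - a * φ x) ^ 2 / (2 * a) := by positivity
    have e : (θ x - a * φ x) ^ 2 / (2 * a) = θ x ^ 2 / (2 * a) + a / 2 * φ x ^ 2 - θ x * φ x := by
      field_simp; ring
    linarith
  have h5 : ∑ x, (θ x ^ 2 / (2 * a) + a / 2 * φ x ^ 2) + 1 / 2 * ∑ x, a / 4 * φ x ^ 2 ≤
      ∑ x, (θ x ^ 2 / (2 * a) + a * φ x ^ 2) := by
    rw [Finset.mul_sum, ← Finset.sum_add_distrib]
    refine Finset.sum_le_sum fun x _ => ?_
    nlinarith [mul_nonneg ha.le (sq_nonneg (φ x))]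
  linarith

theorem bd_int (hint : Integrable (fun u => Real.exp (a * u ^ 2)) ρ) (c : ι → ℝ) :
    Integrable (fun φ : ι → ℝ => ∏ x, Real.exp (c x + a * φ x ^ 2)) (Measure.pi fun _ : ι => ρ) := by
  refine Integrable.fintype_prod (f := fun x u => Real.exp (c x + a * u ^ 2)) fun x => ?_
  simp only [Real.exp_add]
  exact hint.const_mul _

theorem lim_gen (hint : Integrable (fun u => Real.exp (a * u ^ 2)) ρ) (ha : 0 < a) (c : ι → ℝ)
    (F g : (ι → ℝ) → ℝ) (hF : Measurable F) (hF0 : ∀ φ, 0 ≤ F φ)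
    (hFb : ∀ φ, F φ ≤ ∏ x, Real.exp (c x + a * φ x ^ 2))
    (hlim : ∀ φ : ι → ℝ, Filter.Tendsto (fun n => F (fun x => rr n (φ x))) Filter.atTop (nhds (F φ)))
    (hg : Measurable g) (hg0 : ∀ φ, 0 ≤ g φ) (hg1 : ∀ φ, g φ ≤ 1) :
    Filter.Tendsto (fun n => ∫ φ, F (fun x => rr n (φ x)) * g φ ∂(Measure.pi fun _ : ι => ρ))
      Filter.atTop (nhds (∫ φ, F φ * g φ ∂(Measure.pi fun _ : ι => ρ))) := by
  refine tendsto_integral_of_dominated_convergence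
    (fun φ : ι → ℝ => ∏ x, Real.exp (c x + a * φ x ^ 2)) (fun n => ?_) (bd_int hint c)
    (fun n => Filter.Eventually.of_forall fun φ => ?_) (Filter.Eventually.of_forall fun φ => ?_)
  · refine ((hF.comp ?_).mul hg).aestronglyMeasurable
    exact measurable_pi_lambda _ fun x => (rr_meas n).comp (measurable_pi_apply x)
  · rw [Real.norm_of_nonneg (mul_nonneg (hF0 _) (hg0 _))]
    calc F (fun x => rr n (φ x)) * g φ ≤ F (fun x => rr n (φ x)) * 1 := by
          gcongr
          · exact hF0 _
          · exact hg1 _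
      _ ≤ ∏ x, Real.exp (c x + a * rr n (φ x) ^ 2) := by rw [mul_one]; exact hFb _
      _ ≤ _ := by
        refine Finset.prod_le_prod (fun x _ => (Real.exp_pos _).le) (fun x _ => ?_)
        have := rr_sq n (φ x)
        refine Real.exp_le_exp.2 ?_
        gcongr
  · exact (hlim φ).mul_const _

theorem step (h : CDat ρ K a θ T B D) (g : (ι → ℝ) → ℝ) (hg : Measurable g) (hgm : Monotone g)
    (hg0 : ∀ φ, 0 ≤ g φ) (hg1 : ∀ φ, g φ ≤ 1) (n : ℕ) :
    (∫ φ, Real.exp (HH K θ fun x => rr n (φ x)) * g φ ∂(Measure.pi fun _ : ι => ρ)) *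
      (∫ φ, F2 T D (fun x => rr n (φ x)) * 1 ∂(Measure.pi fun _ : ι => ρ)) ≤
    (∫ φ, F2 T D (fun x => rr n (φ x)) * g φ ∂(Measure.pi fun _ : ι => ρ)) *
      (∫ φ, Real.exp (HH K θ fun x => rr n (φ x)) * 1 ∂(Measure.pi fun _ : ι => ρ)) := by
  have hd := discrete (h.disc n) (gh ρ n g) (gh_mono ρ n g hg hgm hg0 hg1)
  have hgi : Integrable g (Measure.pi fun _ : ι => ρ) := by
    refine (integrable_const (1 : ℝ)).mono' hg.aestronglyMeasurable
      (Filter.Eventually.of_forall fun φ => ?_)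
    rw [Real.norm_of_nonneg (hg0 _)]; exact hg1 _
  have hp : ∀ s : ι → ↥(Sn ρ n), ∏ x, pn ρ n (s x).1 ≠ 0 := fun s =>
    (Finset.prod_pos fun x _ => pn_pos ρ n _ (s x).2).ne'
  have hcell : ∀ s : ι → ↥(Sn ρ n), ∫ _ in cell n (fun x => (s x).1), (1 : ℝ)
      ∂(Measure.pi fun _ : ι => ρ) = ∏ x, pn ρ n (s x).1 := by
    intro s
    rw [setIntegral_const, smul_eq_mul, mul_one]
    unfold cell Measure.real
    rw [Measure.pi_pi, ENNReal.toReal_prod]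
    rfl
  have hfac : ∀ s : ι → ↥(Sn ρ n), (∏ x, (if -T x ≤ (s x).1 then pn ρ n (s x).1 *
      Real.exp (Th (D x) (T x) (s x).1) else 0)) =
      F2 T D (fun x => (s x).1) * ∏ x, pn ρ n (s x).1 := by
    intro s
    unfold F2
    rw [← Finset.prod_mul_distrib]
    refine Finset.prod_congr rfl fun x _ => ?_
    split_ifs
    · ring
    · ring
  rw [← sumpi ρ n (fun s => Real.exp (HH K θ s)) g hgi, ← sumpi ρ n (F2 T D) g hgi,
    ← sumpi ρ n (fun s => Real.exp (HH K θ s)) (fun _ => 1) (integrable_const 1),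
    ← sumpi ρ n (F2 T D) (fun _ => 1) (integrable_const 1)]
  simp only [hcell]
  simp only [hfac] at hd
  have e1 : ∀ (F : (ι → ℝ) → ℝ) (s : ι → ↥(Sn ρ n)), F (fun x => (s x).1) *
      ∫ φ in cell n (fun x => (s x).1), g φ ∂(Measure.pi fun _ : ι => ρ) =
      F (fun x => (s x).1) * (∏ x, pn ρ n (s x).1) * gh ρ n g s := by
    intro F s
    unfold gh
    have := hp s
    field_simp
  simp only [e1 (F2 T D), e1 (fun s => Real.exp (HH K θ s))]
  simp only [mul_comm (∏ x, pn ρ n _) (Real.exp _)] at hd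
  exact hd

theorem limit (h : CDat ρ K a θ T B D) (g : (ι → ℝ) → ℝ) (hg : Measurable g) (hgm : Monotone g)
    (hg0 : ∀ φ, 0 ≤ g φ) (hg1 : ∀ φ, g φ ≤ 1) :
    (∫ φ, Real.exp (HH K θ φ) * g φ ∂(Measure.pi fun _ : ι => ρ)) *
      (∫ φ, F2 T D φ ∂(Measure.pi fun _ : ι => ρ)) ≤
    (∫ φ, F2 T D φ * g φ ∂(Measure.pi fun _ : ι => ρ)) *
      (∫ φ, Real.exp (HH K θ φ) ∂(Measure.pi fun _ : ι => ρ)) := by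
  have hst := step h g hg hgm hg0 hg1
  obtain ⟨⟨Do, Di, εp, εn, hDo, hDD, hθ, hKT, hKsum, hεp0, hεn0, hεs, hεp, hεn⟩, hcore, hint, hKs,
    hKd, ha, hD, hB, hBT⟩ := h
  have hT : ∀ x, 0 < T x := fun x => by linarith [hB x, hBT x]
  have hDi0 : ∀ x, 0 ≤ Di x := fun x =>
    (Finset.sum_nonneg fun _ _ => abs_nonneg _).trans (hKsum x)
  have hD0 : ∀ x, 0 ≤ D x := fun x => by linarith [hDi0 x, hDD x, hDo x]
  have hK4 : ∀ x, ∑ y, |K x y| ≤ a / 4 := fun x => by linarith [hKsum x, hDD x, hDo x, hD x]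
  have hrlim : ∀ φ : ι → ℝ, Filter.Tendsto (fun n : ℕ => (fun x => rr n (φ x))) Filter.atTop
      (nhds φ) := fun φ => tendsto_pi_nhds.2 fun x => rr_lim (φ x)
  have hF1lim : ∀ φ : ι → ℝ, Filter.Tendsto (fun n => Real.exp (HH K θ (fun x => rr n (φ x))))
      Filter.atTop (nhds (Real.exp (HH K θ φ))) := fun φ =>
    (((HH_cont K θ).rexp.tendsto φ).comp (hrlim φ))
  have hF2m : Measurable (F2 T D) := by
    unfold F2
    exact Finset.measurable_prod _ fun x _ => (w1_meas (D x) (T x)).comp (measurable_pi_apply x)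
  have hF2lim : ∀ φ : ι → ℝ, Filter.Tendsto (fun n => F2 T D (fun x => rr n (φ x)))
      Filter.atTop (nhds (F2 T D φ)) := by
    intro φ
    unfold F2
    refine tendsto_finset_prod _ fun x _ => ?_
    by_cases hx : -T x ≤ φ x
    · rw [if_pos hx]
      have hall : ∀ n, -T x ≤ rr n (φ x) := by
        intro n
        have h1 := rr_le n (-(φ x))
        rw [rr_neg] at h1
        have h2 : max (-(φ x)) 0 ≤ T x := max_le (by linarith) (hT x).le
        linarith
      simp only [hall, if_true]
      exact (((Th_cont _ _).rexp.tendsto (φ x)).comp (rr_lim (φ x)))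
    · rw [if_neg hx]
      push Not at hx
      refine tendsto_const_nhds.congr' ?_
      filter_upwards [(rr_lim (φ x)).eventually (gt_mem_nhds hx)] with n hn
      rw [if_neg (not_le.2 hn)]
  have hF1m : Measurable fun φ => Real.exp (HH K θ φ) := (HH_cont K θ).rexp.measurable
  have hF2b := F2_le (T := T) (D := D) ha hD0 hD (fun x => (hT x).le)
  have hF1b := F1_le (θ := θ) ha hKs hK4
  have l1 := lim_gen hint ha _ _ g hF1m (fun _ => (Real.exp_pos _).le) hF1b hF1lim hg hg0 hg1
  have l2 := lim_gen hint ha _ _ g hF2m F2_nonneg hF2b hF2lim hg hg0 hg1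
  have l3 := lim_gen hint ha _ _ (fun _ => 1) hF1m (fun _ => (Real.exp_pos _).le) hF1b hF1lim
    measurable_const (fun _ => zero_le_one) (fun _ => le_rfl)
  have l4 := lim_gen hint ha _ _ (fun _ => 1) hF2m F2_nonneg hF2b hF2lim
    measurable_const (fun _ => zero_le_one) (fun _ => le_rfl)
  have := le_of_tendsto_of_tendsto' (l1.mul l4) (l2.mul l3) hst
  simpa only [mul_one] using this

end lim

end FinB

namespace FinB

theorem dom1_of_upper (μ ν : Measure ℝ) [IsFiniteMeasure μ] [IsFiniteMeasure ν]
    (h : ∀ U : Set ℝ, MeasurableSet U → IsUpperSet U →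
      μ U * ν Set.univ ≤ ν U * μ Set.univ) : Dom1 μ ν := by
  intro g hg hgm
  have hb : ∀ f : ℝ → ℝ, Measurable f → Monotone f → (∀ u, 0 ≤ f u) →
      (∫⁻ u, ENNReal.ofReal (f u) ∂μ) * ν Set.univ ≤
        (∫⁻ u, ENNReal.ofReal (f u) ∂ν) * μ Set.univ := by
    intro f hf hfm hf0
    rw [lintegral_eq_lintegral_meas_lt μ (Filter.Eventually.of_forall hf0) hf.aemeasurable,
      lintegral_eq_lintegral_meas_lt ν (Filter.Eventually.of_forall hf0) hf.aemeasurable,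
      ← lintegral_mul_const' _ _ (measure_ne_top _ _),
      ← lintegral_mul_const' _ _ (measure_ne_top _ _)]
    refine lintegral_mono fun t => ?_
    refine h _ (measurableSet_lt measurable_const hf) ?_
    intro u v huv hu
    exact lt_of_lt_of_le (show t < f u from hu) (hfm huv)
  have hn : ∀ n : ℕ, (∫⁻ u, min (g u) n ∂μ) * ν Set.univ ≤
      (∫⁻ u, min (g u) n ∂ν) * μ Set.univ := by
    intro n
    have hne : ∀ u, min (g u) (n : ℝ≥0∞) ≠ ⊤ := fun u =>
      ne_top_of_le_ne_top (ENNReal.natCast_ne_top n) (min_le_right _ _)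
    have := hb (fun u => (min (g u) (n : ℝ≥0∞)).toReal) (hg.min measurable_const).ennreal_toReal
      (fun u v huv => ENNReal.toReal_mono (hne v) (min_le_min_right _ (hgm huv)))
      (fun u => ENNReal.toReal_nonneg)
    simpa only [ENNReal.ofReal_toReal (hne _)] using this
  have hsup : ∀ μ' : Measure ℝ, ∫⁻ u, g u ∂μ' = ⨆ n : ℕ, ∫⁻ u, min (g u) n ∂μ' := by
    intro μ'
    rw [← lintegral_iSup (fun n => hg.min measurable_const)
      (fun n m hnm u => min_le_min_left _ (by exact_mod_cast hnm))]
    refine lintegral_congr fun u => ?_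
    refine le_antisymm ?_ (iSup_le fun n => min_le_left _ _)
    have : g u = min (g u) (⨆ n : ℕ, (n : ℝ≥0∞)) := by rw [ENNReal.iSup_natCast, min_eq_left le_top]
    conv_lhs => rw [this]
    exact (inf_iSup_eq (g u) fun n : ℕ => (n : ℝ≥0∞)).le
  rw [hsup μ, hsup ν, ENNReal.iSup_mul, ENNReal.iSup_mul]
  exact iSup_mono hn

/-- the comparison single-site measure -/
noncomputable def chi (ρ : Measure ℝ) (D T : ℝ) : Measure ℝ :=
  ρ.withDensity fun u => ENNReal.ofReal (if -T ≤ u then Real.exp (Th D T u) else 0)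

theorem chi_apply (ρ : Measure ℝ) (D T : ℝ) (S : Set ℝ) (hS : MeasurableSet S) :
    chi ρ D T S = ∫⁻ u in S, ENNReal.ofReal (if -T ≤ u then Real.exp (Th D T u) else 0) ∂ρ :=
  withDensity_apply _ hS

theorem rhoMod_apply (ρ : Measure ℝ) (a : ℝ) (S : Set ℝ) (hS : MeasurableSet S) :
    rhoMod ρ a S = ∫⁻ u in S, ENNReal.ofReal (Real.exp (a * u ^ 2)) ∂ρ :=
  withDensity_apply _ hS

theorem zeta_apply (ρ : Measure ℝ) (a B : ℝ) (S : Set ℝ) (hS : MeasurableSet S) :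
    zetaM ρ a B S = rhoMod ρ a {u | 0 ≤ u ∧ u + B ∈ S} := by
  unfold zetaM
  rw [Measure.restrict_apply hS, Measure.map_apply (by fun_prop) (hS.inter measurableSet_Ici)]
  congr 1
  ext u
  simp [and_comm]

theorem case1_ineq {a B D u r : ℝ} (hB : 0 < B) (hD0 : 0 ≤ D) (hD : D ≤ a / 4) (hu : 0 ≤ u)
    (hr : u + B ≤ r) : Th D (3 * B) r + a * u ^ 2 ≤ a * r ^ 2 + Th D (3 * B) u := by
  have key : 4 * B * (r - u) + 10 * B * (ep (3 * B) r - ep (3 * B) u) +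
      8 / 5 * (ep (3 * B) r ^ 2 - ep (3 * B) u ^ 2) ≤ 4 * (r ^ 2 - u ^ 2) := by
    unfold ep
    rcases le_total r (3 * B) with h | h
    · rw [max_eq_right (by linarith), max_eq_right (by linarith)]
      nlinarith
    · rcases le_total u (3 * B) with h' | h'
      · rw [max_eq_left (by linarith), max_eq_right (by linarith)]
        nlinarith [mul_nonneg hu (sub_nonneg.2 h'), mul_nonneg (sub_nonneg.2 h) hB.le,
          sq_nonneg (r - 3 * B), mul_nonneg hB.le (sub_nonneg.2 h')]
      · rw [max_eq_left (by linarith), max_eq_left (by linarith)]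
        nlinarith
  have h0 : 0 ≤ 4 * (r ^ 2 - u ^ 2) := by nlinarith
  unfold Th
  have h1 := mul_le_mul_of_nonneg_left key hD0
  have h2 := mul_le_mul_of_nonneg_right hD h0
  linarith

theorem case2_ineq {a B D T u : ℝ} (hB : 0 < B) (hBT : 3 * B ≤ T) (hD0 : 0 ≤ D) (hD : D ≤ a / 4)
    (hu : B ≤ u) : Th D T u ≤ a * u ^ 2 - a / 2 * (u ^ 2 + B ^ 2) + 4 / 3 * D * T * u := by
  have key : 10 / 3 * T * ep T u + 8 / 5 * ep T u ^ 2 ≤ 2 * (u ^ 2 - B ^ 2) := by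
    unfold ep
    rcases le_total u T with h | h
    · rw [max_eq_right (by linarith)]
      nlinarith
    · rw [max_eq_left (by linarith)]
      nlinarith [mul_nonneg (sub_nonneg.2 h) (by linarith : 0 ≤ T)]
  have h0 : 0 ≤ 2 * (u ^ 2 - B ^ 2) := by nlinarith
  unfold Th
  have h1 := mul_le_mul_of_nonneg_left key hD0
  have h2 := mul_le_mul_of_nonneg_right hD h0
  linarith

theorem single (ρ : Measure ℝ) [IsFiniteMeasure ρ] (a B D T : ℝ) (hB : 0 < B)
    (hBT : 3 * B ≤ T) (hD0 : 0 ≤ D) (hD : D ≤ a / 4)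
    [IsFiniteMeasure (rhoMod ρ a)] [IsFiniteMeasure (chi ρ D T)] [IsFiniteMeasure (zetaM ρ a B)]
    (κ : Measure ℝ) [IsFiniteMeasure κ]
    (hκ : κ = ρ.withDensity fun u => ENNReal.ofReal (Real.exp (4 / 3 * D * T * u)))
    (hκ0 : κ Set.univ ≠ 0) (hZ0 : rhoMod ρ a Set.univ ≠ 0)
    (hcase : T = 3 * B ∨ κ ≤ (κ Set.univ / rhoMod ρ a Set.univ) • ρ.withDensity fun u =>
        ENNReal.ofReal (Real.exp (a / 2 * (u ^ 2 + B ^ 2)))) :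
    Dom1 (chi ρ D T) (zetaM ρ a B) := by
  refine dom1_of_upper _ _ fun U hU hUp => ?_
  by_cases hBU : B ∈ U
  · have : zetaM ρ a B U = zetaM ρ a B Set.univ := by
      rw [zeta_apply _ _ _ _ hU, zeta_apply _ _ _ _ MeasurableSet.univ]
      congr 1
      ext u
      simp only [Set.mem_ofPred_eq, Set.mem_univ, and_true, and_iff_left_iff_imp]
      intro hu
      exact hUp (by linarith) hBU
    rw [this, mul_comm]
    gcongr
    exact Set.subset_univ _
  have hUB : ∀ u ∈ U, B < u := by
    intro u hu
    by_contra hcon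
    push Not at hcon
    exact hBU (hUp hcon hu)
  set W : Set ℝ := {u | 0 ≤ u ∧ u + B ∈ Uᶜ} with hW
  have hWm : MeasurableSet W := by
    refine measurableSet_Ici.inter ?_
    exact hU.compl.preimage (by fun_prop : Measurable fun u : ℝ => u + B)
  have hWU : W ⊆ Uᶜ := fun u hu hcon => hu.2 (hUp (by linarith) hcon)
  have hz1 : zetaM ρ a B Uᶜ = rhoMod ρ a W := zeta_apply _ _ _ _ hU.compl
  have hz2 : rhoMod ρ a U ≤ zetaM ρ a B U := by
    rw [zeta_apply _ _ _ _ hU]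
    refine measure_mono fun u hu => ?_
    have := hUB u hu
    exact ⟨by linarith, hUp (by linarith) hu⟩
  suffices hmain : chi ρ D T U * rhoMod ρ a W ≤ rhoMod ρ a U * chi ρ D T Uᶜ by
    rw [← measure_add_measure_compl (μ := zetaM ρ a B) hU,
      ← measure_add_measure_compl (μ := chi ρ D T) hU, mul_add, mul_add, hz1,
      mul_comm (zetaM ρ a B U) (chi ρ D T U)]
    exact add_le_add le_rfl (hmain.trans (by gcongr))
  rcases hcase with hT | hreg
  · subst hT
    have hlow : ∫⁻ u in W, ENNReal.ofReal (Real.exp (Th D (3 * B) u)) ∂ρ ≤ chi ρ D (3 * B) Uᶜ := by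
      refine le_trans ?_ (measure_mono hWU)
      rw [chi_apply _ _ _ _ hWm]
      refine setLIntegral_mono' hWm fun u hu => ?_
      rw [if_pos (by linarith [hu.1])]
    refine le_trans ?_ (mul_le_mul_right hlow _)
    rw [chi_apply _ _ _ _ hU, rhoMod_apply _ _ _ hWm, rhoMod_apply _ _ _ hU,
      ← lintegral_mul_const' _ _ (by rw [← rhoMod_apply _ _ _ hWm]; exact measure_ne_top _ _),
      ← lintegral_mul_const' _ _ (ne_top_of_le_ne_top (measure_ne_top _ _) hlow)]
    refine setLIntegral_mono' hU fun r hr => ?_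
    rw [← lintegral_const_mul' _ _ ENNReal.ofReal_ne_top,
      ← lintegral_const_mul' _ _ ENNReal.ofReal_ne_top]
    refine setLIntegral_mono' hWm fun u hu => ?_
    have hrB := hUB r hr
    rw [if_pos (by linarith), ← ENNReal.ofReal_mul (Real.exp_pos _).le,
      ← ENNReal.ofReal_mul (Real.exp_pos _).le, ← Real.exp_add, ← Real.exp_add]
    refine ENNReal.ofReal_le_ofReal (Real.exp_le_exp.2 ?_)
    refine case1_ineq hB hD0 hD hu.1 ?_
    by_contra hcon
    push Not at hcon
    exact hu.2 (hUp hcon.le hr)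
  · have hZt : rhoMod ρ a Set.univ ≠ ⊤ := measure_ne_top _ _
    have hregS : ∀ S : Set ℝ, MeasurableSet S → (∀ u ∈ S, B ^ 2 ≤ u ^ 2) →
        κ S * rhoMod ρ a Set.univ ≤ κ Set.univ * rhoMod ρ a S := by
      intro S hS hSB
      have h1 := hreg S
      rw [Measure.smul_apply, withDensity_apply _ hS, smul_eq_mul] at h1
      have ha : 0 ≤ a := by linarith
      have h2 : ∫⁻ u in S, ENNReal.ofReal (Real.exp (a / 2 * (u ^ 2 + B ^ 2))) ∂ρ ≤
          rhoMod ρ a S := by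
        rw [rhoMod_apply _ _ _ hS]
        refine setLIntegral_mono' hS fun u hu => ?_
        refine ENNReal.ofReal_le_ofReal (Real.exp_le_exp.2 ?_)
        have := mul_le_mul_of_nonneg_left (hSB u hu) ha
        linarith
      calc _ ≤ (κ Set.univ / rhoMod ρ a Set.univ * rhoMod ρ a S) * rhoMod ρ a Set.univ := by
            gcongr
            exact h1.trans (by gcongr)
        _ = (κ Set.univ / rhoMod ρ a Set.univ * rhoMod ρ a Set.univ) * rhoMod ρ a S := by ring
        _ = _ := by rw [ENNReal.div_mul_cancel hZ0 hZt]
    have hhigh : chi ρ D T U * rhoMod ρ a Set.univ ≤ κ Set.univ * rhoMod ρ a U := by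
      have hm1 : Measurable fun u : ℝ => ENNReal.ofReal
          (Real.exp (a * u ^ 2 - a / 2 * (u ^ 2 + B ^ 2))) := by fun_prop
      have h1 : chi ρ D T U ≤ ∫⁻ u in U, ENNReal.ofReal
          (Real.exp (a * u ^ 2 - a / 2 * (u ^ 2 + B ^ 2))) ∂κ := by
        rw [chi_apply _ _ _ _ hU, hκ, setLIntegral_withDensity_eq_setLIntegral_mul _ (by fun_prop)
          hm1 hU]
        refine setLIntegral_mono' hU fun u hu => ?_
        have hu' := hUB u hu
        simp only [Pi.mul_apply]
        rw [if_pos (by linarith), ← ENNReal.ofReal_mul (Real.exp_pos _).le, ← Real.exp_add]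
        refine ENNReal.ofReal_le_ofReal (Real.exp_le_exp.2 ?_)
        have := case2_ineq hB hBT hD0 hD hu'.le
        linarith
      have h2 : ∫⁻ u in U, ENNReal.ofReal
          (Real.exp (a * u ^ 2 - a / 2 * (u ^ 2 + B ^ 2))) ∂κ ≤
          (κ Set.univ / rhoMod ρ a Set.univ) * rhoMod ρ a U := by
        refine (lintegral_mono' (Measure.restrict_mono_measure hreg U) le_rfl).trans ?_
        rw [Measure.restrict_smul, lintegral_smul_measure, smul_eq_mul,
          setLIntegral_withDensity_eq_setLIntegral_mul _ (by fun_prop) hm1 hU, rhoMod_apply _ _ _ hU]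
        gcongr with u
        simp only [Pi.mul_apply]
        rw [← ENNReal.ofReal_mul (Real.exp_pos _).le, ← Real.exp_add]
        refine ENNReal.ofReal_le_ofReal (Real.exp_le_exp.2 ?_)
        linarith
      calc _ ≤ ((κ Set.univ / rhoMod ρ a Set.univ) * rhoMod ρ a U) * rhoMod ρ a Set.univ := by
            gcongr; exact h1.trans h2
        _ = (κ Set.univ / rhoMod ρ a Set.univ * rhoMod ρ a Set.univ) * rhoMod ρ a U := by ring
        _ = _ := by rw [ENNReal.div_mul_cancel hZ0 hZt]
    have hlow : κ Set.univ * rhoMod ρ a W ≤ chi ρ D T Uᶜ * rhoMod ρ a Set.univ := by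
      set S : Set ℝ := Set.Ici (-T) ∩ Uᶜ with hS
      have hSm : MeasurableSet S := measurableSet_Ici.inter hU.compl
      have hWS : W ⊆ S := fun u hu => ⟨show -T ≤ u by linarith [hu.1], hWU hu⟩
      have h1 := hregS Sᶜ hSm.compl (by
        intro u hu
        by_cases huU : u ∈ U
        · have := hUB u huU
          gcongr
        · have : u < -T := by
            by_contra hcon
            push Not at hcon
            exact hu ⟨hcon, huU⟩
          nlinarith)
      have h2 : κ S ≤ chi ρ D T Uᶜ := by
        refine le_trans ?_ (measure_mono (Set.inter_subset_right (s := Set.Ici (-T))))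
        rw [chi_apply _ _ _ _ hSm, hκ, withDensity_apply _ hSm]
        refine setLIntegral_mono' hSm fun u hu => ?_
        rw [if_pos (show -T ≤ u from hu.1)]
        refine ENNReal.ofReal_le_ofReal (Real.exp_le_exp.2 ?_)
        unfold Th
        have h0 := ep_nonneg T u
        have hT : 0 ≤ T := by linarith
        have : 0 ≤ D * (10 / 3 * T * ep T u + 8 / 5 * ep T u ^ 2) := by positivity
        linarith
      have h3 : κ Set.univ * rhoMod ρ a S ≤ κ S * rhoMod ρ a Set.univ := by
        have e1 : κ Set.univ * rhoMod ρ a Set.univ =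
            κ S * rhoMod ρ a Set.univ + κ Sᶜ * rhoMod ρ a Set.univ := by
          rw [← add_mul, measure_add_measure_compl hSm]
        have e2 : κ Set.univ * rhoMod ρ a Set.univ =
            κ Set.univ * rhoMod ρ a S + κ Set.univ * rhoMod ρ a Sᶜ := by
          rw [← mul_add, measure_add_measure_compl hSm]
        have hfin : κ Set.univ * rhoMod ρ a Sᶜ ≠ ⊤ :=
          ENNReal.mul_ne_top (measure_ne_top _ _) (measure_ne_top _ _)
        refine (ENNReal.add_le_add_iff_right hfin).1 ?_
        rw [← e2, e1]
        gcongr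
      calc _ ≤ κ Set.univ * rhoMod ρ a S := by gcongr
        _ ≤ κ S * rhoMod ρ a Set.univ := h3
        _ ≤ _ := by gcongr
    have hc0 : κ Set.univ * rhoMod ρ a Set.univ ≠ 0 := mul_ne_zero hκ0 hZ0
    have hct : κ Set.univ * rhoMod ρ a Set.univ ≠ ⊤ :=
      ENNReal.mul_ne_top (measure_ne_top _ _) hZt
    refine (ENNReal.mul_le_mul_iff_right hc0 hct).1 ?_
    calc _ = (chi ρ D T U * rhoMod ρ a Set.univ) * (κ Set.univ * rhoMod ρ a W) := by ring
      _ ≤ (κ Set.univ * rhoMod ρ a U) * (chi ρ D T Uᶜ * rhoMod ρ a Set.univ) := by gcongr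
      _ = _ := by ring

end FinB

namespace FinB

theorem pw (x z : ℝ) (hx : 0 ≤ x) (hz : 0 ≤ z) :
    12 * z * (Real.exp (2 * x) - Real.exp x) * Real.exp (13 / 16 * (18 * (1 + z) ^ 2 * x)) ≤
      Real.exp (18 * (1 + z) ^ 2 * x) - Real.exp (x + 9 * (1 + z) ^ 2 * x) := by
  set k : ℝ := 27 / 8 * (1 + z) ^ 2 - 2 with hk
  set c : ℝ := 9 * (1 + z) ^ 2 - 1 with hc
  have hk0 : 0 < k := by rw [hk]; nlinarith
  have hc0 : 0 < c := by rw [hc]; nlinarith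
  have e1 : Real.exp (2 * x) * Real.exp (13 / 16 * (18 * (1 + z) ^ 2 * x)) =
      Real.exp (18 * (1 + z) ^ 2 * x) * Real.exp (-(k * x)) := by
    rw [← Real.exp_add, ← Real.exp_add]; congr 1; rw [hk]; ring
  have e2 : Real.exp x = Real.exp (2 * x) * Real.exp (-x) := by
    rw [← Real.exp_add]; congr 1; ring
  have e3 : Real.exp (x + 9 * (1 + z) ^ 2 * x) =
      Real.exp (18 * (1 + z) ^ 2 * x) * Real.exp (-(c * x)) := by
    rw [← Real.exp_add]; congr 1; rw [hc]; ring
  have hM := Real.exp_pos (18 * (1 + z) ^ 2 * x)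
  have h1 : 1 - Real.exp (-x) ≤ x := by linarith [Real.add_one_le_exp (-x)]
  have hE := Real.exp_pos (-(k * x))
  have hE1 : Real.exp (-(k * x)) ≤ 1 := Real.exp_le_one_iff.2 (by nlinarith)
  have hE2 : 2 * (k * x) * Real.exp (-(k * x)) ≤ 1 := by
    have h2 := Real.quadratic_le_exp_of_nonneg (x := k * x) (by positivity)
    have h3 : 2 * (k * x) ≤ Real.exp (k * x) := by nlinarith [sq_nonneg (k * x - 1)]
    calc 2 * (k * x) * Real.exp (-(k * x)) ≤ Real.exp (k * x) * Real.exp (-(k * x)) := by gcongr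
      _ = 1 := by rw [← Real.exp_add]; simp
  have hC1 : Real.exp (-(c * x)) * (1 + c * x) ≤ 1 := by
    have h2 := Real.add_one_le_exp (c * x)
    calc Real.exp (-(c * x)) * (1 + c * x) ≤ Real.exp (-(c * x)) * Real.exp (c * x) := by
          gcongr; linarith
      _ = 1 := by rw [← Real.exp_add]; simp
  have hpoly : 12 * z * (2 * k + c) ≤ 2 * k * c := by
    rw [hk, hc]
    nlinarith [sq_nonneg (z - 1 / 2), sq_nonneg (z ^ 2), mul_nonneg hz (sq_nonneg (z - 1 / 2)),
      mul_nonneg hz (sq_nonneg z), sq_nonneg (z ^ 2 - 1 / 3)]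
  set E := Real.exp (-(k * x)) with hEdef
  have hkey : 12 * z * (E + c * x * E) ≤ c := by
    have h4 : 2 * k * (E + c * x * E) ≤ 2 * k + c := by
      have : 2 * k * E ≤ 2 * k := by nlinarith
      have : c * (2 * (k * x) * E) ≤ c := by nlinarith
      linarith
    have h5 : 2 * k * (12 * z * (E + c * x * E)) ≤ 2 * k * c := by
      calc _ = 12 * z * (2 * k * (E + c * x * E)) := by ring
        _ ≤ 12 * z * (2 * k + c) := by gcongr
        _ ≤ _ := hpoly
    exact le_of_mul_le_mul_left h5 (by positivity)
  have hfin : 12 * z * (1 - Real.exp (-x)) * E ≤ 1 - Real.exp (-(c * x)) := by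
    have hp : 0 < 1 + c * x := by positivity
    refine le_of_mul_le_mul_right ?_ hp
    calc 12 * z * (1 - Real.exp (-x)) * E * (1 + c * x) ≤ 12 * z * x * E * (1 + c * x) := by
          gcongr
      _ = x * (12 * z * (E + c * x * E)) := by ring
      _ ≤ x * c := by gcongr
      _ ≤ _ := by linarith
  calc _ = Real.exp (2 * x) * Real.exp (13 / 16 * (18 * (1 + z) ^ 2 * x)) *
        (12 * z * (1 - Real.exp (-x))) := by rw [e2]; ring
    _ = Real.exp (18 * (1 + z) ^ 2 * x) * (12 * z * (1 - Real.exp (-x)) * E) := by rw [e1]; ring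
    _ ≤ Real.exp (18 * (1 + z) ^ 2 * x) * (1 - Real.exp (-(c * x))) := by gcongr
    _ = _ := by rw [e3]; ring

theorem pw2 (a B T v : ℝ) (ha : 0 < a) (hB : 0 < B) (hBT : 3 * B ≤ T) (hv : T ≤ v) :
    12 / T * (Real.exp (a * B ^ 2) - Real.exp (a * B ^ 2 / 2)) *
      ((v - T) * Real.exp (13 / 16 * a * v ^ 2)) ≤
      Real.exp (a * v ^ 2) - Real.exp ((a * B ^ 2 + a * v ^ 2) / 2) := by
  have hT : 0 < T := by linarith
  set x : ℝ := a * T ^ 2 / 18 with hx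
  set z : ℝ := v / T - 1 with hz
  have hx0 : 0 ≤ x := by rw [hx]; positivity
  have hz0 : 0 ≤ z := by rw [hz, sub_nonneg, le_div_iff₀ hT]; linarith
  have hvz : v = T * (1 + z) := by rw [hz]; field_simp; ring
  have hBx : a * B ^ 2 / 2 ≤ x := by
    rw [hx]
    have : 9 * B ^ 2 ≤ T ^ 2 := by nlinarith
    nlinarith
  have hX : 18 * (1 + z) ^ 2 * x = a * v ^ 2 := by rw [hvz, hx]; ring
  have h := pw x z hx0 hz0
  have hX9 : 9 * (1 + z) ^ 2 * x = a * v ^ 2 / 2 := by rw [← hX]; ring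
  rw [hX, hX9] at h
  have hmono : Real.exp (a * B ^ 2) - Real.exp (a * B ^ 2 / 2) ≤ Real.exp (2 * x) - Real.exp x := by
    have f1 : Real.exp (a * B ^ 2) = Real.exp (a * B ^ 2 / 2) ^ 2 := by
      rw [← Real.exp_nat_mul]; congr 1; push_cast; ring
    have f2 : Real.exp (2 * x) = Real.exp x ^ 2 := by
      rw [← Real.exp_nat_mul]; congr 1
    rw [f1, f2]
    have g1 := Real.exp_le_exp.2 hBx
    have g2 : 1 ≤ Real.exp (a * B ^ 2 / 2) := Real.one_le_exp (by positivity)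
    nlinarith
  have h2 : Real.exp ((a * B ^ 2 + a * v ^ 2) / 2) ≤ Real.exp (x + a * v ^ 2 / 2) :=
    Real.exp_le_exp.2 (by linarith)
  have h3 : 12 / T * (v - T) = 12 * z := by rw [hz]; field_simp
  calc _ = (12 / T * (v - T)) * (Real.exp (a * B ^ 2) - Real.exp (a * B ^ 2 / 2)) *
        Real.exp (13 / 16 * (a * v ^ 2)) := by
          rw [show 13 / 16 * a * v ^ 2 = 13 / 16 * (a * v ^ 2) by ring]; ring
    _ ≤ 12 * z * (Real.exp (2 * x) - Real.exp x) * Real.exp (13 / 16 * (a * v ^ 2)) := by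
        rw [h3]; gcongr
    _ ≤ _ := by linarith

theorem pw3 (a B T u : ℝ) (ha : 0 < a) (hB : 0 < B) (hBT : 3 * B ≤ T) :
    12 / T * (Real.exp (a * B ^ 2) - Real.exp (a * B ^ 2 / 2)) *
      (ep T u * Real.exp (13 / 16 * a * u ^ 2) + ep T (-u) * Real.exp (13 / 16 * a * u ^ 2)) -
      (Real.exp (a * B ^ 2) - Real.exp (a * B ^ 2 / 2)) *
        (Set.Icc (-B) B).indicator (fun _ => (1 : ℝ)) u ≤
      Real.exp (a * u ^ 2) - Real.exp ((a * B ^ 2 + a * u ^ 2) / 2) := by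
  have hT : 0 < T := by linarith
  have hlt : Real.exp (a * B ^ 2 / 2) ≤ Real.exp (a * B ^ 2) :=
    Real.exp_le_exp.2 (by have : 0 ≤ a * B ^ 2 := by positivity
                          linarith)
  rcases le_or_gt |u| B with h | h
  · have hu := abs_le.1 h
    rw [Set.indicator_of_mem (show u ∈ Set.Icc (-B) B from hu)]
    have e1 : ep T u = 0 := max_eq_right (by linarith)
    have e2 : ep T (-u) = 0 := max_eq_right (by linarith)
    rw [e1, e2]
    have f1 : Real.exp (a * B ^ 2) = Real.exp (a * B ^ 2 / 2) ^ 2 := by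
      rw [← Real.exp_nat_mul]; congr 1; push_cast; ring
    have f2 : Real.exp (a * u ^ 2) = Real.exp (a * u ^ 2 / 2) ^ 2 := by
      rw [← Real.exp_nat_mul]; congr 1; push_cast; ring
    have f3 : Real.exp ((a * B ^ 2 + a * u ^ 2) / 2) =
        Real.exp (a * B ^ 2 / 2) * Real.exp (a * u ^ 2 / 2) := by
      rw [← Real.exp_add]; congr 1; ring
    rw [f1, f2, f3]
    have hs : u ^ 2 ≤ B ^ 2 := sq_le_sq.2 (by rwa [abs_of_pos hB])
    have g1 : Real.exp (a * u ^ 2 / 2) ≤ Real.exp (a * B ^ 2 / 2) := Real.exp_le_exp.2 (by gcongr)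
    have g2 : 1 ≤ Real.exp (a * u ^ 2 / 2) := Real.one_le_exp (by positivity)
    set w := Real.exp (a * u ^ 2 / 2)
    set E := Real.exp (a * B ^ 2 / 2)
    nlinarith [mul_nonneg (sub_nonneg.2 g1) (sub_nonneg.2 g2), sq_nonneg (E - w)]
  · have hnot : u ∉ Set.Icc (-B) B := fun hu => absurd (abs_le.2 hu) (not_le.2 h)
    rw [Set.indicator_of_notMem hnot, mul_zero, sub_zero]
    have hpos : Real.exp ((a * B ^ 2 + a * u ^ 2) / 2) ≤ Real.exp (a * u ^ 2) := by
      refine Real.exp_le_exp.2 ?_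
      have : B ^ 2 ≤ u ^ 2 := sq_le_sq.2 (by rw [abs_of_pos hB]; exact h.le)
      nlinarith
    rcases le_or_gt |u| T with h' | h'
    · have hu := abs_le.1 h'
      have e1 : ep T u = 0 := max_eq_right (by linarith)
      have e2 : ep T (-u) = 0 := max_eq_right (by linarith)
      rw [e1, e2]
      linarith
    · have hp := pw2 a B T |u| ha hB hBT h'.le
      rw [sq_abs] at hp
      have : ep T u + ep T (-u) = |u| - T := by
        unfold ep
        rcases le_total 0 u with h0 | h0
        · rw [abs_of_nonneg h0] at h' ⊢
          rw [max_eq_left (by linarith), max_eq_right (by linarith)]; ring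
        · rw [abs_of_nonpos h0] at h' ⊢
          rw [max_eq_right (by linarith), max_eq_left (by linarith)]; ring
      rw [← add_mul, this]
      exact hp

theorem key (ρ : Measure ℝ) [IsFiniteMeasure ρ] (hρ : ρ ≠ 0) (a B T : ℝ) (ha : 0 < a) (hB : 0 < B)
    (hBT : 3 * B ≤ T) (hint : Integrable (fun u => Real.exp (a * u ^ 2)) ρ)
    (hint2 : Integrable (fun u => Real.exp (a / 2 * u ^ 2)) ρ)
    (hZ : ∫ u, Real.exp (a * u ^ 2) ∂ρ ≤
      Real.exp (a * B ^ 2 / 2) * ∫ u, Real.exp (a / 2 * u ^ 2) ∂ρ) :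
    0 < (ρ (Set.Icc (-B) B)).toReal ∧
    (∫ u, ep T u * Real.exp (13 / 16 * a * u ^ 2) ∂ρ) +
      (∫ u, ep T (-u) * Real.exp (13 / 16 * a * u ^ 2) ∂ρ) ≤
      T / 12 * (ρ (Set.Icc (-B) B)).toReal := by
  have hT : 0 < T := by linarith
  have hfun : (fun u => Real.exp ((a * B ^ 2 + a * u ^ 2) / 2)) = fun u : ℝ =>
      Real.exp (a * B ^ 2 / 2) * Real.exp (a / 2 * u ^ 2) := by
    funext u; rw [← Real.exp_add]; congr 1; ring
  have hi2 : Integrable (fun u => Real.exp ((a * B ^ 2 + a * u ^ 2) / 2)) ρ := by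
    rw [hfun]; exact hint2.const_mul _
  have hle : ∫ u, (Real.exp (a * u ^ 2) - Real.exp ((a * B ^ 2 + a * u ^ 2) / 2)) ∂ρ ≤ 0 := by
    rw [integral_sub hint hi2, hfun, integral_const_mul]; linarith
  have hb1 := bad_int ρ a ha hint T hT.le
  have hb2 := bad_int' ρ a ha hint T hT.le
  have hind : Integrable ((Set.Icc (-B) B).indicator (fun _ => (1 : ℝ))) ρ :=
    (integrable_const (1 : ℝ)).indicator measurableSet_Icc
  set d := Real.exp (a * B ^ 2) - Real.exp (a * B ^ 2 / 2) with hd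
  have hd0 : 0 < d := by
    rw [hd, sub_pos]
    refine Real.exp_lt_exp.2 ?_
    have : 0 < a * B ^ 2 := by positivity
    linarith
  constructor
  · by_contra hcon
    have hc0 : ρ (Set.Icc (-B) B) = 0 := by
      by_contra hne
      exact hcon (ENNReal.toReal_pos hne (measure_ne_top _ _))
    have hae : ∀ᵐ u ∂ρ, u ∉ Set.Icc (-B) B := measure_eq_zero_iff_ae_notMem.1 hc0
    have hpos : ∀ᵐ u ∂ρ, 0 < Real.exp (a * u ^ 2) - Real.exp ((a * B ^ 2 + a * u ^ 2) / 2) := by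
      filter_upwards [hae] with u hu
      rw [sub_pos]
      refine Real.exp_lt_exp.2 ?_
      have h : B < |u| := by
        by_contra hc
        push Not at hc
        exact hu (abs_le.1 hc)
      have : B ^ 2 < u ^ 2 := sq_lt_sq.2 (by rwa [abs_of_pos hB])
      nlinarith
    have hz := (integral_eq_zero_iff_of_nonneg_ae (hpos.mono fun u hu => hu.le)
      (hint.sub hi2)).1 (le_antisymm hle (integral_nonneg_of_ae (hpos.mono fun u hu => hu.le)))
    have hF : ∀ᵐ u ∂ρ, False := by
      filter_upwards [hz, hpos] with u h1 h2
      simp only [Pi.zero_apply] at h1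
      linarith
    rw [Filter.eventually_false_iff_eq_bot, ae_eq_bot] at hF
    exact hρ hF
  · have hL : Integrable (fun u => 12 / T * d *
      (ep T u * Real.exp (13 / 16 * a * u ^ 2) + ep T (-u) * Real.exp (13 / 16 * a * u ^ 2))) ρ :=
      (hb1.add hb2).const_mul _
    have hm := integral_mono (hL.sub (hind.const_mul d)) (hint.sub hi2)
      (fun u => pw3 a B T u ha hB hBT)
    simp only [Pi.sub_apply] at hm
    have e1 := integral_sub hL (hind.const_mul d)
    rw [integral_const_mul, integral_const_mul, integral_add hb1 hb2,
      integral_indicator measurableSet_Icc, setIntegral_const, smul_eq_mul, mul_one] at e1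
    have h2 := (e1.symm.trans_le hm).trans hle
    unfold Measure.real at h2
    set b1 := (∫ u, ep T u * Real.exp (13 / 16 * a * u ^ 2) ∂ρ) +
      (∫ u, ep T (-u) * Real.exp (13 / 16 * a * u ^ 2) ∂ρ)
    set c := (ρ (Set.Icc (-B) B)).toReal
    have h3 : d * (12 / T * b1) ≤ d * c := by linarith
    have h4 := le_of_mul_le_mul_left h3 hd0
    rw [div_mul_eq_mul_div, div_le_iff₀ hT] at h4
    linarith

end FinB

namespace FinB

section walks
variable {V : Type*} (J : V → V → ℝ) (f : ℝ → ℝ) (lam : ℝ) (C : ℝ)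

/-- The set of admissible values for `A`. -/
def ASet (ξ : V → ℝ) (x : V) (R : Set V) : Set ℝ :=
  {A : ℝ | 1 ≤ A ∧ ∀ (m : ℕ) (w : ℕ → V), IsWalk J R m w → w 0 = x → w m ∈ R →
    |∑' z : {z : V // z ∉ R}, J (w m) z.1 * ξ z.1| ≤
      (∑' z : {z : V // z ∉ R}, |J (w m) z.1| * f (J (w m) z.1)) * C * A * lam ^ (m + 1) *
        ∏ i ∈ Finset.range m, f (J (w i) (w (i + 1)))}

lemma prod_f_ge (hf1 : ∀ t, 1 ≤ f t) (m : ℕ) (t : ℕ → ℝ) :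
    1 ≤ ∏ i ∈ Finset.range m, f (t i) := by
  induction m with
  | zero => simp
  | succ k ih =>
    rw [Finset.prod_range_succ]
    have := hf1 (t k)
    nlinarith

lemma d_nonneg (hf1 : ∀ t, 1 ≤ f t) (R : Set V) (y : V) :
    0 ≤ ∑' z : {z : V // z ∉ R}, |J y z.1| * f (J y z.1) :=
  tsum_nonneg fun z => mul_nonneg (abs_nonneg _) (zero_le_one.trans (hf1 _))

lemma mem_ASet_of (hf1 : ∀ t, 1 ≤ f t) (hlam : 1 ≤ lam) (hC : 1 ≤ C) (ξ : V → ℝ) (x : V)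
    (R : Set V) (A : ℝ) (hA : 1 ≤ A)
    (h : ∀ y ∈ R, |∑' z : {z : V // z ∉ R}, J y z.1 * ξ z.1| ≤
      (∑' z : {z : V // z ∉ R}, |J y z.1| * f (J y z.1)) * C * A * lam) :
    A ∈ ASet J f lam C ξ x R := by
  refine ⟨hA, fun m w _ _ hm => (h _ hm).trans ?_⟩
  have h1 := prod_f_ge f hf1 m (fun i => J (w i) (w (i+1)))
  have h2 : lam ≤ lam ^ (m+1) := by
    rw [pow_succ]
    have := one_le_pow₀ hlam (n := m)
    nlinarith
  have h3 := d_nonneg J f hf1 R (w m)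
  have h4 : 0 ≤ (∑' z : {z : V // z ∉ R}, |J (w m) z.1| * f (J (w m) z.1)) * C * A := by
    have : 0 ≤ C := by linarith
    have : 0 ≤ A := by linarith
    positivity
  have h5 : 0 ≤ lam := by linarith
  calc _ ≤ (∑' z : {z : V // z ∉ R}, |J (w m) z.1| * f (J (w m) z.1)) * C * A * lam ^ (m+1) :=
        mul_le_mul_of_nonneg_left h2 h4
    _ ≤ _ := le_mul_of_one_le_right (by positivity) h1

lemma ASet_nonempty (hf1 : ∀ t, 1 ≤ f t) (hlam : 1 ≤ lam) (hC : 1 ≤ C) (ξ : V → ℝ) (x : V)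
    (hJsum : ∀ x, Summable fun y => |J x y| * f (J x y))
    (Λ : Finset V) : (ASet J f lam C ξ x (↑Λ)).Nonempty := by
  have key : ∀ y : V, ∃ A : ℝ, 0 ≤ A ∧ |∑' z : {z : V // z ∉ (↑Λ : Set V)}, J y z.1 * ξ z.1| ≤
      (∑' z : {z : V // z ∉ (↑Λ : Set V)}, |J y z.1| * f (J y z.1)) * A := by
    intro y
    have hs : Summable fun z : {z : V // z ∉ (↑Λ : Set V)} => |J y z.1| * f (J y z.1) :=
      (hJsum y).subtype _
    by_cases hd : (∑' z : {z : V // z ∉ (↑Λ : Set V)}, |J y z.1| * f (J y z.1)) = 0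
    · have h0 : ∀ z : {z : V // z ∉ (↑Λ : Set V)}, J y z.1 = 0 := by
        have := (hs.hasSum_iff.2 hd)
        rw [hasSum_zero_iff_of_nonneg
          (fun z => mul_nonneg (abs_nonneg _) (zero_le_one.trans (hf1 _)))] at this
        intro z
        have h := congrFun this z
        have h1 := hf1 (J y z.1)
        rcases mul_eq_zero.1 h with h | h
        · exact abs_eq_zero.1 h
        · exfalso; linarith
      refine ⟨0, le_rfl, ?_⟩
      simp [h0]
    · have hp := d_nonneg J f hf1 (↑Λ : Set V) y
      refine ⟨|∑' z : {z : V // z ∉ (↑Λ : Set V)}, J y z.1 * ξ z.1| /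
        (∑' z : {z : V // z ∉ (↑Λ : Set V)}, |J y z.1| * f (J y z.1)), by positivity, ?_⟩
      rw [mul_div_cancel₀ _ hd]
  choose A hA0 hA using key
  refine ⟨1 + ∑ y ∈ Λ, A y, mem_ASet_of J f lam C hf1 hlam hC ξ x _ _ ?_ ?_⟩
  · have := Finset.sum_nonneg (s := Λ) (f := A) fun y _ => hA0 y
    linarith
  · intro y hy
    refine (hA y).trans ?_
    have h3 := d_nonneg J f hf1 (↑Λ : Set V) y
    have h4 : A y ≤ ∑ y ∈ Λ, A y :=
      Finset.single_le_sum (f := A) (fun y _ => hA0 y) (Finset.mem_coe.1 hy)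
    have h5 : A y ≤ C * (1 + ∑ y ∈ Λ, A y) * lam := by
      have h6 := hA0 y
      have h7 : 1 * (1 + ∑ y ∈ Λ, A y) * 1 ≤ C * (1 + ∑ y ∈ Λ, A y) * lam := by
        have : 0 ≤ 1 + ∑ y ∈ Λ, A y := by linarith
        gcongr
      linarith
    calc _ ≤ (∑' z : {z : V // z ∉ (↑Λ : Set V)}, |J y z.1| * f (J y z.1)) *
          (C * (1 + ∑ y ∈ Λ, A y) * lam) := mul_le_mul_of_nonneg_left h5 h3
      _ = _ := by ring

lemma AReal_mem (hf1 : ∀ t, 1 ≤ f t) (hlam : 1 ≤ lam) (hC : 1 ≤ C) (ξ : V → ℝ) (x : V)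
    (hJsum : ∀ x, Summable fun y => |J x y| * f (J x y))
    (Λ : Finset V) : ARealL J f lam ξ C x (↑Λ) ∈ ASet J f lam C ξ x (↑Λ) := by
  refine IsClosed.csInf_mem ?_ (ASet_nonempty J f lam C hf1 hlam hC ξ x hJsum Λ)
    ⟨1, fun A hA => hA.1⟩
  have : ASet J f lam C ξ x (↑Λ) = Set.Ici 1 ∩ ⋂ (m : ℕ) (w : ℕ → V)
      (_ : IsWalk J (↑Λ) m w) (_ : w 0 = x) (_ : w m ∈ (↑Λ : Set V)), {A : ℝ |
    |∑' z : {z : V // z ∉ (↑Λ : Set V)}, J (w m) z.1 * ξ z.1| ≤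
      (∑' z : {z : V // z ∉ (↑Λ : Set V)}, |J (w m) z.1| * f (J (w m) z.1)) * C * A *
        lam ^ (m + 1) * ∏ i ∈ Finset.range m, f (J (w i) (w (i + 1)))} := by
    ext A
    constructor
    · rintro ⟨h1, h2⟩
      refine ⟨h1, ?_⟩
      simp only [Set.mem_iInter]
      exact h2
    · rintro ⟨h1, h2⟩
      refine ⟨h1, ?_⟩
      simp only [Set.mem_iInter] at h2
      exact h2
  rw [this]
  refine isClosed_Ici.inter ?_
  refine isClosed_iInter fun m => isClosed_iInter fun w => isClosed_iInter fun _ =>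
    isClosed_iInter fun _ => isClosed_iInter fun _ => isClosed_le (by fun_prop) (by fun_prop)

lemma AReal_le (ξ : V → ℝ) (x : V) (R : Set V) (A : ℝ) (hA : A ∈ ASet J f lam C ξ x R) :
    ARealL J f lam ξ C x R ≤ A := csInf_le ⟨1, fun A hA => hA.1⟩ hA

lemma AReal_h (hf1 : ∀ t, 1 ≤ f t) (hlam : 1 ≤ lam) (hC : 1 ≤ C) (ξ : V → ℝ)
    (hJsum : ∀ x, Summable fun y => |J x y| * f (J x y))
    (Λ : Finset V) (x : V) (hx : x ∈ Λ) :
    |∑' z : {z : V // z ∉ (↑Λ : Set V)}, J x z.1 * ξ z.1| ≤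
      (∑' z : {z : V // z ∉ (↑Λ : Set V)}, |J x z.1| * f (J x z.1)) * C *
        ARealL J f lam ξ C x (↑Λ) * lam := by
  have := (AReal_mem J f lam C hf1 hlam hC ξ x hJsum Λ).2 0 (fun _ => x)
    ⟨fun i h1 h2 => by omega, fun i h => by omega⟩ rfl (Finset.mem_coe.2 hx)
  simpa using this

lemma AReal_nbr (hf1 : ∀ t, 1 ≤ f t) (hlam : 1 ≤ lam) (hC : 1 ≤ C) (ξ : V → ℝ)
    (hJsum : ∀ x, Summable fun y => |J x y| * f (J x y))
    (Λ : Finset V) (x y : V) (hy : y ∈ Λ) (hJ : J x y ≠ 0) :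
    ARealL J f lam ξ C y (↑Λ) ≤ lam * f (J x y) * ARealL J f lam ξ C x (↑Λ) := by
  have hm := AReal_mem J f lam C hf1 hlam hC ξ x hJsum Λ
  refine AReal_le J f lam C ξ y _ _ ⟨?_, ?_⟩
  · have h1 := hm.1
    have h2 := hf1 (J x y)
    have : 1 ≤ lam * f (J x y) := by nlinarith
    nlinarith
  · intro m w hw h0 hmR
    have := hm.2 (m+1) (fun i => if i = 0 then x else w (i-1)) ⟨?_, ?_⟩ (by simp) (by simpa using hmR)
    · rw [Finset.prod_range_succ'] at this
      simp only [Nat.add_eq_zero_iff, one_ne_zero, and_false, if_false, Nat.add_sub_cancel,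
        if_true, zero_add, Nat.sub_self, h0] at this
      refine this.trans (le_of_eq ?_)
      rw [pow_succ lam (m+1)]
      ring
    · intro i h1 h2
      have hi : i ≠ 0 := by omega
      simp only [hi, if_false]
      rcases Nat.eq_or_lt_of_le (Nat.one_le_iff_ne_zero.2 hi) with h | h
      · subst h
        simpa [h0] using hy
      · exact hw.1 (i-1) (by omega) (by omega)
    · intro i hi
      by_cases h : i = 0
      · subst h; simpa [h0] using hJ
      · simp only [h, if_false, Nat.add_eq_zero_iff, one_ne_zero, and_false, Nat.add_sub_cancel]
        have := hw.2 (i-1) (by omega)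
        rwa [Nat.sub_add_cancel (by omega)] at this

/-- Splitting the sum. -/
lemma sum_split (hJsum : ∀ x, Summable fun y => |J x y| * f (J x y)) (Λ : Finset V) (x : V)
    (hx : x ∈ Λ) :
    (∑' z : {z : V // z ∉ (↑Λ : Set V)}, |J x z.1| * f (J x z.1)) +
      ∑ y : ↥Λ, (if x ≠ y.1 then |J x y.1| * f (J x y.1) else 0) =
    ∑' z : {z : V // z ∉ (↑({x} : Finset V) : Set V)}, |J x z.1| * f (J x z.1) := by
  set F : V → ℝ := fun y => |J x y| * f (J x y) with hF
  have hs : Summable F := hJsum x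
  have h1 := hs.sum_add_tsum_subtype_compl Λ
  have h2 := hs.sum_add_tsum_subtype_compl {x}
  have e1 : (∑' z : {z : V // z ∉ (↑Λ : Set V)}, F z.1) = ∑' z : {z : V // z ∉ Λ}, F z.1 := rfl
  have e2 : (∑' z : {z : V // z ∉ (↑({x} : Finset V) : Set V)}, F z.1) =
    ∑' z : {z : V // z ∉ ({x} : Finset V)}, F z.1 := rfl
  have e3 : ∑ y : ↥Λ, (if x ≠ y.1 then F y.1 else 0) = ∑ y ∈ Λ, (if x ≠ y then F y else 0) :=
    Finset.sum_coe_sort Λ (fun y => if x ≠ y then F y else 0)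
  have e4 : ∑ y ∈ Λ, (if x ≠ y then F y else 0) = ∑ y ∈ Λ, F y - F x := by
    rw [← Finset.add_sum_erase _ _ hx, ← Finset.add_sum_erase _ F hx]
    simp only [ne_eq, not_true_eq_false, if_false, zero_add, add_sub_cancel_left]
    refine Finset.sum_congr rfl fun y hy => ?_
    rw [if_pos (Ne.symm (Finset.ne_of_mem_erase hy))]
  rw [Finset.sum_singleton] at h2
  change _ + ∑ y : ↥Λ, (if x ≠ y.1 then F y.1 else 0) = _
  rw [e3, e4]
  change (∑' z : {z : V // z ∉ Λ}, F z.1) + _ = (∑' z : {z : V // z ∉ (↑({x} : Finset V) : Set V)}, F z.1)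
  rw [e2]
  linarith

end walks
end FinB

namespace FinB

section regs
variable {V : Type*} (J : V → V → ℝ) (f : ℝ → ℝ) (lam : ℝ) (C : ℝ)

lemma hamil_single (β : ℝ) (x : V) (ξ : V → ℝ) (φ : ↥({x} : Finset V) → ℝ) :
    hamil J β {x} ξ φ = β * (∑' y : {y : V // y ∉ ({x} : Finset V)}, J x y.1 * ξ y.1) *
      φ default := by
  unfold hamil
  simp only [Fintype.sum_unique, ne_eq, not_true_eq_false, if_false, mul_zero, zero_add]
  have : (default : ↥({x} : Finset V)).1 = x := by
    have := (default : ↥({x} : Finset V)).2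
    simpa using this
  rw [this]
  ring

lemma reg1 (hf1 : ∀ t, 1 ≤ f t)
    (hJsum : ∀ x, Summable fun y => |J x y| * f (J x y))
    (β a Ct : ℝ) (ρ : Measure ℝ) [IsFiniteMeasure ρ] [IsFiniteMeasure (rhoMod ρ (a/2))]
    (hlam1 : 1 ≤ lam) (hC : 1 ≤ C) (hCt : 0 < Ct)
    (hreg : ∀ (Λ Λ' : Finset V) (hsub : Λ' ⊆ Λ) (ξ : V → ℝ),
      (∀ x ∈ Λ, Summable fun y => |J x y * ξ y|) →
      marg hsub (gibbs J β ρ Λ ξ) ≤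
        ENNReal.ofReal (∏ x ∈ Λ', Real.exp (Ct * ARealL J f lam ξ C x (↑Λ) ^ 2)) •
        prodN (rhoMod ρ (a / 2)) Λ')
    (x : V) (A : ℝ) (hA : 1 ≤ A) (D : ℝ)
    (hD : D = β * lam * ∑' z : {z : V // z ∉ (↑({x} : Finset V) : Set V)}, |J x z.1| * f (J x z.1))
    (κ : Measure ℝ) [IsFiniteMeasure κ]
    (hκ : κ = ρ.withDensity fun u => ENNReal.ofReal (Real.exp (D * C * A * u)))
    (hκ0 : κ Set.univ ≠ 0) (S : Set ℝ) (hS : MeasurableSet S) :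
    κ S ≤ κ Set.univ * (ENNReal.ofReal (Real.exp (Ct * A ^ 2)) *
      ((rhoMod ρ (a/2) Set.univ)⁻¹ * rhoMod ρ (a/2) S)) := by
  set ξ : V → ℝ := fun z => SignType.sign (J x z) * f (J x z) * (lam * C * A) with hξ
  have hJξ : ∀ z, J x z * ξ z = |J x z| * f (J x z) * (lam * C * A) := by
    intro z
    have h := sign_mul_self (J x z)
    calc J x z * ξ z = (SignType.sign (J x z) * J x z) * f (J x z) * (lam * C * A) := by
          rw [hξ]; ring
      _ = _ := by rw [h]
  have hpos : 0 ≤ lam * C * A := by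
    have : 0 ≤ lam := by linarith
    have : 0 ≤ C := by linarith
    have : 0 ≤ A := by linarith
    positivity
  have hsum : ∀ y ∈ ({x} : Finset V), Summable fun z => |J y z * ξ z| := by
    intro y hy
    rw [Finset.mem_singleton] at hy
    subst hy
    simp only [hJξ]
    exact ((hJsum y).mul_right _).abs
  have hr := hreg {x} {x} (Finset.Subset.refl _) ξ hsum
  have htsum : (∑' y : {y : V // y ∉ (↑({x} : Finset V) : Set V)}, J x y.1 * ξ y.1) =
      (∑' z : {z : V // z ∉ (↑({x} : Finset V) : Set V)}, |J x z.1| * f (J x z.1)) *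
        (lam * C * A) := by
    simp only [hJξ]
    rw [tsum_mul_right]
  have hAle : ARealL J f lam ξ C x (↑({x} : Finset V)) ≤ A := by
    refine AReal_le J f lam C ξ x _ _ (mem_ASet_of J f lam C hf1 hlam1 hC ξ x _ A hA ?_)
    intro y hy
    have hy : y = x := by simpa using hy
    subst hy
    rw [htsum, abs_of_nonneg (mul_nonneg (d_nonneg J f hf1 _ _) hpos)]
    exact le_of_eq (by ring)
  have hA1 : 1 ≤ ARealL J f lam ξ C x (↑({x} : Finset V)) :=
    (AReal_mem J f lam C hf1 hlam1 hC ξ x hJsum {x}).1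
  have hham : ∀ φ, hamil J β {x} ξ φ = D * C * A * φ default := by
    intro φ
    rw [hamil_single]
    have : (∑' y : {y : V // y ∉ ({x} : Finset V)}, J x y.1 * ξ y.1) = _ := htsum
    rw [this, hD]
    ring
  have mp : MeasurePreserving (fun φ : ↥({x} : Finset V) → ℝ => φ default)
      (Measure.pi fun _ : ↥({x} : Finset V) => ρ) ρ :=
    measurePreserving_funUnique ρ _
  have mp2 : MeasurePreserving (fun φ : ↥({x} : Finset V) → ℝ => φ default)
      (Measure.pi fun _ : ↥({x} : Finset V) => rhoMod ρ (a/2)) (rhoMod ρ (a/2)) :=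
    measurePreserving_funUnique (rhoMod ρ (a/2)) _
  have hmev : Measurable (fun φ : ↥({x} : Finset V) → ℝ => φ default) := measurable_pi_apply _
  have hG : ∀ S : Set ℝ, MeasurableSet S → ((Measure.pi fun _ : ↥({x} : Finset V) => ρ).withDensity
      fun φ => ENNReal.ofReal (Real.exp (hamil J β {x} ξ φ)))
        ((fun φ : ↥({x} : Finset V) → ℝ => φ default) ⁻¹' S) = κ S := by
    intro S hS
    rw [withDensity_apply _ (hmev hS), hκ, withDensity_apply _ hS]
    simp only [hham]
    exact mp.setLIntegral_comp_preimage hS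
      (f := fun u => ENNReal.ofReal (Real.exp (D * C * A * u))) (by fun_prop)
  have h1 := Measure.le_iff'.1 hr ((fun φ : ↥({x} : Finset V) → ℝ => φ default) ⁻¹' S)
  have hid : marg (Finset.Subset.refl {x}) (gibbs J β ρ {x} ξ) = gibbs J β ρ {x} ξ := by
    unfold marg
    exact Measure.map_id
  rw [hid] at h1
  have hG1 := hG Set.univ MeasurableSet.univ
  rw [Set.preimage_univ] at hG1
  have hP1 := mp2.measure_preimage (MeasurableSet.univ.nullMeasurableSet)
  rw [Set.preimage_univ] at hP1
  have hP2 := mp2.measure_preimage hS.nullMeasurableSet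
  unfold gibbs prodN at h1
  simp only [Measure.smul_apply, smul_eq_mul, Finset.prod_singleton] at h1
  rw [hG1, hG S hS, hP1, hP2] at h1
  have h2 : κ S = κ Set.univ * ((κ Set.univ)⁻¹ * κ S) := by
    rw [← mul_assoc, ENNReal.mul_inv_cancel hκ0 (measure_ne_top _ _), one_mul]
  rw [h2]
  refine mul_le_mul_right (h1.trans ?_) _
  refine mul_le_mul_left (ENNReal.ofReal_le_ofReal (Real.exp_le_exp.2 ?_)) _
  refine mul_le_mul_of_nonneg_left ?_ hCt.le
  exact pow_le_pow_left₀ (by linarith) hAle 2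

end regs
end FinB

namespace FinB

theorem w1_int (ρ : Measure ℝ) (a D T : ℝ) (hD0 : 0 ≤ D) (hD : D ≤ a / 4) (hT : 0 ≤ T)
    (hint : Integrable (fun u => Real.exp (a * u ^ 2)) ρ) :
    Integrable (fun u => if -T ≤ u then Real.exp (Th D T u) else 0) ρ := by
  refine (hint.const_mul (Real.exp (a * T ^ 2))).mono' (w1_meas D T).aestronglyMeasurable
    (Filter.Eventually.of_forall fun u => ?_)
  rw [Real.norm_of_nonneg (by split_ifs <;> positivity), ← Real.exp_add]
  split_ifs
  · exact Real.exp_le_exp.2 (Th_le hD0 hD hT u)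
  · exact (Real.exp_pos _).le

theorem chi_fin (ρ : Measure ℝ) (a D T : ℝ) (hD0 : 0 ≤ D) (hD : D ≤ a / 4) (hT : 0 ≤ T)
    (hint : Integrable (fun u => Real.exp (a * u ^ 2)) ρ) : IsFiniteMeasure (chi ρ D T) :=
  isFiniteMeasure_withDensity_ofReal (w1_int ρ a D T hD0 hD hT hint).2

theorem F2_meas {ι : Type*} [Fintype ι] (T D : ι → ℝ) : Measurable (F2 T D) := by
  unfold F2
  exact Finset.measurable_prod _ fun x _ => (w1_meas (D x) (T x)).comp (measurable_pi_apply x)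

theorem pi_chi {ι : Type*} [Fintype ι] (ρ : Measure ℝ) [IsFiniteMeasure ρ] (a : ℝ) (D T : ι → ℝ)
    (hD0 : ∀ x, 0 ≤ D x) (hD : ∀ x, D x ≤ a / 4) (hT : ∀ x, 0 ≤ T x)
    (hint : Integrable (fun u => Real.exp (a * u ^ 2)) ρ) :
    Measure.pi (fun x => chi ρ (D x) (T x)) =
      (Measure.pi fun _ : ι => ρ).withDensity fun φ => ENNReal.ofReal (F2 T D φ) := by
  haveI : ∀ x, IsFiniteMeasure (chi ρ (D x) (T x)) := fun x =>
    chi_fin ρ a _ _ (hD0 x) (hD x) (hT x) hint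
  refine Measure.pi_eq fun S hS => ?_
  rw [withDensity_apply _ (MeasurableSet.univ_pi hS), Measure.restrict_pi_pi]
  have h1 : ∀ x, Integrable (fun u => if -T x ≤ u then Real.exp (Th (D x) (T x) u) else 0)
      (ρ.restrict (S x)) := fun x => (w1_int ρ a _ _ (hD0 x) (hD x) (hT x) hint).restrict
  have h0 : ∀ x u, 0 ≤ (if -T x ≤ u then Real.exp (Th (D x) (T x) u) else 0) := by
    intro x u; split_ifs <;> positivity
  have h2 : Integrable (F2 T D) (Measure.pi fun i => ρ.restrict (S i)) := by
    unfold F2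
    exact Integrable.fintype_prod (f := fun x u =>
      if -T x ≤ u then Real.exp (Th (D x) (T x) u) else 0) h1
  rw [← ofReal_integral_eq_lintegral_ofReal h2 (Filter.Eventually.of_forall fun φ => F2_nonneg φ)]
  unfold F2
  rw [integral_fintype_prod_eq_prod (f := fun x u =>
      if -T x ≤ u then Real.exp (Th (D x) (T x) u) else 0),
    ENNReal.ofReal_prod_of_nonneg (fun x _ => integral_nonneg (h0 x))]
  refine Finset.prod_congr rfl fun x _ => ?_
  rw [chi_apply _ _ _ _ (hS x), ofReal_integral_eq_lintegral_ofReal (h1 x)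
    (Filter.Eventually.of_forall (h0 x))]

theorem Dom1.smul {μ ν : Measure ℝ} (h : Dom1 μ ν) (c : ℝ≥0∞) : Dom1 μ (c • ν) := by
  intro g hg hgm
  have := h g hg hgm
  rw [lintegral_smul_measure, Measure.smul_apply, smul_eq_mul, smul_eq_mul]
  calc _ = c * ((∫⁻ u, g u ∂μ) * ν Set.univ) := by ring
    _ ≤ c * ((∫⁻ u, g u ∂ν) * μ Set.univ) := by gcongr
    _ = _ := by ring

theorem chi_ne (ρ : Measure ℝ) (D T B : ℝ) (hB : 0 < B) (hBT : 3 * B ≤ T)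
    (hc : 0 < (ρ (Set.Icc (-B) B)).toReal) : chi ρ D T Set.univ ≠ 0 := by
  intro h0
  rw [chi_apply _ _ _ _ MeasurableSet.univ, Measure.restrict_univ,
    lintegral_eq_zero_iff (w1_meas D T).ennreal_ofReal] at h0
  have : ρ (Set.Icc (-B) B) = 0 := by
    refine measure_mono_null ?_ h0
    intro u hu
    have h1 : -T ≤ u := by linarith [hu.1]
    intro h2
    have h3 : ENNReal.ofReal (if -T ≤ u then Real.exp (Th D T u) else 0) = 0 := h2
    rw [if_pos h1, ENNReal.ofReal_eq_zero] at h3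
    linarith [Real.exp_pos (Th D T u)]
  rw [this] at hc
  simp at hc

section
variable {ι : Type*} [Fintype ι] {ρ : Measure ℝ} {K : ι → ι → ℝ} {a : ℝ} {θ T B D : ι → ℝ}

theorem full [IsFiniteMeasure ρ] (h : CDat ρ K a θ T B D) (hD0 : ∀ x, 0 ≤ D x)
    (ν : ι → Measure ℝ) [∀ x, IsProbabilityMeasure (ν x)]
    (hdom : ∀ x, Dom1 (chi ρ (D x) (T x)) (ν x))
    (g : (ι → ℝ) → ℝ) (hg : Measurable g) (hgm : Monotone g)
    (hg0 : ∀ φ, 0 ≤ g φ) (hg1 : ∀ φ, g φ ≤ 1) :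
    (∫ φ, Real.exp (HH K θ φ) * g φ ∂(Measure.pi fun _ : ι => ρ)) ≤
      (∫ φ, g φ ∂(Measure.pi ν)) *
      (∫ φ, Real.exp (HH K θ φ) ∂(Measure.pi fun _ : ι => ρ)) := by
  have hl := limit h g hg hgm hg0 hg1
  have hT : ∀ x, 0 ≤ T x := fun x => by linarith [h.hB x, h.hBT x]
  haveI : ∀ x, IsFiniteMeasure (chi ρ (D x) (T x)) := fun x =>
    chi_fin ρ a _ _ (hD0 x) (h.hD x) (hT x) h.hint
  have hpc := pi_chi ρ a D T hD0 h.hD hT h.hint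
  have hgo : Measurable fun φ => ENNReal.ofReal (g φ) := hg.ennreal_ofReal
  have hd := dom_pi (fun x => chi ρ (D x) (T x)) ν hdom (fun φ => ENNReal.ofReal (g φ)) hgo
    (fun φ ψ hφ => ENNReal.ofReal_le_ofReal (hgm hφ))
  simp only [measure_univ, Finset.prod_const_one, mul_one] at hd
  rw [← Measure.pi_univ, hpc, withDensity_apply _ MeasurableSet.univ, Measure.restrict_univ,
    lintegral_withDensity_eq_lintegral_mul _ (F2_meas T D).ennreal_ofReal hgo] at hd
  have hF2int : Integrable (F2 T D) (Measure.pi fun _ : ι => ρ) := by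
    refine (bd_int h.hint (fun x => a * T x ^ 2)).mono' (F2_meas T D).aestronglyMeasurable
      (Filter.Eventually.of_forall fun φ => ?_)
    rw [Real.norm_of_nonneg (F2_nonneg φ)]
    exact F2_le h.ha hD0 h.hD hT φ
  have hF2g : Integrable (fun φ => F2 T D φ * g φ) (Measure.pi fun _ : ι => ρ) := by
    refine hF2int.mono' ((F2_meas T D).mul hg).aestronglyMeasurable
      (Filter.Eventually.of_forall fun φ => ?_)
    rw [Real.norm_of_nonneg (mul_nonneg (F2_nonneg φ) (hg0 φ))]
    exact mul_le_of_le_one_right (F2_nonneg φ) (hg1 φ)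
  have hgint : Integrable g (Measure.pi ν) := by
    refine (integrable_const (1 : ℝ)).mono' hg.aestronglyMeasurable
      (Filter.Eventually.of_forall fun φ => ?_)
    rw [Real.norm_of_nonneg (hg0 φ)]
    exact hg1 φ
  have e1 : (∫⁻ φ, ((fun φ => ENNReal.ofReal (F2 T D φ)) * fun φ => ENNReal.ofReal (g φ)) φ
      ∂(Measure.pi fun _ : ι => ρ)) =
      ENNReal.ofReal (∫ φ, F2 T D φ * g φ ∂(Measure.pi fun _ : ι => ρ)) := by
    rw [ofReal_integral_eq_lintegral_ofReal hF2g
      (Filter.Eventually.of_forall fun φ => mul_nonneg (F2_nonneg φ) (hg0 φ))]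
    refine lintegral_congr fun φ => ?_
    rw [ENNReal.ofReal_mul (F2_nonneg φ)]
    rfl
  rw [e1, ← ofReal_integral_eq_lintegral_ofReal hF2int
      (Filter.Eventually.of_forall fun φ => F2_nonneg φ),
    ← ofReal_integral_eq_lintegral_ofReal hgint (Filter.Eventually.of_forall hg0),
    ← ENNReal.ofReal_mul (integral_nonneg hg0),
    ENNReal.ofReal_le_ofReal_iff (mul_nonneg (integral_nonneg hg0)
      (integral_nonneg fun φ => F2_nonneg φ))] at hd
  have hQ : 0 < ∫ φ, F2 T D φ ∂(Measure.pi fun _ : ι => ρ) := by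
    rw [← ENNReal.ofReal_pos, ofReal_integral_eq_lintegral_ofReal hF2int
      (Filter.Eventually.of_forall fun φ => F2_nonneg φ), ← Measure.restrict_univ (μ := Measure.pi _),
      ← withDensity_apply _ MeasurableSet.univ, ← hpc, Measure.pi_univ, pos_iff_ne_zero,
      Finset.prod_ne_zero_iff]
    exact fun x _ => chi_ne ρ (D x) (T x) (B x) (h.hB x) (h.hBT x) (h.core x)
  have hN : 0 ≤ ∫ φ, Real.exp (HH K θ φ) ∂(Measure.pi fun _ : ι => ρ) :=
    integral_nonneg fun φ => (Real.exp_pos _).le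
  refine le_of_mul_le_mul_right (hl.trans ?_) hQ
  calc _ ≤ (∫ φ, g φ ∂(Measure.pi ν)) * (∫ φ, F2 T D φ ∂(Measure.pi fun _ : ι => ρ)) *
        ∫ φ, Real.exp (HH K θ φ) ∂(Measure.pi fun _ : ι => ρ) :=
      mul_le_mul_of_nonneg_right hd hN
    _ = _ := by ring
end

theorem stoch_of01 {ι : Type*} (μ ν : Measure (ι → ℝ)) [IsProbabilityMeasure μ]
    [IsProbabilityMeasure ν]
    (h : ∀ g : (ι → ℝ) → ℝ, Measurable g → Monotone g → (∀ φ, 0 ≤ g φ) → (∀ φ, g φ ≤ 1) →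
      ∫ φ, g φ ∂μ ≤ ∫ φ, g φ ∂ν) : StochDom μ ν := by
  intro g hg hgm ⟨K, hK⟩
  set L := max K 1 with hL
  have hL1 : 1 ≤ L := le_max_right _ _
  have hKL : ∀ φ, |g φ| ≤ L := fun φ => (hK φ).trans (le_max_left _ _)
  have h1 := h (fun φ => (g φ + L) * (2 * L)⁻¹) ((hg.add_const _).mul_const _)
    (fun φ ψ hφ => mul_le_mul_of_nonneg_right (by linarith [hgm hφ]) (by positivity))
    (fun φ => mul_nonneg (by linarith [(abs_le.1 (hKL φ)).1]) (by positivity))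
    (fun φ => by
      rw [← div_eq_mul_inv, div_le_one (by positivity)]
      linarith [(abs_le.1 (hKL φ)).2])
  have hi : ∀ (m : Measure (ι → ℝ)) [IsProbabilityMeasure m], Integrable g m := fun m _ =>
    (integrable_const L).mono' hg.aestronglyMeasurable
      (Filter.Eventually.of_forall fun φ => hKL φ)
  rw [integral_mul_const, integral_mul_const, integral_add (hi μ) (integrable_const _),
    integral_add (hi ν) (integrable_const _)] at h1
  simp only [integral_const, probReal_univ, one_smul] at h1
  have h2 := le_of_mul_le_mul_right h1 (by positivity : (0:ℝ) < (2 * L)⁻¹)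
  linarith

theorem pi_norm {ι : Type*} [Fintype ι] (ζ : ι → Measure ℝ) [∀ x, IsFiniteMeasure (ζ x)]
    (h0 : ∀ x, ζ x Set.univ ≠ 0) :
    Measure.pi (fun x => (ζ x Set.univ)⁻¹ • ζ x) =
      ((Measure.pi ζ) Set.univ)⁻¹ • Measure.pi ζ := by
  haveI : ∀ x, IsFiniteMeasure ((ζ x Set.univ)⁻¹ • ζ x) := fun x =>
    ⟨by
      rw [Measure.smul_apply, smul_eq_mul, ENNReal.inv_mul_cancel (h0 x) (measure_ne_top _ _)]
      exact ENNReal.one_lt_top⟩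
  refine Measure.pi_eq fun S hS => ?_
  rw [Measure.smul_apply, Measure.pi_pi, Measure.pi_univ, smul_eq_mul]
  simp only [Measure.smul_apply, smul_eq_mul, Finset.prod_mul_distrib]
  rw [ENNReal.prod_inv_distrib]
  intro i _ j _ _
  exact Or.inl (h0 i)

end FinB

namespace FinB

theorem kap_fin (ρ : Measure ℝ) (a c : ℝ) (ha : 0 < a)
    (hint : Integrable (fun u => Real.exp (a * u ^ 2)) ρ) :
    IsFiniteMeasure (ρ.withDensity fun u => ENNReal.ofReal (Real.exp (c * u))) := by
  refine isFiniteMeasure_withDensity_ofReal ?_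
  refine Integrable.hasFiniteIntegral ?_
  refine (hint.const_mul (Real.exp (c ^ 2 / (4 * a)))).mono'
    (by fun_prop) (Filter.Eventually.of_forall fun u => ?_)
  rw [Real.norm_of_nonneg (Real.exp_pos _).le, ← Real.exp_add]
  refine Real.exp_le_exp.2 ?_
  have : c ^ 2 / (4 * a) + a * u ^ 2 - c * u = (c - 2 * a * u) ^ 2 / (4 * a) := by
    field_simp; ring
  have h2 : 0 ≤ (c - 2 * a * u) ^ 2 / (4 * a) := by positivity
  linarith

theorem exp_dens_ne (ρ : Measure ℝ) (hρ : ρ ≠ 0) (q : ℝ → ℝ) (hq : Measurable q) :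
    (ρ.withDensity fun u => ENNReal.ofReal (Real.exp (q u))) Set.univ ≠ 0 := by
  intro h0
  rw [withDensity_apply _ MeasurableSet.univ, Measure.restrict_univ,
    lintegral_eq_zero_iff (by fun_prop)] at h0
  refine hρ (Measure.measure_univ_eq_zero.1 (measure_mono_null ?_ h0))
  intro u _ h2
  have h3 : ENNReal.ofReal (Real.exp (q u)) = 0 := h2
  rw [ENNReal.ofReal_eq_zero] at h3
  linarith [Real.exp_pos (q u)]

theorem Bsq_facts (a Ct A Za Zh B : ℝ) (ha : 0 < a) (hCt : 0 < Ct) (hA : 1 ≤ A) (hZh : 0 < Zh)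
    (hZ : Zh ≤ Za)
    (hB : B = Real.sqrt (2 / a * (Ct * A ^ 2 + Real.log Za - Real.log Zh))) :
    0 < B ∧ B ^ 2 = 2 / a * (Ct * A ^ 2 + Real.log Za - Real.log Zh) ∧
      Real.exp (a * B ^ 2 / 2) = Real.exp (Ct * A ^ 2) * Za / Zh := by
  have hl : Real.log Zh ≤ Real.log Za := Real.log_le_log hZh hZ
  have hp : 0 < Ct * A ^ 2 + Real.log Za - Real.log Zh := by
    have : 0 < Ct * A ^ 2 := by positivity
    linarith
  have h2 : 0 < 2 / a * (Ct * A ^ 2 + Real.log Za - Real.log Zh) := by positivity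
  have hsq : B ^ 2 = 2 / a * (Ct * A ^ 2 + Real.log Za - Real.log Zh) := by
    rw [hB, Real.sq_sqrt h2.le]
  refine ⟨hB ▸ Real.sqrt_pos.2 h2, hsq, ?_⟩
  have : a * B ^ 2 / 2 = Ct * A ^ 2 + Real.log Za - Real.log Zh := by
    rw [hsq]; field_simp
  rw [this, Real.exp_sub, Real.exp_add, Real.exp_log hZh, Real.exp_log (hZh.trans_le hZ)]

theorem B_nbr (a Ct A A' L k : ℝ) (ha : 0 < a) (hCt : 0 < Ct) (hA' : 1 ≤ A') (hL : 0 ≤ L)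
    (hk : 1 ≤ k) (h : A' ≤ k * A) :
    Real.sqrt (2 / a * (Ct * A' ^ 2 + L)) ≤ k * Real.sqrt (2 / a * (Ct * A ^ 2 + L)) := by
  rw [Real.sqrt_le_iff]
  have h0 : 0 ≤ 2 / a * (Ct * A ^ 2 + L) := by positivity
  refine ⟨by positivity, ?_⟩
  rw [mul_pow, Real.sq_sqrt h0]
  have h1 : A' ^ 2 ≤ (k * A) ^ 2 := pow_le_pow_left₀ (by linarith) h 2
  have h2 : L ≤ k ^ 2 * L := le_mul_of_one_le_left hL (one_le_pow₀ hk)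
  have h3 : Ct * A' ^ 2 ≤ Ct * (k * A) ^ 2 := mul_le_mul_of_nonneg_left h1 hCt.le
  calc 2 / a * (Ct * A' ^ 2 + L) ≤ 2 / a * (Ct * (k * A) ^ 2 + k ^ 2 * L) := by gcongr
    _ = _ := by ring

theorem alg_aux (N E W r Z Y : ℝ≥0∞) (h : Y * Z = 1) :
    N * (E * (W * r)) = N * Y * (E * Z * W * r) := by
  calc N * (E * (W * r)) = N * (E * (W * r)) * (Y * Z) := by rw [h, mul_one]
    _ = _ := by ring

/-- the single-site comparison -/
theorem site (ρ : Measure ℝ) [IsFiniteMeasure ρ] (hρ : ρ ≠ 0) (a C Ct A B D T : ℝ) (ha : 0 < a)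
    (hint : Integrable (fun u => Real.exp (a * u ^ 2)) ρ)
    [IsFiniteMeasure (rhoMod ρ a)] [IsFiniteMeasure (rhoMod ρ (a/2))]
    [IsFiniteMeasure (zetaM ρ a B)] (hB : 0 < B) (hD0 : 0 ≤ D) (hD : D ≤ a / 4)
    (hT : T = 3 / 4 * max (C * A) (4 * B))
    (hexp : Real.exp (a * B ^ 2 / 2) = Real.exp (Ct * A ^ 2) * (rhoMod ρ a Set.univ).toReal /
      (rhoMod ρ (a/2) Set.univ).toReal)
    (hreg : ∀ κ : Measure ℝ, IsFiniteMeasure κ →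
      κ = (ρ.withDensity fun u => ENNReal.ofReal (Real.exp (D * C * A * u))) →
      κ Set.univ ≠ 0 → ∀ S : Set ℝ, MeasurableSet S →
      κ S ≤ κ Set.univ * (ENNReal.ofReal (Real.exp (Ct * A ^ 2)) *
        ((rhoMod ρ (a/2) Set.univ)⁻¹ * rhoMod ρ (a/2) S))) :
    Dom1 (chi ρ D T) (zetaM ρ a B) := by
  have hBT : 3 * B ≤ T := by
    rw [hT]; linarith [le_max_right (C * A) (4 * B)]
  haveI := chi_fin ρ a D T hD0 hD (by linarith) hint
  haveI := kap_fin ρ a (4 / 3 * D * T) ha hint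
  have hκ0 := exp_dens_ne ρ hρ (fun u => 4 / 3 * D * T * u) (by fun_prop)
  have hZ0 : rhoMod ρ a Set.univ ≠ 0 := exp_dens_ne ρ hρ (fun u => a * u ^ 2) (by fun_prop)
  have hZh0 : rhoMod ρ (a/2) Set.univ ≠ 0 :=
    exp_dens_ne ρ hρ (fun u => a / 2 * u ^ 2) (by fun_prop)
  refine single ρ a B D T hB hBT hD0 hD _ rfl hκ0 hZ0 ?_
  rcases le_total (C * A) (4 * B) with h | h
  · left
    rw [hT, max_eq_right h]; ring
  · right
    have hT' : 4 / 3 * D * T = D * C * A := by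
      rw [hT, max_eq_left h]; ring
    rw [hT'] at this hκ0 ⊢
    have hr := hreg _ this rfl hκ0
    refine Measure.le_iff.2 fun S hS => (hr S hS).trans (le_of_eq ?_)
    rw [Measure.smul_apply, smul_eq_mul, withDensity_apply (fun u =>
      ENNReal.ofReal (Real.exp (a / 2 * (u ^ 2 + B ^ 2)))) hS]
    have e1 : (∫⁻ u in S, ENNReal.ofReal (Real.exp (a / 2 * (u ^ 2 + B ^ 2))) ∂ρ) =
        ENNReal.ofReal (Real.exp (a * B ^ 2 / 2)) * rhoMod ρ (a/2) S := by
      rw [rhoMod_apply _ _ _ hS, ← lintegral_const_mul _ (by fun_prop)]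
      refine lintegral_congr fun u => ?_
      rw [← ENNReal.ofReal_mul (Real.exp_pos _).le, ← Real.exp_add]
      congr 2; ring
    have e2 : ENNReal.ofReal (Real.exp (a * B ^ 2 / 2)) = ENNReal.ofReal (Real.exp (Ct * A ^ 2)) *
        rhoMod ρ a Set.univ * (rhoMod ρ (a/2) Set.univ)⁻¹ := by
      rw [hexp, ENNReal.ofReal_div_of_pos (ENNReal.toReal_pos hZh0 (measure_ne_top _ _)),
        ENNReal.ofReal_mul (Real.exp_pos _).le, ENNReal.ofReal_toReal (measure_ne_top _ _),
        ENNReal.ofReal_toReal (measure_ne_top _ _), div_eq_mul_inv]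
    rw [e1, e2, div_eq_mul_inv]
    have hc : (rhoMod ρ a Set.univ)⁻¹ * rhoMod ρ a Set.univ = 1 :=
      ENNReal.inv_mul_cancel hZ0 (measure_ne_top _ _)
    exact alg_aux _ _ _ _ _ _ hc

theorem zeta_univ (ρ : Measure ℝ) (a B : ℝ) :
    zetaM ρ a B Set.univ = rhoMod ρ a (Set.Ici 0) := by
  rw [zeta_apply _ _ _ _ MeasurableSet.univ]
  congr 1
  ext u
  simp

theorem hamil_eq {V : Type*} (J : V → V → ℝ) (β : ℝ) (Λ : Finset V) (ξ : V → ℝ) (φ : ↥Λ → ℝ) :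
    hamil J β Λ ξ φ = HH (fun x y : ↥Λ => if x.1 ≠ y.1 then β * J x.1 y.1 else 0)
      (fun x => β * ∑' y : {y : V // y ∉ (↑Λ : Set V)}, J x.1 y.1 * ξ y.1) φ := by
  unfold hamil HH
  rw [mul_add, add_comm]
  congr 1
  · rw [Finset.mul_sum]
    refine Finset.sum_congr rfl fun x _ => ?_
    have : (∑' y : {y : V // y ∉ Λ}, J x.1 y.1 * ξ y.1) =
      ∑' y : {y : V // y ∉ (↑Λ : Set V)}, J x.1 y.1 * ξ y.1 := rfl
    rw [this]; ring
  · rw [← mul_assoc, mul_comm β, mul_assoc]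
    congr 1
    rw [Finset.mul_sum]
    refine Finset.sum_congr rfl fun x _ => ?_
    rw [Finset.mul_sum]
    refine Finset.sum_congr rfl fun y _ => ?_
    beta_reduce
    by_cases hxy : x.1 = y.1
    · rw [if_neg (not_not.2 hxy), if_neg (not_not.2 hxy)]; ring
    · rw [if_pos hxy, if_pos hxy]; ring

/-- Passing from the comparison of integrals to stochastic domination of marginals. -/
theorem finish {V : Type*} (J : V → V → ℝ) (β : ℝ) (ρ : Measure ℝ) [IsFiniteMeasure ρ]
    (hρ : ρ ≠ 0)
    (Λ Λ' : Finset V) (hsub : Λ' ⊆ Λ) (ξ : V → ℝ) (ζ : V → Measure ℝ)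
    [∀ x, IsFiniteMeasure (ζ x)] (hζ0 : ∀ x, ζ x Set.univ ≠ 0)
    (hmeas : Measurable (hamil J β Λ ξ))
    (hI : Integrable (fun φ => Real.exp (hamil J β Λ ξ φ)) (Measure.pi fun _ : ↥Λ => ρ))
    (h : ∀ g : (↥Λ → ℝ) → ℝ, Measurable g → Monotone g → (∀ φ, 0 ≤ g φ) → (∀ φ, g φ ≤ 1) →
      (∫ φ, Real.exp (hamil J β Λ ξ φ) * g φ ∂(Measure.pi fun _ : ↥Λ => ρ)) ≤
      (∫ φ, g φ ∂(Measure.pi fun x : ↥Λ => (ζ x.1 Set.univ)⁻¹ • ζ x.1)) *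
      (∫ φ, Real.exp (hamil J β Λ ξ φ) ∂(Measure.pi fun _ : ↥Λ => ρ))) :
    StochDom (marg hsub (gibbs J β ρ Λ ξ))
      (((Measure.pi fun x : ↥Λ' => ζ x.1) Set.univ)⁻¹ • Measure.pi fun x : ↥Λ' => ζ x.1) := by
  rw [← pi_norm (fun x : ↥Λ' => ζ x.1) (fun x => hζ0 x.1)]
  haveI hpr : ∀ x, IsProbabilityMeasure ((ζ x Set.univ)⁻¹ • ζ x) := fun x =>
    ⟨by rw [Measure.smul_apply, smul_eq_mul, ENNReal.inv_mul_cancel (hζ0 x) (measure_ne_top _ _)]⟩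
  set N := ∫ φ, Real.exp (hamil J β Λ ξ φ) ∂(Measure.pi fun _ : ↥Λ => ρ) with hN
  haveI : NeZero ρ := ⟨hρ⟩
  have hpi0 : (Measure.pi fun _ : ↥Λ => ρ) ≠ 0 := by
    intro h0
    have := congrArg (fun m => m Set.univ) h0
    simp only [Measure.pi_univ, Measure.coe_zero, Pi.zero_apply, Finset.prod_eq_zero_iff] at this
    obtain ⟨_, _, h1⟩ := this
    exact hρ (Measure.measure_univ_eq_zero.1 h1)
  haveI : NeZero (Measure.pi fun _ : ↥Λ => ρ) := ⟨hpi0⟩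
  have hNpos : 0 < N := integral_exp_pos hI
  have hNe : ((Measure.pi fun _ : ↥Λ => ρ).withDensity
      fun φ => ENNReal.ofReal (Real.exp (hamil J β Λ ξ φ))) Set.univ = ENNReal.ofReal N := by
    rw [withDensity_apply _ MeasurableSet.univ, Measure.restrict_univ, hN,
      ofReal_integral_eq_lintegral_ofReal hI
        (Filter.Eventually.of_forall fun φ => (Real.exp_pos _).le)]
  have hN0 : ENNReal.ofReal N ≠ 0 := by simpa using hNpos
  have hgp : IsProbabilityMeasure (gibbs J β ρ Λ ξ) := by
    constructor
    unfold gibbs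
    rw [Measure.smul_apply, smul_eq_mul, hNe, ENNReal.inv_mul_cancel hN0 ENNReal.ofReal_ne_top]
  have hrm : Measurable (fun (φ : ↥Λ → ℝ) (x : ↥Λ') => φ ⟨x.1, hsub x.2⟩) :=
    measurable_pi_lambda _ fun x => measurable_pi_apply _
  haveI hmp : IsProbabilityMeasure (marg hsub (gibbs J β ρ Λ ξ)) :=
    Measure.isProbabilityMeasure_map hrm.aemeasurable
  have hproj : (Measure.pi fun x : ↥Λ' => (ζ x.1 Set.univ)⁻¹ • ζ x.1) =
      (Measure.pi fun x : ↥Λ => (ζ x.1 Set.univ)⁻¹ • ζ x.1).map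
        (fun (φ : ↥Λ → ℝ) (x : ↥Λ') => φ ⟨x.1, hsub x.2⟩) :=
    isProjectiveMeasureFamily_pi (fun x => (ζ x Set.univ)⁻¹ • ζ x) Λ Λ' hsub
  refine stoch_of01 _ _ fun g hg hgm hg0 hg1 => ?_
  rw [hproj]
  unfold marg
  rw [integral_map hrm.aemeasurable hg.aestronglyMeasurable,
    integral_map hrm.aemeasurable hg.aestronglyMeasurable]
  have h1 := h (fun φ => g fun x : ↥Λ' => φ ⟨x.1, hsub x.2⟩) (hg.comp hrm)
    (fun φ ψ hφ => hgm fun x => hφ _) (fun φ => hg0 _) (fun φ => hg1 _)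
  unfold gibbs
  rw [hNe, integral_smul_measure, integral_withDensity_eq_integral_toReal_smul
    (by fun_prop) (Filter.Eventually.of_forall fun φ => ENNReal.ofReal_lt_top)]
  simp only [ENNReal.toReal_ofReal (Real.exp_pos _).le, smul_eq_mul, ENNReal.toReal_inv,
    ENNReal.toReal_ofReal hNpos.le]
  rw [inv_mul_le_iff₀ hNpos, mul_comm N]
  exact h1

end FinB

namespace FinB

theorem main {V : Type*} (J : V → V → ℝ) (f : ℝ → ℝ)
    (Mf : ℝ)
    (hJsymm : ∀ x y, J x y = J y x)
    (hf1 : ∀ t, 1 ≤ f t)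
    (hJsum : ∀ x, Summable fun y => |J x y| * f (J x y))
    (hJbound : ∀ x, ∑' y, |J x y| * f (J x y) ≤ Mf)
    (β : ℝ) (hβ : 0 ≤ β) (a : ℝ) (ha : 0 < a)
    (ρ : Measure ℝ)
    (hρfin : ∫⁻ u, ENNReal.ofReal (Real.exp (a * u ^ 2)) ∂ρ < ⊤)
    (hρpos : 0 < ρ (Set.Ici (0 : ℝ)))
    (lam : ℝ) (hlam1 : 1 ≤ lam) (hlam2 : 4 * β * Mf * lam ≤ a)
    (C Ct : ℝ) (hC : 1 ≤ C) (hCt : 0 < Ct)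
    (hreg : ∀ (Λ Λ' : Finset V) (hsub : Λ' ⊆ Λ) (ξ : V → ℝ),
      (∀ x ∈ Λ, Summable fun y => |J x y * ξ y|) →
      marg hsub (gibbs J β ρ Λ ξ) ≤
        ENNReal.ofReal (∏ x ∈ Λ', Real.exp (Ct * ARealL J f lam ξ C x (↑Λ) ^ 2)) •
        prodN (rhoMod ρ (a / 2)) Λ')
    (Λ Λ' : Finset V) (hsub : Λ' ⊆ Λ) (ξ : V → ℝ) :
    StochDom (marg hsub (gibbs J β ρ Λ ξ))
      (((Measure.pi fun x : ↥Λ' => zetaM ρ a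
          (Real.sqrt (2 / a * (Ct * ARealL J f lam ξ C x.1 (↑Λ) ^ 2 +
            Real.log ((rhoMod ρ a) Set.univ).toReal -
            Real.log ((rhoMod ρ (a / 2)) Set.univ).toReal)))) Set.univ)⁻¹ •
        Measure.pi fun x : ↥Λ' => zetaM ρ a
          (Real.sqrt (2 / a * (Ct * ARealL J f lam ξ C x.1 (↑Λ) ^ 2 +
            Real.log ((rhoMod ρ a) Set.univ).toReal -
            Real.log ((rhoMod ρ (a / 2)) Set.univ).toReal)))) := by
  have hρ : ρ ≠ 0 := by
    rintro rfl
    simp at hρpos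
  have hfin : IsFiniteMeasure ρ := by
    refine ⟨lt_of_le_of_lt ?_ hρfin⟩
    rw [← lintegral_one]
    refine lintegral_mono fun u => ?_
    rw [← ENNReal.ofReal_one]
    refine ENNReal.ofReal_le_ofReal (Real.one_le_exp (by positivity))
  have hint : Integrable (fun u => Real.exp (a * u ^ 2)) ρ := by
    refine ⟨by fun_prop, ?_⟩
    rw [hasFiniteIntegral_iff_ofReal (Filter.Eventually.of_forall fun u => (Real.exp_pos _).le)]
    exact hρfin
  have hmono : ∀ u : ℝ, Real.exp (a / 2 * u ^ 2) ≤ Real.exp (a * u ^ 2) := fun u =>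
    Real.exp_le_exp.2 (by nlinarith [sq_nonneg u])
  have hint2 : Integrable (fun u => Real.exp (a / 2 * u ^ 2)) ρ := by
    refine hint.mono' (by fun_prop) (Filter.Eventually.of_forall fun u => ?_)
    rw [Real.norm_of_nonneg (Real.exp_pos _).le]
    exact hmono u
  haveI fa : IsFiniteMeasure (rhoMod ρ a) := isFiniteMeasure_withDensity_ofReal hint.2
  haveI fh : IsFiniteMeasure (rhoMod ρ (a/2)) := isFiniteMeasure_withDensity_ofReal hint2.2
  have eZ : ∀ b : ℝ, Integrable (fun u => Real.exp (b * u ^ 2)) ρ →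
      (rhoMod ρ b Set.univ).toReal = ∫ u, Real.exp (b * u ^ 2) ∂ρ := by
    intro b hb
    rw [rhoMod_apply _ _ _ MeasurableSet.univ, Measure.restrict_univ,
      ← ofReal_integral_eq_lintegral_ofReal hb
        (Filter.Eventually.of_forall fun u => (Real.exp_pos _).le),
      ENNReal.toReal_ofReal (integral_nonneg fun u => (Real.exp_pos _).le)]
  have hZh : 0 < (rhoMod ρ (a/2) Set.univ).toReal :=
    ENNReal.toReal_pos (exp_dens_ne ρ hρ (fun u => a / 2 * u ^ 2) (by fun_prop))
      (measure_ne_top _ _)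
  have hZ : (rhoMod ρ (a/2) Set.univ).toReal ≤ (rhoMod ρ a Set.univ).toReal := by
    rw [eZ _ hint, eZ _ hint2]
    exact integral_mono hint2 hint hmono
  have hL : 0 ≤ Real.log (rhoMod ρ a Set.univ).toReal -
      Real.log (rhoMod ρ (a/2) Set.univ).toReal := sub_nonneg.2 (Real.log_le_log hZh hZ)
  set A : V → ℝ := fun x => ARealL J f lam ξ C x (↑Λ) with hAdef
  set B : V → ℝ := fun x => Real.sqrt (2 / a * (Ct * A x ^ 2 +
    Real.log ((rhoMod ρ a) Set.univ).toReal -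
    Real.log ((rhoMod ρ (a / 2)) Set.univ).toReal)) with hBdef
  have hA1 : ∀ x, 1 ≤ A x := fun x => (AReal_mem J f lam C hf1 hlam1 hC ξ x hJsum Λ).1
  have hBf := fun x => Bsq_facts a Ct (A x) _ _ (B x) ha hCt (hA1 x) hZh hZ rfl
  set T : V → ℝ := fun x => 3 / 4 * max (C * A x) (4 * B x) with hTdef
  set D : V → ℝ := fun x => β * lam *
    ∑' z : {z : V // z ∉ (↑({x} : Finset V) : Set V)}, |J x z.1| * f (J x z.1) with hDdef
  have hBT : ∀ x, 3 * B x ≤ T x := fun x => by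
    have := le_max_right (C * A x) (4 * B x)
    simp only [hTdef]; linarith
  have hT0 : ∀ x, 0 < T x := fun x => by linarith [hBT x, (hBf x).1]
  have hlam0 : 0 ≤ lam := by linarith
  have hD0 : ∀ x, 0 ≤ D x := fun x =>
    mul_nonneg (mul_nonneg hβ hlam0) (d_nonneg J f hf1 _ x)
  have hD : ∀ x, D x ≤ a / 4 := by
    intro x
    have h1 := (hJsum x).sum_add_tsum_subtype_compl {x}
    rw [Finset.sum_singleton] at h1
    have h2 : 0 ≤ |J x x| * f (J x x) := mul_nonneg (abs_nonneg _) (zero_le_one.trans (hf1 _))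
    have h3 : (∑' z : {z : V // z ∉ (↑({x} : Finset V) : Set V)}, |J x z.1| * f (J x z.1)) ≤ Mf := by
      have h4 : (∑' z : {z : V // z ∉ (↑({x} : Finset V) : Set V)}, |J x z.1| * f (J x z.1)) =
        ∑' z : {z : V // z ∉ ({x} : Finset V)}, |J x z.1| * f (J x z.1) := rfl
      rw [h4]
      linarith [hJbound x]
    have h5 : D x ≤ β * lam * Mf := mul_le_mul_of_nonneg_left h3 (mul_nonneg hβ hlam0)
    linarith
  have hζu : ∀ x, zetaM ρ a (B x) Set.univ = rhoMod ρ a (Set.Ici 0) := fun x => zeta_univ ρ a _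
  haveI fζ : ∀ x, IsFiniteMeasure (zetaM ρ a (B x)) := fun x =>
    ⟨by rw [hζu]; exact measure_lt_top _ _⟩
  have hζ0 : ∀ x, zetaM ρ a (B x) Set.univ ≠ 0 := by
    intro x
    rw [hζu]
    have hle : ρ (Set.Ici 0) ≤ rhoMod ρ a (Set.Ici 0) := by
      rw [rhoMod_apply _ _ _ measurableSet_Ici, ← setLIntegral_one]
      refine lintegral_mono fun u => ?_
      rw [← ENNReal.ofReal_one]
      exact ENNReal.ofReal_le_ofReal (Real.one_le_exp (by positivity))
    exact (hρpos.trans_le hle).ne'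
  haveI hpr : ∀ x : ↥Λ, IsProbabilityMeasure
      ((zetaM ρ a (B x.1) Set.univ)⁻¹ • zetaM ρ a (B x.1)) := fun x =>
    ⟨by rw [Measure.smul_apply, smul_eq_mul,
      ENNReal.inv_mul_cancel (hζ0 x.1) (measure_ne_top _ _)]⟩
  have hdom : ∀ x, Dom1 (chi ρ (D x) (T x)) (zetaM ρ a (B x)) := by
    intro x
    refine site ρ hρ a C Ct (A x) (B x) (D x) (T x) ha hint (hBf x).1 (hD0 x) (hD x) rfl
      (hBf x).2.2 ?_
    intro κ hκf hκ hκ0 S hS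
    exact reg1 J f lam C hf1 hJsum β a Ct ρ hlam1 hC hCt hreg x (A x) (hA1 x) (D x) rfl κ hκ hκ0
      S hS
  have hTn : ∀ x y, y ∈ Λ → J x y ≠ 0 → T y ≤ lam * f (J x y) * T x := by
    intro x y hy hJ
    have hk : 1 ≤ lam * f (J x y) := by nlinarith [hf1 (J x y)]
    have h1 : A y ≤ lam * f (J x y) * A x := AReal_nbr J f lam C hf1 hlam1 hC ξ hJsum Λ x y hy hJ
    have h2 : B y ≤ lam * f (J x y) * B x := by
      have := B_nbr a Ct (A x) (A y) _ (lam * f (J x y)) ha hCt (hA1 y) hL hk h1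
      simp only [hBdef, add_sub_assoc]
      exact this
    simp only [hTdef]
    have h3 : max (C * A y) (4 * B y) ≤ lam * f (J x y) * max (C * A x) (4 * B x) := by
      refine max_le ?_ ?_
      · calc C * A y ≤ C * (lam * f (J x y) * A x) :=
              mul_le_mul_of_nonneg_left h1 (by linarith)
          _ = lam * f (J x y) * (C * A x) := by ring
          _ ≤ _ := mul_le_mul_of_nonneg_left (le_max_left _ _) (by linarith)
      · calc 4 * B y ≤ 4 * (lam * f (J x y) * B x) :=
              mul_le_mul_of_nonneg_left h2 (by norm_num)
          _ = lam * f (J x y) * (4 * B x) := by ring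
          _ ≤ _ := mul_le_mul_of_nonneg_left (le_max_right _ _) (by linarith)
    linarith
  have hkey := fun x => key ρ hρ a (B x) (T x) ha (hBf x).1 (hBT x) hint hint2 (by
    rw [(hBf x).2.2, ← eZ _ hint, ← eZ _ hint2, div_mul_cancel₀ _ hZh.ne']
    refine le_mul_of_one_le_left (hZh.le.trans hZ) (Real.one_le_exp ?_)
    positivity)
  have hep0 : ∀ (t : ℝ) (s : ℝ → ℝ), 0 ≤ ∫ u, ep t (s u) * Real.exp (13 / 16 * a * u ^ 2) ∂ρ :=
    fun t s => integral_nonneg fun u => mul_nonneg (ep_nonneg _ _) (Real.exp_pos _).le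
  have hCD : CDat (ι := ↥Λ) ρ (fun x y : ↥Λ => if x.1 ≠ y.1 then β * J x.1 y.1 else 0) a
      (fun x => β * ∑' y : {y : V // y ∉ (↑Λ : Set V)}, J x.1 y.1 * ξ y.1)
      (fun x => T x.1) (fun x => B x.1) (fun x => D x.1) := by
    refine ⟨⟨fun x => β * lam *
      ∑' z : {z : V // z ∉ (↑Λ : Set V)}, |J x.1 z.1| * f (J x.1 z.1),
      fun x => β * lam * ∑ y : ↥Λ, (if x.1 ≠ y.1 then |J x.1 y.1| * f (J x.1 y.1) else 0),
      fun x => (∫ u, ep (T x.1) u * Real.exp (13 / 16 * a * u ^ 2) ∂ρ) /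
        (ρ (Set.Icc (-B x.1) (B x.1))).toReal,
      fun x => (∫ u, ep (T x.1) (-u) * Real.exp (13 / 16 * a * u ^ 2) ∂ρ) /
        (ρ (Set.Icc (-B x.1) (B x.1))).toReal, ?_, ?_, ?_, ?_, ?_, ?_, ?_, ?_, ?_, ?_⟩,
      fun x => (hkey x.1).1, hint, ?_, ?_, ha, fun x => hD x.1, fun x => (hBf x.1).1,
      fun x => hBT x.1⟩
    · exact fun x => mul_nonneg (mul_nonneg hβ hlam0) (d_nonneg J f hf1 _ _)
    · intro x
      beta_reduce
      rw [← mul_add, sum_split J f hJsum Λ x.1 x.2]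
    · intro x
      beta_reduce
      rw [abs_mul, abs_of_nonneg hβ]
      have h1 := AReal_h J f lam C hf1 hlam1 hC ξ hJsum Λ x.1 x.2
      have h2 := d_nonneg J f hf1 (↑Λ : Set V) x.1
      have h3 := le_max_left (C * A x.1) (4 * B x.1)
      have h4 := mul_le_mul_of_nonneg_left h1 hβ
      refine h4.trans ?_
      have h5 := mul_le_mul_of_nonneg_left h3 (mul_nonneg (mul_nonneg hβ hlam0) h2)
      have h6 : A x.1 = ARealL J f lam ξ C x.1 (↑Λ) := rfl
      rw [← h6]
      simp only [hTdef]
      linarith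
    · intro x
      beta_reduce
      rw [mul_assoc, Finset.sum_mul, Finset.mul_sum]
      refine Finset.sum_le_sum fun y _ => ?_
      by_cases hxy : x.1 = y.1
      · rw [if_neg (not_not.2 hxy), if_neg (not_not.2 hxy)]
        simp
      · rw [if_pos hxy, if_pos hxy, abs_mul, abs_of_nonneg hβ]
        by_cases hJ : J x.1 y.1 = 0
        · simp [hJ]
        · have h1 := mul_le_mul_of_nonneg_left (hTn x.1 y.1 y.2 hJ)
            (mul_nonneg hβ (abs_nonneg (J x.1 y.1)))
          refine h1.trans (le_of_eq ?_)
          ring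
    · intro x
      beta_reduce
      rw [Finset.mul_sum]
      refine Finset.sum_le_sum fun y _ => ?_
      by_cases hxy : x.1 = y.1
      · rw [if_neg (not_not.2 hxy), if_neg (not_not.2 hxy)]
        simp
      · rw [if_pos hxy, if_pos hxy, abs_mul, abs_of_nonneg hβ]
        have hk : 1 ≤ lam * f (J x.1 y.1) := by nlinarith [hf1 (J x.1 y.1)]
        calc β * |J x.1 y.1| ≤ β * |J x.1 y.1| * (lam * f (J x.1 y.1)) :=
              le_mul_of_one_le_right (mul_nonneg hβ (abs_nonneg _)) hk
          _ = _ := by ring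
    · exact fun x => div_nonneg (hep0 _ fun u => u) ENNReal.toReal_nonneg
    · exact fun x => div_nonneg (hep0 _ fun u => -u) ENNReal.toReal_nonneg
    · intro x
      beta_reduce
      rw [← add_div, div_le_iff₀ (hkey x.1).1]
      exact (hkey x.1).2
    · intro x
      beta_reduce
      rw [div_mul_cancel₀ _ (hkey x.1).1.ne']
    · intro x
      beta_reduce
      rw [div_mul_cancel₀ _ (hkey x.1).1.ne']
    · intro x y
      beta_reduce
      by_cases hxy : x.1 = y.1
      · rw [if_neg (not_not.2 hxy), if_neg (not_not.2 hxy.symm)]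
      · rw [if_pos hxy, if_pos (Ne.symm hxy), hJsymm]
    · intro x
      simp
  have hhe : ∀ φ, hamil J β Λ ξ φ = _ := hamil_eq J β Λ ξ
  have hcont : Continuous (hamil J β Λ ξ) := by
    rw [funext hhe]
    exact HH_cont _ _
  refine finish J β ρ hρ Λ Λ' hsub ξ (fun x => zetaM ρ a (B x)) hζ0 hcont.measurable ?_ ?_
  · obtain ⟨⟨Do, Di, εp, εn, hDo, hDD, hθ, hKT, hKsum, hεp0, hεn0, hεs, hεp, hεn⟩, hcore, _, hKs,
      hKd, _, hD', hB', hBT'⟩ := hCD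
    refine (bd_int hint (fun x : ↥Λ => (β * ∑' y : {y : V // y ∉ (↑Λ : Set V)},
      J x.1 y.1 * ξ y.1) ^ 2 / (2 * a))).mono' (hcont.rexp).aestronglyMeasurable
      (Filter.Eventually.of_forall fun φ => ?_)
    rw [Real.norm_of_nonneg (Real.exp_pos _).le, hhe]
    exact F1_le ha hKs (fun x => by linarith [hKsum x, hDo x, hDD x, hD' x]) φ
  · intro g hg hgm hg0 hg1
    simp only [hhe]
    exact full hCD (fun x => hD0 x.1) _ (fun x => (hdom x.1).smul _) g hg hgm hg0 hg1

end FinB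

/-- Corollary `domination corollary`: stochastic domination by a
shifted product measure. Let `J` satisfy the integrability condition with `n = 2`,
`β ≥ 0`, `a ≥ 4βM_f`, `ρ([0,∞)) > 0`, `1 ≤ λ ≤ a/(4βM_f)`, and let `C ≥ 1`, `C̃ > 0`
be constants satisfying the `n = 2` regularity theorem. With
`B_x = ((2/a)(C̃ A(x,Λ,λ,ξ,C)² + log ρ_a(ℝ) - log ρ_{a/2}(ℝ)))^{1/2}` and
`dζ_x(u) = 1_{u ≥ B_x} dρ_a(u - B_x)`, the `Λ'`-marginal of `ν^ξ_{Λ,β,ρ,J}` is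
stochastically dominated by the normalized product measure `∏_{x∈Λ'} dζ_x/ζ_x(ℝ)`. -/
theorem stmt15 {V : Type*} [Countable V] (J : V → V → ℝ) (f : ℝ → ℝ)
    (δf Mf : ℝ) (hδf : 0 < δf) (hMf : 0 < Mf)
    (hJsymm : ∀ x y, J x y = J y x)
    (hf1 : ∀ t, 1 ≤ f t)
    (hflog : ∀ t : ℝ, t ≠ 0 → |t| < δf → (Real.log (|t|⁻¹)) ^ ((1 : ℝ) / 2) ≤ f t)
    (hJsum : ∀ x, Summable fun y => |J x y| * f (J x y))
    (hJbound : ∀ x, ∑' y, |J x y| * f (J x y) ≤ Mf)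
    (β : ℝ) (hβ : 0 ≤ β) (a : ℝ) (ha4 : 4 * β * Mf ≤ a) (ha : 0 < a)
    (ρ : Measure ℝ)
    (hρ0 : 0 < ∫⁻ u, ENNReal.ofReal (Real.exp (a * u ^ 2)) ∂ρ)
    (hρfin : ∫⁻ u, ENNReal.ofReal (Real.exp (a * u ^ 2)) ∂ρ < ⊤)
    (hρpos : 0 < ρ (Set.Ici (0 : ℝ)))
    (lam : ℝ) (hlam1 : 1 ≤ lam) (hlam2 : 4 * β * Mf * lam ≤ a)
    (C Ct : ℝ) (hC : 1 ≤ C) (hCt : 0 < Ct)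
    -- `C` and `C̃` are constants for which the `n = 2` regularity theorem holds:
    (hreg : ∀ (Λ Λ' : Finset V) (hsub : Λ' ⊆ Λ) (ξ : V → ℝ),
      (∀ x ∈ Λ, Summable fun y => |J x y * ξ y|) →
      marg hsub (gibbs J β ρ Λ ξ) ≤
        ENNReal.ofReal (∏ x ∈ Λ', Real.exp (Ct * ARealL J f lam ξ C x (↑Λ) ^ 2)) •
        prodN (rhoMod ρ (a / 2)) Λ')
    (Λ Λ' : Finset V) (hsub : Λ' ⊆ Λ) (ξ : V → ℝ)
    (hξ : ∀ x ∈ Λ, Summable fun y => |J x y * ξ y|) :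
    StochDom (marg hsub (gibbs J β ρ Λ ξ))
      (((Measure.pi fun x : ↥Λ' => zetaM ρ a
          (Real.sqrt (2 / a * (Ct * ARealL J f lam ξ C x.1 (↑Λ) ^ 2 +
            Real.log ((rhoMod ρ a) Set.univ).toReal -
            Real.log ((rhoMod ρ (a / 2)) Set.univ).toReal)))) Set.univ)⁻¹ •
        Measure.pi fun x : ↥Λ' => zetaM ρ a
          (Real.sqrt (2 / a * (Ct * ARealL J f lam ξ C x.1 (↑Λ) ^ 2 +
            Real.log ((rhoMod ρ a) Set.univ).toReal -
            Real.log ((rhoMod ρ (a / 2)) Set.univ).toReal)))) := by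
  exact FinB.main J f Mf hJsymm hf1 hJsum hJbound β hβ a ha ρ hρfin hρpos lam hlam1 hlam2 C Ct hC hCt
    hreg Λ Λ' hsub ξ
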